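/- arXiv:2303.05507 — 2 statements merged into one kernel-verified Lean document; each statement's English description precedes it below -/
import Mathlib

section
/- Let n ≥ 2. If φ is a partial proper edge coloring of at most n edges of K_{2n} □ K_2, then φ is extendable to a proper 2n-edge coloring of K_{2n} □ K_2. -/
open SimpleGraph

variable {V : Type*}

/-- Two edges of `G` are adjacent if both are edges, they are distinct,
and they share a vertex. -/
def EdgeAdj (G : SimpleGraph V) (e f : Sym2 V) : Prop :=
  e ∈ G.edgeSet ∧ f ∈ G.edgeSet ∧ e ≠ f ∧ ∃ v, v ∈ e ∧ v ∈ f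

/-- A proper edge coloring (with natural-number colors). -/
def IsProperEdgeColoring (G : SimpleGraph V) (C : Sym2 V → ℕ) : Prop :=
  ∀ ⦃e f⦄, EdgeAdj G e f → C e ≠ C f

/-- A partial proper edge coloring: colored edges are edges of `G`, and
adjacent colored edges receive distinct colors. -/
def IsPartialProperEdgeColoring (G : SimpleGraph V) (φ : Sym2 V → Option ℕ) : Prop :=
  (∀ e, φ e ≠ none → e ∈ G.edgeSet) ∧
  ∀ ⦃e f⦄, EdgeAdj G e f → φ e ≠ none → φ e ≠ φ f

/-- The partial coloring uses colors from `{0, ..., t-1}`. -/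
def UsesColors (φ : Sym2 V → Option ℕ) (t : ℕ) : Prop :=
  ∀ e a, φ e = some a → a < t

/-- The (total) coloring uses colors from `{0, ..., t-1}` on all edges of `G`. -/
def ColorsBelow (G : SimpleGraph V) (C : Sym2 V → ℕ) (t : ℕ) : Prop :=
  ∀ e ∈ G.edgeSet, C e < t

/-- `C` agrees with the partial coloring `φ` on all precolored edges. -/
def ExtendsColoring (C : Sym2 V → ℕ) (φ : Sym2 V → Option ℕ) : Prop :=
  ∀ e a, φ e = some a → C e = a

/-- `φ` extends to a proper edge coloring of `G` with `t` colors. -/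
def Extendable (G : SimpleGraph V) (φ : Sym2 V → Option ℕ) (t : ℕ) : Prop :=
  ∃ C, IsProperEdgeColoring G C ∧ ColorsBelow G C t ∧ ExtendsColoring C φ

/-- The set of precolored edges of `φ`. -/
def Precolored (φ : Sym2 V → Option ℕ) : Set (Sym2 V) := {e | φ e ≠ none}

/-- The chromatic index: least `t` admitting a proper edge coloring with `t` colors. -/
noncomputable def chromaticIndex (G : SimpleGraph V) : ℕ :=
  sInf {t | ∃ C, IsProperEdgeColoring G C ∧ ColorsBelow G C t}

/-- A set of edges is independent (a matching) if no two distinct members share a vertex. -/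
def IndependentEdges (S : Set (Sym2 V)) : Prop :=
  ∀ e ∈ S, ∀ f ∈ S, e ≠ f → ∀ v, v ∈ e → v ∉ f

set_option linter.unusedSectionVars false

section Items

variable {V ι C : Type*} [DecidableEq V] [DecidableEq ι] [DecidableEq C]

/-- The items of `M`, viewed as edges of a multigraph via `ends`, form a matching. -/
def ItemMatching (ends : ι → Sym2 V) (M : Finset ι) : Prop :=
  ∀ i ∈ M, ∀ j ∈ M, i ≠ j → ∀ v, v ∈ ends i → v ∉ ends j

/-- The items of `I` are properly coloured by `f`. -/
def ItemProper (ends : ι → Sym2 V) (I : Finset ι) (f : ι → C) : Prop :=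
  ∀ i ∈ I, ∀ j ∈ I, i ≠ j → f i = f j → ∀ v, v ∈ ends i → v ∉ ends j

theorem ItemMatching.mono {ends : ι → Sym2 V} {M N : Finset ι} (h : ItemMatching ends N)
    (hs : M ⊆ N) : ItemMatching ends M :=
  fun i hi j hj => h i (hs hi) j (hs hj)

theorem ItemMatching.insert {ends : ι → Sym2 V} {M : Finset ι} {e : ι}
    (h : ItemMatching ends M) (he : ∀ j ∈ M, ∀ v, v ∈ ends e → v ∉ ends j) :
    ItemMatching ends (insert e M) := by
  intro i hi j hj hij v hv hv'
  rw [Finset.mem_insert] at hi hj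
  rcases hi with rfl | hi <;> rcases hj with rfl | hj
  · exact hij rfl
  · exact he j hj v hv hv'
  · exact he i hi v hv' hv
  · exact h i hi j hj hij v hv hv'

theorem ItemMatching.card_biUnion {ends : ι → Sym2 V} {M : Finset ι} (h : ItemMatching ends M)
    (hd : ∀ i ∈ M, ¬ (ends i).IsDiag) :
    (M.biUnion fun i => (ends i).toFinset).card = 2 * M.card := by
  rw [Finset.card_biUnion]
  · rw [Finset.sum_congr rfl fun i hi => Sym2.card_toFinset_of_not_isDiag _ (hd i hi)]
    simp [mul_comm]
  · intro i hi j hj hij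
    refine Finset.disjoint_left.2 fun v hv hv' => ?_
    rw [Sym2.mem_toFinset] at hv hv'
    exact h i hi j hj hij v hv hv'

theorem ItemMatching.exchange {ends : ι → Sym2 V} (n : ℕ) : ∀ {X Y : Finset ι}, Y.card = n →
    Disjoint X Y → ItemMatching ends X → ItemMatching ends Y →
    (∀ i ∈ X ∪ Y, ¬ (ends i).IsDiag) → Y.card < X.card →
    ∃ X' Y', Disjoint X' Y' ∧ X' ∪ Y' = X ∪ Y ∧ ItemMatching ends X' ∧ ItemMatching ends Y' ∧
      Y'.card = Y.card + 1 := by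
  induction n with
  | zero =>
    intro X Y hn hXY hX hY hd hlt
    obtain ⟨e, he⟩ := Finset.card_pos.1 (by omega : 0 < X.card)
    obtain rfl := Finset.card_eq_zero.1 hn
    refine ⟨X.erase e, {e}, by simp, ?_, hX.mono (Finset.erase_subset _ _), ?_, by simp⟩
    · ext x; by_cases x = e <;> grind
    · intro i hi j hj hij; grind
  | succ n ih =>
    intro X Y hn hXY hX hY hd hlt
    have hns : ¬ (X.biUnion fun i => (ends i).toFinset) ⊆ Y.biUnion fun i => (ends i).toFinset := by
      intro hs
      have := Finset.card_le_card hs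
      rw [hX.card_biUnion fun i hi => hd i (by simp [hi]),
        hY.card_biUnion fun i hi => hd i (by simp [hi])] at this
      omega
    rw [Finset.not_subset] at hns
    obtain ⟨u, hu, huY⟩ := hns
    simp only [Finset.mem_biUnion, Sym2.mem_toFinset, not_exists, not_and] at hu huY
    obtain ⟨e, he, hue⟩ := hu
    obtain ⟨v, hv⟩ := Sym2.mem_iff_exists.1 hue
    have heY : e ∉ Y := Finset.disjoint_left.1 hXY he
    by_cases hvY : ∃ f ∈ Y, v ∈ ends f
    · obtain ⟨f, hf, hvf⟩ := hvY
      obtain ⟨w, hw⟩ := Sym2.mem_iff_exists.1 hvf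
      have hfX : f ∉ X := Finset.disjoint_right.1 hXY hf
      obtain ⟨X₂, Y₂, hdis, hun, hX₂, hY₂, hc⟩ := ih (X := X.erase e) (Y := Y.erase f)
        (by rw [Finset.card_erase_of_mem hf]; omega)
        (hXY.mono (Finset.erase_subset _ _) (Finset.erase_subset _ _))
        (hX.mono (Finset.erase_subset _ _)) (hY.mono (Finset.erase_subset _ _))
        (fun i hi => hd i (by grind))
        (by rw [Finset.card_erase_of_mem hf, Finset.card_erase_of_mem he]; omega)
      rw [Finset.card_erase_of_mem hf] at hc
      have hmem : ∀ i, i ∈ X₂ ∨ i ∈ Y₂ ↔ (i ∈ X ∧ i ≠ e) ∨ (i ∈ Y ∧ i ≠ f) := by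
        intro i
        have := congrArg (i ∈ ·) hun
        simp only [Finset.mem_union, Finset.mem_erase] at this
        rw [this]; tauto
      have hve : v ∈ ends e := by rw [hv]; simp
      have hnv : ∀ i, i ∈ X₂ ∨ i ∈ Y₂ → v ∉ ends i := by
        intro i hi hvi
        rcases (hmem i).1 hi with h | h
        · exact hX i h.1 e he h.2 v hvi hve
        · exact hY i h.1 f hf h.2 v hvi hvf
      have hnu : ∀ i, i ∈ X₂ ∨ i ∈ Y₂ → u ∉ ends i := by
        intro i hi hui
        rcases (hmem i).1 hi with h | h
        · exact hX i h.1 e he h.2 u hui hue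
        · exact huY i h.1 hui
      have hne : ∀ i, i ∈ X₂ ∨ i ∈ Y₂ → ∀ x, x ∈ ends e → x ∉ ends i := by
        intro i hi x hx
        rw [hv, Sym2.mem_iff] at hx
        rcases hx with rfl | rfl
        · exact hnu i hi
        · exact hnv i hi
      have hnf : ∀ i, i ∈ X₂ ∨ i ∈ Y₂ → w ∉ ends i → ∀ x, x ∈ ends f → x ∉ ends i := by
        intro i hi hwi x hx
        rw [hw, Sym2.mem_iff] at hx
        rcases hx with rfl | rfl
        · exact hnv i hi
        · exact hwi
      have hwf : w ∈ ends f := by rw [hw]; simp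
      have hef : e ≠ f := fun h => hfX (h ▸ he)
      have heN : e ∉ X₂ ∧ e ∉ Y₂ := by
        have := hmem e; tauto
      have hfN : f ∉ X₂ ∧ f ∉ Y₂ := by
        have := hmem f; tauto
      rw [Finset.disjoint_left] at hdis
      by_cases hwY : ∃ i ∈ Y₂, w ∈ ends i
      · obtain ⟨i, hi, hwi⟩ := hwY
        refine ⟨Insert.insert f X₂, Insert.insert e Y₂, ?_, ?_, hX₂.insert ?_, hY₂.insert ?_, ?_⟩
        · rw [Finset.disjoint_left]; intro x; simp only [Finset.mem_insert]
          rintro (rfl | hx) (rfl | hx')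
          exacts [hef rfl, hfN.2 hx', heN.1 hx, hdis hx hx']
        · ext x; have := hmem x
          by_cases hxe : x = e <;> by_cases hxf : x = f <;> simp_all
        · intro j hj
          refine hnf j (.inl hj) fun hwj => ?_
          rcases (hmem i).1 (.inr hi) with h | h
          · rcases (hmem j).1 (.inl hj) with h' | h'
            · exact hX i h.1 j h'.1 (fun h => hdis (h ▸ hj) hi) w hwi hwj
            · exact hY j h'.1 f hf h'.2 w hwj hwf
          · exact hY i h.1 f hf h.2 w hwi hwf
        · exact fun j hj => hne j (.inr hj)
        · rw [Finset.card_insert_of_notMem heN.2]; omega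
      · push Not at hwY
        refine ⟨Insert.insert e X₂, Insert.insert f Y₂, ?_, ?_, hX₂.insert ?_, hY₂.insert ?_, ?_⟩
        · rw [Finset.disjoint_left]; intro x; simp only [Finset.mem_insert]
          rintro (rfl | hx) (rfl | hx')
          exacts [hef rfl, heN.2 hx', hfN.1 hx, hdis hx hx']
        · ext x; have := hmem x
          by_cases hxe : x = e <;> by_cases hxf : x = f <;> simp_all
        · exact fun j hj => hne j (.inl hj)
        · exact fun j hj => hnf j (.inr hj) (hwY j hj)
        · rw [Finset.card_insert_of_notMem hfN.2]; omega
    · push Not at hvY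
      refine ⟨X.erase e, Insert.insert e Y, ?_, ?_, hX.mono (Finset.erase_subset _ _),
        hY.insert ?_, ?_⟩
      · rw [Finset.disjoint_left] at hXY ⊢; grind
      · ext x; by_cases x = e <;> grind
      · intro j hj x hx
        rw [hv, Sym2.mem_iff] at hx
        rcases hx with rfl | rfl
        · exact huY j hj
        · exact hvY j hj
      · rw [Finset.card_insert_of_notMem heY]

theorem itemProper_iff {ends : ι → Sym2 V} {I : Finset ι} {f : ι → C} :
    ItemProper ends I f ↔ ∀ c, ItemMatching ends {i ∈ I | f i = c} := by
  constructor
  · intro h c i hi j hj hij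
    rw [Finset.mem_filter] at hi hj
    exact h i hi.1 j hj.1 hij (hi.2.trans hj.2.symm)
  · intro h i hi j hj hij he
    exact h (f j) i (by simp [hi, he]) j (by simp [hj]) hij

theorem ItemProper.mono {ends : ι → Sym2 V} {I J : Finset ι} {f : ι → C}
    (h : ItemProper ends J f) (hs : I ⊆ J) : ItemProper ends I f :=
  fun i hi j hj => h i (hs hi) j (hs hj)

theorem ItemProper.shift_class {ends : ι → Sym2 V} {I : Finset ι} {f : ι → C}
    (h : ItemProper ends I f) (hd : ∀ i ∈ I, ¬ (ends i).IsDiag) {c c' : C} (hcc : c ≠ c')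
    (hlt : ({i ∈ I | f i = c'} : Finset ι).card < ({i ∈ I | f i = c} : Finset ι).card) :
    ∃ f' : ι → C, ItemProper ends I f' ∧ (∀ i ∈ I, f' i = f i ∨ f' i = c ∨ f' i = c') ∧
      ({i ∈ I | f' i = c} : Finset ι).card + 1 = ({i ∈ I | f i = c} : Finset ι).card ∧
      ({i ∈ I | f' i = c'} : Finset ι).card = ({i ∈ I | f i = c'} : Finset ι).card + 1 ∧
      ∀ d, d ≠ c → d ≠ c' → {i ∈ I | f' i = d} = {i ∈ I | f i = d} := by
  have hdis : Disjoint {i ∈ I | f i = c} {i ∈ I | f i = c'} := by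
    rw [Finset.disjoint_left]; intro i hi hj
    rw [Finset.mem_filter] at hi hj
    exact hcc (hi.2.symm.trans hj.2)
  obtain ⟨X', Y', hXY, hun, hX, hY, hcard⟩ := ItemMatching.exchange _ rfl hdis
    (itemProper_iff.1 h c) (itemProper_iff.1 h c')
    (fun i hi => hd i (by simp only [Finset.mem_union, Finset.mem_filter] at hi; tauto)) hlt
  have hmem : ∀ i, i ∈ X' ∨ i ∈ Y' ↔ i ∈ I ∧ (f i = c ∨ f i = c') := by
    intro i
    have := congrArg (i ∈ ·) hun
    simp only [Finset.mem_union, Finset.mem_filter] at this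
    rw [this]; tauto
  rw [Finset.disjoint_left] at hXY
  let f' : ι → C := fun i => if i ∈ X' then c else if i ∈ Y' then c' else f i
  have h1 : {i ∈ I | f' i = c} = X' := by
    ext i; have := hmem i; have := @hXY i
    simp only [Finset.mem_filter, f']
    split_ifs <;> simp_all
    tauto
  have h2 : {i ∈ I | f' i = c'} = Y' := by
    ext i; have := hmem i; have := @hXY i
    simp only [Finset.mem_filter, f']
    split_ifs <;> simp_all
  have h3 : ∀ d, d ≠ c → d ≠ c' → {i ∈ I | f' i = d} = {i ∈ I | f i = d} := by
    intro d hc hc'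
    ext i; have := hmem i
    simp only [Finset.mem_filter, f']
    split_ifs <;> grind
  have hcu := congrArg Finset.card hun
  rw [Finset.card_union_of_disjoint (Finset.disjoint_left.2 @hXY),
    Finset.card_union_of_disjoint hdis] at hcu
  refine ⟨f', itemProper_iff.2 fun d => ?_, fun i _ => ?_, by rw [h1]; omega, by rw [h2, hcard], h3⟩
  · by_cases hdc : d = c
    · rw [hdc, h1]; exact hX
    · by_cases hdc' : d = c'
      · rw [hdc', h2]; exact hY
      · rw [h3 d hdc hdc']; exact itemProper_iff.1 h d
  · simp only [f']; split_ifs <;> simp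

theorem ItemProper.exists_equalized {ends : ι → Sym2 V} {I : Finset ι} {Q : Finset C} {δ : ℕ}
    (hd : ∀ i ∈ I, ¬ (ends i).IsDiag) (hcard : I.card = Q.card * δ) {f : ι → C}
    (h : ItemProper ends I f) (hf : ∀ i ∈ I, f i ∈ Q) :
    ∃ f' : ι → C, ItemProper ends I f' ∧ (∀ i ∈ I, f' i ∈ Q) ∧
      ∀ c ∈ Q, ({i ∈ I | f' i = c} : Finset ι).card = δ := by
  induction hm : ∑ c ∈ Q, (({i ∈ I | f i = c} : Finset ι).card - δ) using Nat.strong_induction_on generalizing f with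
  | _ m ih =>
  have hsum : ∑ c ∈ Q, ({i ∈ I | f i = c} : Finset ι).card = ∑ c ∈ Q, δ := by
    rw [← Finset.card_eq_sum_card_fiberwise hf, hcard]; simp
  by_cases hall : ∀ c ∈ Q, ({i ∈ I | f i = c} : Finset ι).card ≤ δ
  · exact ⟨f, h, hf, (Finset.sum_eq_sum_iff_of_le hall).1 hsum⟩
  push Not at hall
  obtain ⟨c, hc, hcδ⟩ := hall
  obtain ⟨c', hc', hcδ'⟩ : ∃ c' ∈ Q, ({i ∈ I | f i = c'} : Finset ι).card < δ := by
    by_contra hcon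
    push Not at hcon
    have := Finset.sum_lt_sum hcon ⟨c, hc, hcδ⟩
    omega
  have hcc : c ≠ c' := by rintro rfl; omega
  obtain ⟨f', hp, hval, h1, h2, h3⟩ := h.shift_class hd hcc (by omega)
  refine ih _ ?_ hp (fun i hi => ?_) rfl
  · rw [← hm]
    refine Finset.sum_lt_sum (fun d _ => ?_) ⟨c, hc, by omega⟩
    by_cases hdc : d = c
    · subst hdc; omega
    · by_cases hdc' : d = c'
      · subst hdc'; omega
      · rw [h3 d hdc hdc']
  · rcases hval i hi with h | h | h <;> rw [h]
    exacts [hf i hi, hc, hc']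

theorem ItemMatching.card_meet_le {ends : ι → Sym2 V} {M : Finset ι} (h : ItemMatching ends M)
    (e : Sym2 V) : ({j ∈ M | ∃ v ∈ e.toFinset, v ∈ ends j} : Finset ι).card ≤ 2 := by
  have hsub : ({j ∈ M | ∃ v ∈ e.toFinset, v ∈ ends j} : Finset ι) ⊆
      e.toFinset.biUnion fun v => {j ∈ M | v ∈ ends j} := by
    intro j hj
    simp only [Finset.mem_filter, Finset.mem_biUnion] at hj ⊢
    obtain ⟨hj, v, hv, hvj⟩ := hj
    exact ⟨v, hv, hj, hvj⟩
  have h1 : ∀ v ∈ e.toFinset, ({j ∈ M | v ∈ ends j} : Finset ι).card ≤ 1 := by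
    intro v _
    rw [Finset.card_le_one]
    intro i hi j hj
    rw [Finset.mem_filter] at hi hj
    by_contra hij
    exact h i hi.1 j hj.1 hij v hi.2 hj.2
  have h2 : e.toFinset.card ≤ 2 := by
    rw [Sym2.card_toFinset]; split_ifs <;> omega
  have := (Finset.card_le_card hsub).trans (Finset.card_biUnion_le_card_mul _ _ _ h1)
  omega

theorem ItemProper.exists_dump {ends : ι → Sym2 V} {I Pre : Finset ι} {f : ι → C}
    (h : ItemProper ends I f) {ζ : Finset C} {b v : ℕ} (hb : 1 ≤ b) (hζ : ζ.card = 2 * b)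
    (S : Finset C) (hS : ∀ c ∈ S, ({i ∈ I | i ∈ Pre ∧ f i = c} : Finset ι).card + v + b ≤
      ({i ∈ I | f i = c} : Finset ι).card + 1) (hv : S.card ≤ v) :
    ∃ (R : Finset ι) (g : ι → C), (∀ i ∈ R, i ∈ I ∧ i ∉ Pre ∧ f i ∈ S) ∧
      (∀ c ∈ S, ({i ∈ R | f i = c} : Finset ι).card = b) ∧ ItemProper ends R g ∧
      ∀ i ∈ R, g i ∈ ζ := by
  induction S using Finset.induction_on with
  | empty => exact ⟨∅, f, by simp, by simp, by simp [ItemProper], by simp⟩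
  | insert c S hc ih =>
    rw [Finset.card_insert_of_notMem hc] at hv
    obtain ⟨R, g, hR, hRb, hg, hgζ⟩ := ih (fun d hd => hS d (by simp [hd])) (by omega)
    have hRcard : R.card = S.card * b := by
      rw [Finset.card_eq_sum_card_fiberwise fun i hi => (hR i hi).2.2, Finset.sum_congr rfl hRb]
      simp
    let free : ι → C → Prop := fun i z => z ∈ ζ ∧ ∀ r ∈ R, g r = z → ∀ x, x ∈ ends i → x ∉ ends r
    classical
    let Bl : Finset ι := {i ∈ I | f i = c ∧ ¬ ∃ z, free i z}
    have hBl : Bl.card ≤ S.card := by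
      have hcount := Finset.card_mul_le_card_mul (s := Bl) (t := R) (m := 2 * b) (n := 2)
        (fun i r => ∃ x ∈ (ends r).toFinset, x ∈ ends i) ?_ ?_
      · rw [hRcard] at hcount
        nlinarith
      · intro i hi
        simp only [Bl, Finset.mem_filter, free, not_exists, not_and] at hi
        rw [← hζ]
        refine (Finset.card_le_card fun z hz => ?_).trans (Finset.card_image_le (f := g))
        have := hi.2.2 z hz
        push Not at this
        obtain ⟨r, hr, hrz, x, hx, hx'⟩ := this
        rw [Finset.mem_image]
        exact ⟨r, by simp only [Finset.bipartiteAbove, Finset.mem_filter, Sym2.mem_toFinset]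
                     exact ⟨hr, x, hx', hx⟩, hrz⟩
      · intro r _
        refine le_trans (Finset.card_le_card ?_) ((itemProper_iff.1 h c).card_meet_le (ends r))
        intro i hi
        simp only [Finset.bipartiteBelow, Finset.mem_filter, Bl] at hi ⊢
        exact ⟨⟨hi.1.1, hi.1.2.1⟩, hi.2⟩
    have hav : b ≤ ({i ∈ I | f i = c ∧ i ∉ Pre ∧ ∃ z, free i z} : Finset ι).card := by
      have hsub : ({i ∈ I | f i = c} : Finset ι) ⊆
          ({i ∈ I | i ∈ Pre ∧ f i = c} : Finset ι) ∪ Bl ∪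
            ({i ∈ I | f i = c ∧ i ∉ Pre ∧ ∃ z, free i z} : Finset ι) := by
        intro i hi
        simp only [Finset.mem_union, Finset.mem_filter, Bl] at hi ⊢
        tauto
      have h1 := Finset.card_le_card hsub
      have h2 := Finset.card_union_le (({i ∈ I | i ∈ Pre ∧ f i = c} : Finset ι) ∪ Bl)
        ({i ∈ I | f i = c ∧ i ∉ Pre ∧ ∃ z, free i z} : Finset ι)
      have h3 := Finset.card_union_le ({i ∈ I | i ∈ Pre ∧ f i = c} : Finset ι) Bl
      have h4 := hS c (by simp)
      omega
    obtain ⟨T, hT, hTb⟩ := Finset.exists_subset_card_eq hav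
    have hT' : ∀ i ∈ T, i ∈ I ∧ f i = c ∧ i ∉ Pre ∧ ∃ z, free i z := by
      intro i hi; simpa using hT hi
    have : Nonempty C := ⟨c⟩
    choose! z hz using fun i hi => (hT' i hi).2.2.2
    have hRT : ∀ i ∈ R, i ∉ T := fun i hi hi' => hc ((hT' i hi').2.1 ▸ (hR i hi).2.2)
    refine ⟨R ∪ T, fun i => if i ∈ T then z i else g i, ?_, ?_, ?_, ?_⟩
    · intro i hi
      rcases Finset.mem_union.1 hi with hi | hi
      · obtain ⟨h1, h2, h3⟩ := hR i hi
        exact ⟨h1, h2, by simp [h3]⟩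
      · obtain ⟨h1, h2, h3, _⟩ := hT' i hi
        exact ⟨h1, h3, by simp [h2]⟩
    · intro d hd
      rw [Finset.filter_union]
      rcases Finset.mem_insert.1 hd with rfl | hd
      · have h1 : ({i ∈ R | f i = d} : Finset ι) = ∅ :=
          Finset.filter_false_of_mem fun i hi hid => hc (hid ▸ (hR i hi).2.2)
        have h2 : ({i ∈ T | f i = d} : Finset ι) = T :=
          Finset.filter_true_of_mem fun i hi => (hT' i hi).2.1
        rw [h1, h2, Finset.empty_union, hTb]
      · have h2 : ({i ∈ T | f i = d} : Finset ι) = ∅ :=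
          Finset.filter_false_of_mem fun i hi hid => hc (by rwa [← (hT' i hi).2.1, hid])
        rw [h2, Finset.union_empty, hRb d hd]
    · intro i hi j hj hij
      by_cases hiT : i ∈ T <;> by_cases hjT : j ∈ T
      · intro _
        exact h i (hT' i hiT).1 j (hT' j hjT).1 hij ((hT' i hiT).2.1.trans (hT' j hjT).2.1.symm)
      · simp only [hiT, hjT, if_true, if_false]
        have hjR : j ∈ R := by simpa [hjT] using hj
        intro he x hx
        exact (hz i hiT).2 j hjR he.symm x hx
      · simp only [hiT, hjT, if_true, if_false]
        have hiR : i ∈ R := by simpa [hiT] using hi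
        intro he x hx hx'
        exact (hz j hjT).2 i hiR he x hx' hx
      · simp only [hiT, hjT, if_false]
        exact hg i (by simpa [hiT] using hi) j (by simpa [hjT] using hj) hij
    · intro i hi
      by_cases hiT : i ∈ T
      · simpa only [hiT, if_true] using (hz i hiT).1
      · simpa only [hiT, if_false] using hgζ i (by simpa [hiT] using hi)

theorem ItemProper.exists_spread {ends : ι → Sym2 V} {I Pre : Finset ι} {f : ι → C}
    (h : ItemProper ends I f) (hd : ∀ i ∈ I, ¬ (ends i).IsDiag) {ε ζ : Finset C} {b δ : ℕ}
    (hf : ∀ i ∈ I, f i ∈ ε) (hε : ε.card = 2 * δ)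
    (hcls : ∀ c ∈ ε, ({i ∈ I | f i = c} : Finset ι).card = δ + b)
    (hb : 1 ≤ b) (hζ : ζ.card = 2 * b) (hεζ : Disjoint ε ζ) (hPre : Pre ⊆ I)
    (hcond : ∀ c ∈ Pre.image f, ({i ∈ Pre | f i = c} : Finset ι).card + (Pre.image f).card ≤ δ + 1) :
    ∃ f' : ι → C, ItemProper ends I f' ∧ (∀ i ∈ I, f' i ∈ ε ∪ ζ) ∧
      (∀ c ∈ ε ∪ ζ, ({i ∈ I | f' i = c} : Finset ι).card = δ) ∧ ∀ i ∈ Pre, f' i = f i := by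
  have hVε : Pre.image f ⊆ ε := by
    intro c hc
    obtain ⟨i, hi, rfl⟩ := Finset.mem_image.1 hc
    exact hf i (hPre hi)
  set W := Pre.image f with hW
  obtain ⟨R, g, hR, hRb, hg, hgζ⟩ := h.exists_dump (Pre := Pre) hb hζ W (v := W.card)
    (fun c hc => by
      have h1 := hcond c hc
      have h2 := hcls c (hVε hc)
      have h3 : ({i ∈ I | i ∈ Pre ∧ f i = c} : Finset ι) = {i ∈ Pre | f i = c} := by
        ext i; simp only [Finset.mem_filter]; have := @hPre i; tauto
      rw [h2, h3]; omega) le_rfl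
  rw [Finset.disjoint_left] at hεζ
  let f₁ : ι → C := fun i => if i ∈ R then g i else f i
  let Q : Finset ι := {i ∈ I | i ∈ R ∨ f i ∉ W}
  have hf₁ : ∀ i ∈ Q, f₁ i ∈ (ε \ W) ∪ ζ := by
    intro i hi
    simp only [Q, Finset.mem_filter] at hi
    simp only [f₁, Finset.mem_union, Finset.mem_sdiff]
    split_ifs with hiR
    · exact .inr (hgζ i hiR)
    · exact .inl ⟨hf i hi.1, by tauto⟩
  have hp₁ : ItemProper ends Q f₁ := by
    intro i hi j hj hij
    simp only [Q, Finset.mem_filter] at hi hj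
    simp only [f₁]
    split_ifs with hiR hjR hjR
    · exact hg i hiR j hjR hij
    · intro he
      exact absurd (hgζ i hiR) (he ▸ hεζ (hf j hj.1))
    · intro he
      exact absurd (hgζ j hjR) (he ▸ hεζ (hf i hi.1))
    · exact h i hi.1 j hj.1 hij
  have hRcard : R.card = W.card * b := by
    rw [Finset.card_eq_sum_card_fiberwise fun i hi => (hR i hi).2.2, Finset.sum_congr rfl hRb]
    simp
  have hWle := Finset.card_le_card hVε
  have hQcard : Q.card = ((ε \ W) ∪ ζ).card * δ := by
    have hQ : Q = R ∪ {i ∈ I | f i ∈ ε \ W} := by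
      ext i
      simp only [Q, Finset.mem_filter, Finset.mem_union, Finset.mem_sdiff]
      have := hR i; have := hf i; tauto
    have h1 : ({i ∈ I | f i ∈ ε \ W} : Finset ι).card = (ε \ W).card * (δ + b) := by
      have hmap : ∀ i ∈ ({i ∈ I | f i ∈ ε \ W} : Finset ι), f i ∈ ε \ W :=
        fun i hi => (Finset.mem_filter.1 hi).2
      rw [Finset.card_eq_sum_card_fiberwise hmap]
      rw [Finset.sum_congr rfl (g := fun _ => δ + b)]
      · simp
      · intro c hc
        rw [← hcls c (Finset.mem_sdiff.1 hc).1]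
        congr 1; ext i; simp only [Finset.mem_filter]
        constructor
        · tauto
        · rintro ⟨h1, h2⟩; exact ⟨⟨h1, h2 ▸ hc⟩, h2⟩
    rw [hQ, Finset.card_union_of_disjoint, h1, hRcard, Finset.card_union_of_disjoint, hζ,
      Finset.card_sdiff_of_subset hVε, hε]
    · obtain ⟨k, hk⟩ := Nat.exists_eq_add_of_le hWle
      rw [hε] at hk
      rw [hk, Nat.add_sub_cancel_left]
      nlinarith
    · rw [Finset.disjoint_left]; intro c hc; exact hεζ (Finset.mem_sdiff.1 hc).1
    · rw [Finset.disjoint_left]; intro i hi hi'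
      simp only [Finset.mem_filter, Finset.mem_sdiff] at hi'
      exact hi'.2.2 (hR i hi).2.2
  obtain ⟨f₂, hp₂, hf₂, hc₂⟩ := hp₁.exists_equalized
    (fun i hi => hd i (Finset.mem_filter.1 hi).1) hQcard hf₁
  have hQW : ∀ i ∈ Q, f₂ i ∉ W := by
    intro i hi hiW
    have := hf₂ i hi
    simp only [Finset.mem_union, Finset.mem_sdiff] at this
    rcases this with h | h
    exacts [h.2 hiW, hεζ (hVε hiW) h]
  have hnQ : ∀ i ∈ I, i ∉ Q → f i ∈ W ∧ i ∉ R := by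
    intro i hi hiQ
    simp only [Q, Finset.mem_filter] at hiQ
    tauto
  refine ⟨fun i => if i ∈ Q then f₂ i else f i, ?_, ?_, ?_, ?_⟩
  · intro i hi j hj hij
    dsimp only
    split_ifs with hiQ hjQ hjQ
    · exact hp₂ i hiQ j hjQ hij
    · intro he; exact absurd (hnQ j hj hjQ).1 (he ▸ hQW i hiQ)
    · intro he; exact absurd (hnQ i hi hiQ).1 (he ▸ hQW j hjQ)
    · exact h i hi j hj hij
  · intro i hi
    dsimp only
    split_ifs with hiQ
    · have := hf₂ i hiQ
      simp only [Finset.mem_union, Finset.mem_sdiff] at this ⊢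
      tauto
    · exact Finset.mem_union_left _ (hf i hi)
  · intro c hc
    by_cases hcW : c ∈ W
    · have h1 : ({i ∈ I | f i = c} : Finset ι) =
          {i ∈ I | (if i ∈ Q then f₂ i else f i) = c} ∪ {i ∈ R | f i = c} := by
        ext i
        simp only [Finset.mem_filter, Finset.mem_union]
        have := hR i
        have := hQW i
        have := hnQ i
        have h4 : i ∈ Q ↔ i ∈ I ∧ (i ∈ R ∨ f i ∉ W) := by simp only [Q, Finset.mem_filter]
        split_ifs <;> grind
      have h2 : Disjoint ({i ∈ I | (if i ∈ Q then f₂ i else f i) = c} : Finset ι)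
          ({i ∈ R | f i = c} : Finset ι) := by
        rw [Finset.disjoint_left]
        intro i hi hi'
        rw [Finset.mem_filter] at hi hi'
        have hiQ : i ∈ Q := by simp only [Q, Finset.mem_filter]; exact ⟨hi.1, .inl hi'.1⟩
        rw [if_pos hiQ] at hi
        exact hQW i hiQ (hi.2 ▸ hcW)
      have h3 := congrArg Finset.card h1
      rw [Finset.card_union_of_disjoint h2, hRb c hcW, hcls c (hVε hcW)] at h3
      exact (Nat.add_right_cancel h3).symm
    · rw [← hc₂ c (by simp only [Finset.mem_union, Finset.mem_sdiff] at hc ⊢; tauto)]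
      congr 1
      ext i
      simp only [Finset.mem_filter]
      have := hnQ i
      have h4 : i ∈ Q → i ∈ I := fun h => (Finset.mem_filter.1 h).1
      split_ifs <;> grind
  · intro i hi
    have : i ∉ Q := by
      simp only [Q, Finset.mem_filter]
      have h1 := hR i
      have h2 : f i ∈ W := Finset.mem_image_of_mem f hi
      tauto
    simp [this]

end Items

section Konig

variable {V W C : Type*} [DecidableEq V] [DecidableEq W] [DecidableEq C]

theorem exists_injOn_of_hall (A : Finset V) (t : V → Finset C)
    (h : ∀ S ⊆ A, S.card ≤ (S.biUnion t).card) :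
    A = ∅ ∨ ∃ f : V → C, (∀ v ∈ A, f v ∈ t v) ∧ Set.InjOn f A := by
  rcases A.eq_empty_or_nonempty with hA | ⟨a, ha⟩
  · exact .inl hA
  right
  obtain ⟨f, hf, hft⟩ := (Finset.all_card_le_biUnion_card_iff_exists_injective
    fun v : A => t v).1 fun S => by
      have := h (S.map (Function.Embedding.subtype _)) fun v hv => by
        rw [Finset.mem_map] at hv
        obtain ⟨x, _, rfl⟩ := hv
        exact x.2
      rw [Finset.card_map] at this
      refine this.trans (Finset.card_le_card fun c hc => ?_)
      simp only [Finset.mem_biUnion, Finset.mem_map] at hc ⊢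
      obtain ⟨_, ⟨x, hx, rfl⟩, hc⟩ := hc
      exact ⟨x, hx, hc⟩
  refine ⟨fun v => if hv : v ∈ A then f ⟨v, hv⟩ else f ⟨a, ha⟩, ?_, ?_⟩
  · intro v hv
    simpa only [hv, dif_pos] using hft ⟨v, hv⟩
  · intro v hv w hw hvw
    have hv' : v ∈ A := hv
    have hw' : w ∈ A := hw
    simp only [hv', hw', dif_pos] at hvw
    exact congrArg Subtype.val (hf hvw)

theorem card_le_card_biUnion_of_regular {A : Finset V} {t : V → Finset C} {d : ℕ} (hd : 1 ≤ d)
    (hrow : ∀ v ∈ A, d ≤ (t v).card)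
    (hcol : ∀ c ∈ A.biUnion t, ({v ∈ A | c ∈ t v} : Finset V).card ≤ d) :
    A.card ≤ (A.biUnion t).card := by
  have := Finset.card_mul_le_card_mul (s := A) (t := A.biUnion t) (m := d) (n := d)
    (fun v c => c ∈ t v) (fun v hv => (hrow v hv).trans (Finset.card_le_card fun c hc => by
      simp only [Finset.bipartiteAbove, Finset.mem_filter, Finset.mem_biUnion]
      exact ⟨⟨v, hv, hc⟩, hc⟩)) hcol
  exact Nat.le_of_mul_le_mul_right this hd

/-- A bipartite graph that is regular of degree `B.card` is a union of perfect matchings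
indexed by `B`. -/
theorem exists_matching_decomposition {A : Finset V} {K : Finset C} (hAK : A.card = K.card)
    (B : Finset W) (t : V → Finset C) (ht : ∀ v ∈ A, t v ⊆ K)
    (hrow : ∀ v ∈ A, (t v).card = B.card)
    (hcol : ∀ c ∈ K, ({v ∈ A | c ∈ t v} : Finset V).card = B.card) :
    (A = ∅ ∨ B = ∅) ∨ ∃ g : V → W → C, (∀ v ∈ A, ∀ w ∈ B, g v w ∈ t v) ∧
      (∀ v ∈ A, ∀ w ∈ B, ∀ w' ∈ B, g v w = g v w' → w = w') ∧
      ∀ w ∈ B, ∀ v ∈ A, ∀ v' ∈ A, g v w = g v' w → v = v' := by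
  induction B using Finset.induction_on generalizing t with
  | empty => simp
  | insert b B hb ih =>
    rw [Finset.card_insert_of_notMem hb] at hrow hcol
    rcases exists_injOn_of_hall A t fun S hS => card_le_card_biUnion_of_regular (d := B.card + 1)
        (by omega) (fun v hv => (hrow v (hS hv)).ge) fun c hc => by
          rw [Finset.mem_biUnion] at hc
          obtain ⟨v, hv, hvc⟩ := hc
          rw [← hcol c (ht v (hS hv) hvc)]
          exact Finset.card_le_card (Finset.filter_subset_filter _ hS) with hA | ⟨f, hft, hf⟩
    · exact .inl (.inl hA)
    right
    have hfim : A.image f = K := by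
      refine Finset.eq_of_subset_of_card_le (fun c hc => ?_) ?_
      · obtain ⟨v, hv, rfl⟩ := Finset.mem_image.1 hc
        exact ht v hv (hft v hv)
      · rw [Finset.card_image_of_injOn hf, hAK]
    rcases ih (fun v => (t v).erase (f v)) (fun v hv => (Finset.erase_subset _ _).trans (ht v hv))
      (fun v hv => by rw [Finset.card_erase_of_mem (hft v hv), hrow v hv]; omega)
      (fun c hc => by
        have hc' := hc
        rw [← hfim, Finset.mem_image] at hc'
        obtain ⟨u, hu, rfl⟩ := hc'
        have : ({v ∈ A | f u ∈ (t v).erase (f v)} : Finset V) =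
            ({v ∈ A | f u ∈ t v} : Finset V).erase u := by
          ext v
          simp only [Finset.mem_filter, Finset.mem_erase]
          constructor
          · rintro ⟨h1, h2, h3⟩
            exact ⟨fun h => h2 (h ▸ rfl), h1, h3⟩
          · rintro ⟨h1, h2, h3⟩
            exact ⟨h2, fun h => h1 (hf hu h2 h).symm, h3⟩
        rw [this, Finset.card_erase_of_mem (by simp [hu, hft u hu]), hcol _ hc]
        omega) with (hA | hB) | ⟨g, hgt, hgw, hgv⟩
    · subst hA
      exact ⟨fun v _ => f v, by simp, by simp, by simp⟩
    · subst hB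
      refine ⟨fun v _ => f v, ?_, ?_, ?_⟩
      · exact fun v hv _ _ => hft v hv
      · simp
      · exact fun _ _ v hv v' hv' h => hf hv hv' h
    · refine ⟨fun v w => if w = b then f v else g v w, ?_, ?_, ?_⟩
      · intro v hv w hw
        dsimp only
        split_ifs with hwb
        · exact hft v hv
        · exact Finset.mem_of_mem_erase (hgt v hv w (by simpa [hwb] using hw))
      · intro v hv w hw w' hw'
        dsimp only
        split_ifs with hwb hwb' hwb'
        · exact fun _ => hwb.trans hwb'.symm
        · intro h
          exact absurd h.symm (Finset.ne_of_mem_erase (hgt v hv w' (by simpa [hwb'] using hw')))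
        · intro h
          exact absurd h (Finset.ne_of_mem_erase (hgt v hv w (by simpa [hwb] using hw)))
        · exact hgw v hv w (by simpa [hwb] using hw) w' (by simpa [hwb'] using hw')
      · intro w hw v hv v' hv'
        dsimp only
        split_ifs with hwb
        · exact hf hv hv'
        · exact hgv w (by simpa [hwb] using hw) v hv v' hv'

end Konig

/-- `L` is a symmetric Latin square on `A` with symbols `K`, whose diagonal is constant on the
pairs of the fixed-point-free involution `z`. -/
structure SymLatin {V C : Type*} (A : Finset V) (K : Finset C) (z : V → V) (L : V → V → C) :
    Prop where
  z_mem : ∀ u ∈ A, z u ∈ A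
  z_ne : ∀ u ∈ A, z u ≠ u
  z_z : ∀ u ∈ A, z (z u) = u
  symm : ∀ u ∈ A, ∀ v ∈ A, L u v = L v u
  diag : ∀ u ∈ A, L (z u) (z u) = L u u
  mem : ∀ u ∈ A, ∀ v ∈ A, L u v ∈ K
  inj : ∀ u ∈ A, ∀ v ∈ A, ∀ w ∈ A, L u v = L u w → v = w

section SymLatin

variable {V C : Type*} [DecidableEq V] [DecidableEq C]

/-- The item of cell `(u, v)`: a pair of opposite off-diagonal cells is an edge, and the diagonal
cells of `u` and `z u` together form a second copy of the edge `s(u, z u)`. -/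
def cellItem (z : V → V) (u v : V) : Sym2 V × Bool :=
  if v = u then (s(u, z u), true) else (s(u, v), false)

theorem cellItem_right_inj {z : V → V} {u v w : V} (h : cellItem z u v = cellItem z u w) :
    v = w := by
  unfold cellItem at h
  split_ifs at h with h1 h2 h2
  · rw [h1, h2]
  · simp at h
  · simp at h
  · simp only [Prod.mk.injEq, and_true] at h
    exact Sym2.congr_right.1 h

theorem mem_cellItem (z : V → V) (u v : V) : u ∈ (cellItem z u v).1 := by
  unfold cellItem; split_ifs <;> simp

theorem exists_cellItem_eq {A : Finset V} {z : V → V} (hz : ∀ u ∈ A, z u ∈ A)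
    (hzz : ∀ u ∈ A, z (z u) = u) {u v x : V} (hu : u ∈ A) (hv : v ∈ A)
    (hx : x ∈ (cellItem z u v).1) : x ∈ A ∧ ∃ w ∈ A, cellItem z u v = cellItem z x w := by
  unfold cellItem at hx ⊢
  split_ifs at hx ⊢ with h
  · simp only [Sym2.mem_iff] at hx
    rcases hx with rfl | rfl
    · exact ⟨hu, x, hu, by simp⟩
    · exact ⟨hz u hu, z u, hz u hu, by simp [hzz u hu, Sym2.eq_swap]⟩
  · simp only [Sym2.mem_iff] at hx
    rcases hx with rfl | rfl
    · exact ⟨hu, v, hv, by simp [h]⟩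
    · exact ⟨hv, u, hu, by simp [Ne.symm h, Sym2.eq_swap]⟩

theorem SymLatin.exists_itemColoring {A : Finset V} {K : Finset C} {z : V → V} {L : V → V → C}
    (h : SymLatin A K z L) :
    ∃ f : Sym2 V × Bool → C, ∀ u ∈ A, ∀ v ∈ A, f (cellItem z u v) = L u v := by
  classical
  refine ⟨fun i => if hi : ∃ p : V × V, p.1 ∈ A ∧ p.2 ∈ A ∧ i = cellItem z p.1 p.2 then
    L hi.choose.1 hi.choose.2 else L i.1.out.1 i.1.out.1, fun u hu v hv => ?_⟩
  have hi : ∃ p : V × V, p.1 ∈ A ∧ p.2 ∈ A ∧ cellItem z u v = cellItem z p.1 p.2 :=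
    ⟨(u, v), hu, hv, rfl⟩
  dsimp only
  rw [dif_pos hi]
  obtain ⟨h1, h2, h3⟩ := hi.choose_spec
  generalize hi.choose = p at h1 h2 h3
  obtain ⟨x, y⟩ := p
  unfold cellItem at h3
  split_ifs at h3 with hvu hyx hyx
  · simp only [Prod.mk.injEq, and_true, Sym2.eq_iff] at h3 h1 h2 hyx ⊢
    subst hvu hyx
    rcases h3 with h3 | h3
    · rw [h3.1]
    · rw [← h3.2, h.diag v hv]
  · simp at h3
  · simp at h3
  · simp only [Prod.mk.injEq, and_true, Sym2.eq_iff] at h3 h1 h2 ⊢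
    rcases h3 with ⟨rfl, rfl⟩ | ⟨rfl, rfl⟩
    · rfl
    · exact h.symm _ h1 _ h2

theorem SymLatin.image_row {A : Finset V} {K : Finset C} {z : V → V} {L : V → V → C}
    (h : SymLatin A K z L) (hAK : A.card = K.card) {u : V} (hu : u ∈ A) : A.image (L u) = K := by
  refine Finset.eq_of_subset_of_card_le (fun c hc => ?_) ?_
  · obtain ⟨v, hv, rfl⟩ := Finset.mem_image.1 hc
    exact h.mem u hu v hv
  · rw [Finset.card_image_of_injOn (fun v hv w hw => h.inj u hu v hv w hw), hAK]

/-- Keep the cells with symbols in `γ` and spread the symbols of the other ones over all the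
symbols outside `γ`, so that the result can be bordered by a square with symbols in `γ`. -/
theorem SymLatin.exists_spread {A : Finset V} {K α γ : Finset C} {z : V → V} {L : V → V → C}
    {a b : ℕ} (h : SymLatin A α z L) (hA : A.card = 2 * a) (hα : α.card = 2 * a)
    (hγ : γ.card = 2 * b) (hK : K.card = 2 * (a + b)) (hγα : γ ⊆ α) (hαK : α ⊆ K) (hb : 1 ≤ b)
    (hba : b ≤ a) {φ : Sym2 V → C} {E : Finset (Sym2 V)} (hE : ∀ e ∈ E, ¬ e.IsDiag)
    (hEA : ∀ u v, s(u, v) ∈ E → u ∈ A ∧ v ∈ A ∧ L u v = φ s(u, v) ∧ φ s(u, v) ∉ γ)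
    (hcond : ∀ c ∈ E.image φ, ({e ∈ E | φ e = c} : Finset (Sym2 V)).card + (E.image φ).card + b
      ≤ a + 1) :
    ∃ L' : V → V → C, (∀ u ∈ A, ∀ v ∈ A, L' u v = L' v u) ∧ (∀ u ∈ A, L' (z u) (z u) = L' u u) ∧
      (∀ u ∈ A, ∀ v ∈ A, L' u v ∈ K) ∧ (∀ u ∈ A, ∀ v ∈ A, ∀ w ∈ A, L' u v = L' u w → v = w) ∧
      (∀ u ∈ A, ∀ v ∈ A, L u v ∈ γ → L' u v = L u v) ∧
      (∀ u v, s(u, v) ∈ E → L' u v = φ s(u, v)) ∧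
      ∀ c ∈ K \ γ, ({u ∈ A | ∀ v ∈ A, L' u v ≠ c} : Finset V).card = 2 * b := by
  classical
  obtain ⟨f, hf⟩ := h.exists_itemColoring
  let ends : Sym2 V × Bool → Sym2 V := Prod.fst
  let J : Finset (Sym2 V × Bool) := (A ×ˢ A).image fun p => cellItem z p.1 p.2
  have hJ : ∀ i, i ∈ J ↔ ∃ u ∈ A, ∃ v ∈ A, cellItem z u v = i := by
    intro i; simp only [J, Finset.mem_image, Finset.mem_product, Prod.exists]
    constructor
    · rintro ⟨u, v, ⟨hu, hv⟩, rfl⟩; exact ⟨u, hu, v, hv, rfl⟩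
    · rintro ⟨u, hu, v, hv, rfl⟩; exact ⟨u, v, ⟨hu, hv⟩, rfl⟩
  have hJx : ∀ i ∈ J, ∀ x ∈ ends i, x ∈ A ∧ ∃ w ∈ A, i = cellItem z x w := by
    intro i hi x hx
    obtain ⟨u, hu, v, hv, rfl⟩ := (hJ i).1 hi
    exact exists_cellItem_eq h.z_mem h.z_z hu hv hx
  have hJd : ∀ i ∈ J, ¬ (ends i).IsDiag := by
    intro i hi
    obtain ⟨u, hu, v, hv, rfl⟩ := (hJ i).1 hi
    simp only [ends, cellItem]
    split_ifs with huv
    · rw [Sym2.mk_isDiag_iff]; exact (h.z_ne u hu).symm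
    · rw [Sym2.mk_isDiag_iff]; exact Ne.symm huv
  have hfJ : ItemProper ends J f := by
    intro i hi j hj hij hc x hxi hxj
    obtain ⟨hx, w, hw, rfl⟩ := hJx i hi x hxi
    obtain ⟨-, w', hw', rfl⟩ := hJx j hj x hxj
    rw [hf x hx w hw, hf x hx w' hw'] at hc
    exact hij (by rw [h.inj x hx w hw w' hw' hc])
  have hJα : ∀ i ∈ J, f i ∈ α := by
    intro i hi
    obtain ⟨u, hu, v, hv, rfl⟩ := (hJ i).1 hi
    rw [hf u hu v hv]; exact h.mem u hu v hv
  let I : Finset (Sym2 V × Bool) := {i ∈ J | f i ∉ γ}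
  have hIJ : I ⊆ J := Finset.filter_subset _ _
  let Pre : Finset (Sym2 V × Bool) := E.image fun e => (e, false)
  have hPreJ : ∀ u v, s(u, v) ∈ E → cellItem z u v = (s(u, v), false) := by
    intro u v huv
    have := hE _ huv
    rw [Sym2.mk_isDiag_iff] at this
    simp [cellItem, Ne.symm this]
  have hfE : ∀ e ∈ E, f (e, false) = φ e ∧ (e, false) ∈ I := by
    intro e
    induction e with | _ u v
    intro he
    obtain ⟨hu, hv, h1, h2⟩ := hEA u v he
    have h3 : f (s(u, v), false) = φ s(u, v) := by rw [← hPreJ u v he, hf u hu v hv, h1]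
    refine ⟨h3, Finset.mem_filter.2 ⟨(hJ _).2 ⟨u, hu, v, hv, hPreJ u v he⟩, by rwa [h3]⟩⟩
  have hPim : Pre.image f = E.image φ := by
    rw [Finset.image_image]
    exact Finset.image_congr fun e he => (hfE e he).1
  obtain ⟨f', hp', hf'm, hf'c, hf'P⟩ := (hfJ.mono hIJ).exists_spread (ε := α \ γ) (ζ := K \ α)
    (b := b) (δ := a - b) (Pre := Pre)
    (fun i hi => hJd i (hIJ hi)) (fun i hi => by
      rw [Finset.mem_sdiff]
      exact ⟨hJα i (hIJ hi), (Finset.mem_filter.1 hi).2⟩)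
    (by rw [Finset.card_sdiff_of_subset hγα]; omega)
    (fun c hc => by
      rw [Finset.mem_sdiff] at hc
      have hm := itemProper_iff.1 (hfJ.mono hIJ) c
      have hcard := hm.card_biUnion (fun i hi => hJd i (hIJ (Finset.mem_filter.1 hi).1))
      have hall : (({i ∈ I | f i = c} : Finset (Sym2 V × Bool)).biUnion
          fun i => (ends i).toFinset) = A := by
        ext x
        simp only [Finset.mem_biUnion, Finset.mem_filter, Sym2.mem_toFinset]
        constructor
        · rintro ⟨i, ⟨hi, -⟩, hx⟩
          exact (hJx i (hIJ hi) x hx).1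
        · intro hx
          have := hc.1
          rw [← h.image_row (hA.trans hα.symm) hx, Finset.mem_image] at this
          obtain ⟨w, hw, hwc⟩ := this
          have h4 : f (cellItem z x w) = c := by rw [hf x hx w hw, hwc]
          exact ⟨cellItem z x w, ⟨Finset.mem_filter.2 ⟨(hJ _).2 ⟨x, hx, w, hw, rfl⟩,
            by rw [h4]; exact hc.2⟩, h4⟩, mem_cellItem _ _ _⟩
      rw [hall, hA] at hcard
      omega)
    hb (by rw [Finset.card_sdiff_of_subset hαK]; omega)
    (Finset.disjoint_left.2 fun c hc hc' => (Finset.mem_sdiff.1 hc').2 (Finset.mem_sdiff.1 hc).1)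
    (fun i hi => by
      obtain ⟨e, he, rfl⟩ := Finset.mem_image.1 hi
      exact (hfE e he).2)
    (fun c hc => by
      rw [hPim] at hc ⊢
      have h1 := hcond c hc
      have h2 : ({i ∈ Pre | f i = c} : Finset _).card ≤
          ({e ∈ E | φ e = c} : Finset (Sym2 V)).card := by
        refine (Finset.card_le_card (t := ({e ∈ E | φ e = c} : Finset (Sym2 V)).image
          fun e => (e, false)) fun i hi => ?_).trans Finset.card_image_le
        obtain ⟨hi, hic⟩ := Finset.mem_filter.1 hi
        obtain ⟨e, he, rfl⟩ := Finset.mem_image.1 hi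
        exact Finset.mem_image_of_mem _ (Finset.mem_filter.2 ⟨he, by rw [← (hfE e he).1, hic]⟩)
      omega)
  have hunion : ∀ c, c ∈ (α \ γ) ∪ (K \ α) ↔ c ∈ K \ γ := by
    intro c; simp only [Finset.mem_union, Finset.mem_sdiff]
    have := @hγα c; have := @hαK c; tauto
  have hI : ∀ u ∈ A, ∀ v ∈ A, cellItem z u v ∈ I ↔ L u v ∉ γ := by
    intro u hu v hv
    simp only [I, Finset.mem_filter, hf u hu v hv, and_iff_right_iff_imp]
    exact fun _ => (hJ _).2 ⟨u, hu, v, hv, rfl⟩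
  let L' : V → V → C := fun u v => if L u v ∈ γ then L u v else f' (cellItem z u v)
  have hL'm : ∀ u ∈ A, ∀ v ∈ A, L u v ∉ γ → f' (cellItem z u v) ∈ K ∧ f' (cellItem z u v) ∉ γ := by
    intro u hu v hv huv
    have := (hunion _).1 (hf'm _ ((hI u hu v hv).2 huv))
    rwa [Finset.mem_sdiff] at this
  refine ⟨L', ?_, ?_, ?_, ?_, ?_, ?_, ?_⟩
  · intro u hu v hv
    have : cellItem z u v = cellItem z v u := by
      by_cases huv : u = v
      · rw [huv]
      · simp [cellItem, huv, Ne.symm huv, Sym2.eq_swap]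
    simp only [L', this, h.symm u hu v hv]
  · intro u hu
    have : cellItem z (z u) (z u) = cellItem z u u := by
      simp [cellItem, h.z_z u hu, Sym2.eq_swap]
    simp only [L', this, h.diag u hu]
  · intro u hu v hv
    simp only [L']
    split_ifs with huv
    · exact hαK (hγα huv)
    · exact (hL'm u hu v hv huv).1
  · intro u hu v hv w hw
    simp only [L']
    split_ifs with h1 h2 h2
    · exact h.inj u hu v hv w hw
    · intro he; exact absurd h1 (he ▸ (hL'm u hu w hw h2).2)
    · intro he; exact absurd h2 (he ▸ (hL'm u hu v hv h1).2)
    · intro he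
      by_contra hvw
      exact hp' _ ((hI u hu v hv).2 h1) _ ((hI u hu w hw).2 h2)
        (fun h => hvw (cellItem_right_inj h)) he u (mem_cellItem _ _ _) (mem_cellItem _ _ _)
  · intro u _ v _ huv
    simp [L', huv]
  · intro u v huv
    obtain ⟨hu, hv, h1, h2⟩ := hEA u v huv
    simp only [L', h1, h2, if_false, hPreJ u v huv]
    rw [hf'P _ (Finset.mem_image_of_mem _ huv), (hfE _ huv).1]
  · intro c hc
    have hm := itemProper_iff.1 hp' c
    have hcard := hm.card_biUnion (fun i hi => hJd i (hIJ (Finset.mem_filter.1 hi).1))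
    rw [hf'c c ((hunion c).2 hc)] at hcard
    have hcγ := (Finset.mem_sdiff.1 hc).2
    have hall : (({i ∈ I | f' i = c} : Finset (Sym2 V × Bool)).biUnion
        fun i => (ends i).toFinset) = {u ∈ A | ¬ ∀ v ∈ A, L' u v ≠ c} := by
      ext x
      simp only [Finset.mem_biUnion, Finset.mem_filter, Sym2.mem_toFinset]
      constructor
      · rintro ⟨i, ⟨hi, hic⟩, hx⟩
        obtain ⟨hxA, w, hw, rfl⟩ := hJx i (hIJ hi) x hx
        refine ⟨hxA, fun hcon => hcon w hw ?_⟩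
        simp only [L', (hI x hxA w hw).1 hi, if_false, hic]
      · rintro ⟨hx, hcon⟩
        push Not at hcon
        obtain ⟨w, hw, hwc⟩ := hcon
        simp only [L'] at hwc
        split_ifs at hwc with h1
        · exact absurd (hwc ▸ h1) hcγ
        · exact ⟨cellItem z x w, ⟨(hI x hx w hw).2 h1, hwc⟩, mem_cellItem _ _ _⟩
    rw [hall] at hcard
    have := Finset.card_filter_add_card_filter_not (s := A) (fun u => ∀ v ∈ A, L' u v ≠ c)
    rw [hcard, hA] at this
    omega

theorem SymLatin.exists_join {A B : Finset V} {K α γ : Finset C} {z₁ z₂ : V → V}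
    {L₁ L₂ : V → V → C} {a b : ℕ} (h₁ : SymLatin A α z₁ L₁) (h₂ : SymLatin B γ z₂ L₂)
    (hAB : Disjoint A B) (hA : A.card = 2 * a) (hB : B.card = 2 * b) (hα : α.card = 2 * a)
    (hγ : γ.card = 2 * b) (hK : K.card = 2 * (a + b)) (hγα : γ ⊆ α) (hαK : α ⊆ K) (hb : 1 ≤ b)
    (hba : b ≤ a) {φ : Sym2 V → C} {E : Finset (Sym2 V)} (hE : ∀ e ∈ E, ¬ e.IsDiag)
    (hEA : ∀ u v, s(u, v) ∈ E → u ∈ A ∧ v ∈ A ∧ L₁ u v = φ s(u, v) ∧ φ s(u, v) ∉ γ)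
    (hcond : ∀ c ∈ E.image φ, ({e ∈ E | φ e = c} : Finset (Sym2 V)).card + (E.image φ).card + b
      ≤ a + 1) :
    ∃ z L, SymLatin (A ∪ B) K z L ∧ (∀ u ∈ A, z u = z₁ u) ∧ (∀ u ∈ B, z u = z₂ u) ∧
      (∀ u ∈ B, ∀ v ∈ B, L u v = L₂ u v) ∧ (∀ u ∈ A, ∀ v ∈ A, L₁ u v ∈ γ → L u v = L₁ u v) ∧
      ∀ u v, s(u, v) ∈ E → L u v = φ s(u, v) := by
  obtain ⟨L', hsymm, hdiag, hmem, hinj, hkeep, hφ, hmiss⟩ :=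
    h₁.exists_spread hA hα hγ hK hγα hαK hb hba hE hEA hcond
  let t : V → Finset C := fun u => K \ A.image (L' u)
  have himK : ∀ u ∈ A, A.image (L' u) ⊆ K := by
    intro u hu c hc
    obtain ⟨v, hv, rfl⟩ := Finset.mem_image.1 hc
    exact hmem u hu v hv
  have htγ : ∀ u ∈ A, t u ⊆ K \ γ := by
    intro u hu c hc
    rw [Finset.mem_sdiff] at hc ⊢
    refine ⟨hc.1, fun hcγ => hc.2 ?_⟩
    have := hγα hcγ
    rw [← h₁.image_row (hA.trans hα.symm) hu, Finset.mem_image] at this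
    obtain ⟨w, hw, rfl⟩ := this
    exact Finset.mem_image.2 ⟨w, hw, hkeep u hu w hw hcγ⟩
  have hdisj := Finset.disjoint_left.1 hAB
  rcases exists_matching_decomposition (A := A) (K := K \ γ)
    (by rw [Finset.card_sdiff_of_subset (hγα.trans hαK)]; omega) B t htγ
    (fun u hu => by
      rw [Finset.card_sdiff_of_subset (himK u hu),
        Finset.card_image_of_injOn (fun v hv w hw => hinj u hu v hv w hw)]; omega)
    (fun c hc => by
      rw [hB, ← hmiss c hc]
      congr 1
      ext u
      simp only [t, Finset.mem_filter, Finset.mem_sdiff, Finset.mem_image, not_exists, not_and,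
        (Finset.mem_sdiff.1 hc).1, true_and]) with (h0 | h0) | ⟨g, hgt, hgw, hgv⟩
  · rw [h0, Finset.card_empty] at hA; omega
  · rw [h0, Finset.card_empty] at hB; omega
  have hgK : ∀ u ∈ A, ∀ v ∈ B, g u v ∈ K ∧ g u v ∉ γ ∧ ∀ w ∈ A, L' u w ≠ g u v := by
    intro u hu v hv
    have h1 := hgt u hu v hv
    have h2 := htγ u hu h1
    rw [Finset.mem_sdiff] at h1 h2
    exact ⟨h1.1, h2.2, fun w hw he => h1.2 (Finset.mem_image.2 ⟨w, hw, he⟩)⟩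
  let L : V → V → C := fun u v =>
    if u ∈ A then if v ∈ A then L' u v else g u v else if v ∈ A then g v u else L₂ u v
  have hLAA : ∀ u ∈ A, ∀ v ∈ A, L u v = L' u v := by
    intro u hu v hv; simp [L, hu, hv]
  have hLAB : ∀ u ∈ A, ∀ v ∈ B, L u v = g u v := by
    intro u hu v hv
    have : v ∉ A := fun h => hdisj h hv
    simp [L, hu, this]
  have hLBA : ∀ u ∈ A, ∀ v ∈ B, L v u = g u v := by
    intro u hu v hv
    have : v ∉ A := fun h => hdisj h hv
    simp [L, hu, this]
  have hLBB : ∀ u ∈ B, ∀ v ∈ B, L u v = L₂ u v := by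
    intro u hu v hv
    have h1 : v ∉ A := fun h => hdisj h hv
    have h2 : u ∉ A := fun h => hdisj h hu
    simp [L, h1, h2]
  have hzA : ∀ u ∈ A, (if u ∈ A then z₁ u else z₂ u) = z₁ u := fun u hu => if_pos hu
  have hzB : ∀ u ∈ B, (if u ∈ A then z₁ u else z₂ u) = z₂ u :=
    fun u hu => if_neg fun h => hdisj h hu
  refine ⟨fun u => if u ∈ A then z₁ u else z₂ u, L, ⟨?_, ?_, ?_, ?_, ?_, ?_, ?_⟩, hzA, hzB, hLBB,
    ?_, ?_⟩
  · intro u hu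
    rw [Finset.mem_union] at hu ⊢
    rcases hu with hu | hu
    · rw [hzA u hu]; exact .inl (h₁.z_mem u hu)
    · rw [hzB u hu]; exact .inr (h₂.z_mem u hu)
  · intro u hu
    rcases Finset.mem_union.1 hu with hu | hu
    · rw [hzA u hu]; exact h₁.z_ne u hu
    · rw [hzB u hu]; exact h₂.z_ne u hu
  · intro u hu
    rcases Finset.mem_union.1 hu with hu | hu
    · rw [hzA u hu, hzA _ (h₁.z_mem u hu)]; exact h₁.z_z u hu
    · rw [hzB u hu, hzB _ (h₂.z_mem u hu)]; exact h₂.z_z u hu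
  · intro u hu v hv
    rcases Finset.mem_union.1 hu with hu | hu <;> rcases Finset.mem_union.1 hv with hv | hv
    · rw [hLAA u hu v hv, hLAA v hv u hu, hsymm u hu v hv]
    · rw [hLAB u hu v hv, hLBA u hu v hv]
    · rw [hLBA v hv u hu, hLAB v hv u hu]
    · rw [hLBB u hu v hv, hLBB v hv u hu, h₂.symm u hu v hv]
  · intro u hu
    rcases Finset.mem_union.1 hu with hu | hu
    · rw [hzA u hu, hLAA u hu u hu, hLAA _ (h₁.z_mem u hu) _ (h₁.z_mem u hu), hdiag u hu]
    · rw [hzB u hu, hLBB u hu u hu, hLBB _ (h₂.z_mem u hu) _ (h₂.z_mem u hu), h₂.diag u hu]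
  · intro u hu v hv
    rcases Finset.mem_union.1 hu with hu | hu <;> rcases Finset.mem_union.1 hv with hv | hv
    · rw [hLAA u hu v hv]; exact hmem u hu v hv
    · rw [hLAB u hu v hv]; exact (hgK u hu v hv).1
    · rw [hLBA v hv u hu]; exact (hgK v hv u hu).1
    · rw [hLBB u hu v hv]; exact hαK (hγα (h₂.mem u hu v hv))
  · intro u hu v hv w hw
    rcases Finset.mem_union.1 hu with hu | hu <;> rcases Finset.mem_union.1 hv with hv | hv <;>
      rcases Finset.mem_union.1 hw with hw | hw
    · rw [hLAA u hu v hv, hLAA u hu w hw]; exact hinj u hu v hv w hw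
    · rw [hLAA u hu v hv, hLAB u hu w hw]; exact fun h => absurd h ((hgK u hu w hw).2.2 v hv)
    · rw [hLAB u hu v hv, hLAA u hu w hw]
      exact fun h => absurd h.symm ((hgK u hu v hv).2.2 w hw)
    · rw [hLAB u hu v hv, hLAB u hu w hw]; exact hgw u hu v hv w hw
    · rw [hLBA v hv u hu, hLBA w hw u hu]; exact hgv u hu v hv w hw
    · rw [hLBA v hv u hu, hLBB u hu w hw]
      exact fun h => absurd (h ▸ h₂.mem u hu w hw) (hgK v hv u hu).2.1
    · rw [hLBA w hw u hu, hLBB u hu v hv]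
      exact fun h => absurd (h ▸ h₂.mem u hu v hv) (hgK w hw u hu).2.1
    · rw [hLBB u hu v hv, hLBB u hu w hw]; exact h₂.inj u hu v hv w hw
  · intro u hu v hv huv
    rw [hLAA u hu v hv, hkeep u hu v hv huv]
  · intro u v huv
    rw [hLAA u (hEA u v huv).1 v (hEA u v huv).2.1, hφ u v huv]

end SymLatin

section Colors

variable {ι C : Type*} [DecidableEq C]

theorem Finset.exists_top_subset (W : Finset C) (g : C → ℕ) {s : ℕ} (hs : s ≤ W.card) :
    ∃ S ⊆ W, S.card = s ∧ ∀ x ∈ S, ∀ y ∈ W \ S, g y ≤ g x := by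
  induction s with
  | zero => exact ⟨∅, by simp, by simp, by simp⟩
  | succ s ih =>
    obtain ⟨S, hSW, hS, htop⟩ := ih (by omega)
    have hne : (W \ S).Nonempty := by
      rw [← Finset.card_pos, Finset.card_sdiff_of_subset hSW]; omega
    obtain ⟨x, hx, hmax⟩ := Finset.exists_max_image (W \ S) g hne
    have hx' := Finset.mem_sdiff.1 hx
    refine ⟨insert x S, Finset.insert_subset hx'.1 hSW, ?_, ?_⟩
    · rw [Finset.card_insert_of_notMem hx'.2, hS]
    · intro u hu y hy
      have hy' : y ∈ W \ S := by simp only [Finset.mem_sdiff, Finset.mem_insert] at hy ⊢; tauto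
      rcases Finset.mem_insert.1 hu with rfl | hu
      · exact hmax y hy'
      · exact htop u hu y hy'

theorem exists_color_split {E₁ E₂ : Finset ι} {φ : ι → C} {D K : Finset C} {a b : ℕ}
    (he : E₁.card + E₂.card + D.card ≤ a + b) (he₂ : E₂.card ≤ b) (hD : D.card ≤ 1) (hb : 1 ≤ b)
    (hba : b ≤ a) (hK : K.card = 2 * (a + b)) (h₁ : ∀ e ∈ E₁, φ e ∈ K) (h₂ : ∀ e ∈ E₂, φ e ∈ K)
    (hDK : D ⊆ K) :
    ∃ γ α : Finset C, γ ⊆ α ∧ α ⊆ K ∧ γ.card = 2 * b ∧ α.card = 2 * a ∧ D ⊆ γ ∧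
      (∀ e ∈ E₂, φ e ∈ γ) ∧ (∀ e ∈ E₁, φ e ∈ α) ∧
      ∀ c ∈ ({e ∈ E₁ | φ e ∉ γ} : Finset ι).image φ,
        ({e ∈ ({e ∈ E₁ | φ e ∉ γ} : Finset ι) | φ e = c} : Finset ι).card +
          (({e ∈ E₁ | φ e ∉ γ} : Finset ι).image φ).card + b ≤ a + 1 := by
  set T := E₂.image φ ∪ D with hT
  have hTcard : T.card ≤ E₂.card + D.card :=
    (Finset.card_union_le _ _).trans (Nat.add_le_add_right Finset.card_image_le _)
  have hTK : T ⊆ K := Finset.union_subset (fun c hc => by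
    obtain ⟨e, he, rfl⟩ := Finset.mem_image.1 hc; exact h₂ e he) hDK
  have hTE : ∀ e ∈ E₂, φ e ∈ T := fun e he =>
    Finset.mem_union_left _ (Finset.mem_image_of_mem _ he)
  set W := E₁.image φ \ T with hW
  have hWK : W ⊆ K := fun c hc => by
    obtain ⟨e, he, rfl⟩ := Finset.mem_image.1 (Finset.mem_sdiff.1 hc).1; exact h₁ e he
  have hWcard : W.card ≤ E₁.card := (Finset.card_le_card Finset.sdiff_subset).trans
    Finset.card_image_le
  have hTW : Disjoint T W := Finset.disjoint_sdiff
  have hEW : ∀ e ∈ E₁, φ e ∈ T ∪ W := fun e he => by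
    simp only [hW, Finset.mem_union, Finset.mem_sdiff]
    have := Finset.mem_image_of_mem φ he
    tauto
  have hTWK : T ∪ W ⊆ K := Finset.union_subset hTK hWK
  have hTWcard : (T ∪ W).card = T.card + W.card := Finset.card_union_of_disjoint hTW
  rcases le_or_gt (T.card + W.card) (2 * b) with hle | hgt
  · obtain ⟨γ, hγ, hγK, hγc⟩ := Finset.exists_subsuperset_card_eq hTWK (n := 2 * b)
      (by omega) (by omega)
    obtain ⟨α, hα, hαK, hαc⟩ := Finset.exists_subsuperset_card_eq hγK (n := 2 * a)
      (by omega) (by omega)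
    have hTγ := Finset.subset_union_left.trans hγ
    refine ⟨γ, α, hα, hαK, hγc, hαc, Finset.subset_union_right.trans hTγ,
      fun e he => hTγ (hTE e he), fun e he => hα (hγ (hEW e he)), ?_⟩
    intro c hc
    obtain ⟨e, he, -⟩ := Finset.mem_image.1 hc
    rw [Finset.mem_filter] at he
    exact absurd (hγ (hEW e he.1)) he.2
  · obtain ⟨S, hSW, hS, htop⟩ := Finset.exists_top_subset W
      (fun c => ({e ∈ E₁ | φ e = c} : Finset ι).card) (s := 2 * b - T.card) (by omega)
    have hTS : T ∪ S ⊆ T ∪ W := Finset.union_subset_union_right hSW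
    have hTSc : (T ∪ S).card = T.card + S.card := Finset.card_union_of_disjoint
      (hTW.mono_right hSW)
    obtain ⟨α, hα, hαK, hαc⟩ := Finset.exists_subsuperset_card_eq hTWK (n := 2 * a)
      (by omega) (by omega)
    refine ⟨T ∪ S, α, hTS.trans hα, hαK, by omega, hαc,
      Finset.subset_union_right.trans Finset.subset_union_left,
      fun e he => Finset.mem_union_left _ (hTE e he), fun e he => hα (hEW e he), ?_⟩
    have himage : ({e ∈ E₁ | φ e ∉ T ∪ S} : Finset ι).image φ = W \ S := by
      ext c
      simp only [hW, Finset.mem_image, Finset.mem_filter, Finset.mem_sdiff, Finset.mem_union]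
      constructor
      · rintro ⟨e, ⟨he, h⟩, rfl⟩
        exact ⟨⟨⟨e, he, rfl⟩, by tauto⟩, by tauto⟩
      · rintro ⟨⟨⟨e, he, rfl⟩, h⟩, h'⟩
        exact ⟨e, ⟨he, by tauto⟩, rfl⟩
    rw [himage]
    intro c hc
    have hc' := Finset.mem_sdiff.1 hc
    have hg : ({e ∈ ({e ∈ E₁ | φ e ∉ T ∪ S} : Finset ι) | φ e = c} : Finset ι).card ≤
        ({e ∈ E₁ | φ e = c} : Finset ι).card :=
      Finset.card_le_card (Finset.filter_subset_filter _ (Finset.filter_subset _ _))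
    have hsum : ∑ d ∈ W, ({e ∈ E₁ | φ e = d} : Finset ι).card ≤ E₁.card := by
      classical
      rw [← Finset.card_biUnion fun c _ d _ hcd => Finset.disjoint_filter.2
        fun e _ h h' => hcd (h.symm.trans h')]
      exact Finset.card_le_card (Finset.biUnion_subset.2 fun c _ => Finset.filter_subset _ _)
    have hpos : ∀ d ∈ W, 1 ≤ ({e ∈ E₁ | φ e = d} : Finset ι).card := by
      intro d hd
      obtain ⟨e, he, hed⟩ := Finset.mem_image.1 (Finset.mem_sdiff.1 hd).1
      exact Finset.card_pos.2 ⟨e, Finset.mem_filter.2 ⟨he, hed⟩⟩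
    rw [← Finset.sum_sdiff hSW, ← Finset.add_sum_erase _ _ hc] at hsum
    have hs1 := Finset.card_nsmul_le_sum ((W \ S).erase c)
      (fun d => ({e ∈ E₁ | φ e = d} : Finset ι).card) 1
      fun d hd => hpos d (Finset.mem_sdiff.1 (Finset.mem_of_mem_erase hd)).1
    have hs2 := Finset.card_nsmul_le_sum S
      (fun d => ({e ∈ E₁ | φ e = d} : Finset ι).card) (({e ∈ E₁ | φ e = c} : Finset ι).card)
      fun d hd => htop d hd c hc
    rw [Finset.card_erase_of_mem hc, smul_eq_mul, mul_one] at hs1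
    rw [smul_eq_mul] at hs2
    have hWS := Finset.card_sdiff_of_subset hSW
    have h1 := hpos c hc'.1
    have hWSpos : 1 ≤ (W \ S).card := Finset.card_pos.2 ⟨c, hc⟩
    rcases Nat.lt_or_ge 1 (({e ∈ E₁ | φ e = c} : Finset ι).card) with h2 | h2
    · have := Nat.mul_le_mul_left S.card h2
      omega
    · omega

end Colors

/-- `c` properly colours the edges of the complete graph on `D` with colours from `K`. -/
structure IsCompleteColoring {V C : Type*} (D : Finset V) (K : Finset C) (c : V → V → C) :
    Prop where
  symm : ∀ u ∈ D, ∀ v ∈ D, c u v = c v u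
  mem : ∀ u ∈ D, ∀ v ∈ D, v ≠ u → c u v ∈ K
  inj : ∀ u ∈ D, ∀ v ∈ D, ∀ w ∈ D, v ≠ u → w ≠ u → c u v = c u w → v = w

section CompleteColoring

variable {V C : Type*} [DecidableEq V] [DecidableEq C]

/-- The vertices of `D` that are on no edge of colour `q`. -/
def missingVertices (D : Finset V) (c : V → V → C) (q : C) : Finset V :=
  {x ∈ D | ∀ v ∈ D, v ≠ x → c x v ≠ q}

theorem mem_missingVertices {D : Finset V} {c : V → V → C} {q : C} {x : V} :
    x ∈ missingVertices D c q ↔ x ∈ D ∧ ∀ v ∈ D, v ≠ x → c x v ≠ q := by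
  simp [missingVertices]

theorem Finset.even_card_of_involution (S : Finset V) (g : V → V) (h1 : ∀ x ∈ S, g x ∈ S)
    (h2 : ∀ x ∈ S, g x ≠ x) (h3 : ∀ x ∈ S, g (g x) = x) : Even S.card := by
  have : ∑ _x ∈ S, (1 : ZMod 2) = 0 :=
    Finset.sum_involution (fun x _ => g x) (fun _ _ => by decide) (fun x hx _ => h2 x hx)
      h1 h3
  rw [Finset.sum_const, nsmul_eq_mul, mul_one] at this
  exact (ZMod.natCast_eq_zero_iff_even).1 this

theorem IsCompleteColoring.even_card_sdiff_missing {D : Finset V} {K : Finset C} {c : V → V → C}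
    (h : IsCompleteColoring D K c) (q : C) : Even (D \ missingVertices D c q).card := by
  have hx : ∀ x ∈ D \ missingVertices D c q, ∃ y, y ∈ D ∧ y ≠ x ∧ c x y = q := by
    intro x hx
    rw [Finset.mem_sdiff, mem_missingVertices] at hx
    have := hx.2
    push Not at this
    exact this hx.1
  choose! g hg using hx
  have hmem : ∀ x ∈ D \ missingVertices D c q, g x ∈ D \ missingVertices D c q := by
    intro x hx
    obtain ⟨h1, h2, h3⟩ := hg x hx
    have hxD := (Finset.mem_sdiff.1 hx).1
    rw [Finset.mem_sdiff, mem_missingVertices]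
    exact ⟨h1, fun hcon => hcon.2 x hxD h2.symm (by rw [← h.symm x hxD _ h1, h3])⟩
  refine Finset.even_card_of_involution _ g hmem (fun x hx => (hg x hx).2.1) fun x hx => ?_
  have hxD := (Finset.mem_sdiff.1 hx).1
  obtain ⟨h1, h2, h3⟩ := hg x hx
  obtain ⟨h4, h5, h6⟩ := hg _ (hmem x hx)
  exact h.inj _ h1 _ h4 x hxD h5 h2.symm (by rw [h6, ← h.symm x hxD _ h1, h3])

theorem IsCompleteColoring.exists_extend_vertex {D : Finset V} {K : Finset C} {c : V → V → C}
    (h : IsCompleteColoring D K c) {j : ℕ} (hcard : D.card + j = K.card)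
    (heven : Even (K.card + 1)) (hmiss : ∀ q ∈ K, (missingVertices D c q).card ≤ j + 1)
    {w : V} (hw : w ∉ D) :
    ∃ c' : V → V → C, IsCompleteColoring (insert w D) K c' ∧
      (∀ u ∈ D, ∀ v ∈ D, c' u v = c u v) ∧
      ∀ q ∈ K, (missingVertices (insert w D) c' q).card ≤ j := by
  have hpar : ∀ q ∈ K, (missingVertices D c q).card ≠ j + 1 →
      (missingVertices D c q).card + 1 ≤ j := by
    intro q hq hne
    have h1 := h.even_card_sdiff_missing q
    have h2 := hmiss q hq
    have hsub : missingVertices D c q ⊆ D := Finset.filter_subset _ _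
    rw [Finset.card_sdiff_of_subset hsub] at h1
    have h3 := Finset.card_le_card hsub
    rw [Nat.even_iff] at h1 heven
    omega
  let t : V ⊕ Fin j → Finset C := Sum.elim (fun x => {q ∈ K | x ∈ missingVertices D c q})
    fun _ => {q ∈ K | (missingVertices D c q).card ≠ j + 1}
  have hrow : ∀ x ∈ D, (t (.inl x)).card = j + 1 := by
    intro x hx
    have h1 : t (.inl x) = K \ (D.erase x).image (c x) := by
      ext q
      simp only [t, Sum.elim_inl, Finset.mem_filter, Finset.mem_sdiff, mem_missingVertices, hx,
        true_and, Finset.mem_image, Finset.mem_erase, not_exists, not_and]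
      exact and_congr_right fun _ => ⟨fun h v hv => h v hv.2 hv.1, fun h v hv hvx => h v ⟨hvx, hv⟩⟩
    have h2 : (D.erase x).image (c x) ⊆ K := by
      intro q hq
      obtain ⟨v, hv, rfl⟩ := Finset.mem_image.1 hq
      rw [Finset.mem_erase] at hv
      exact h.mem x hx v hv.2 hv.1
    rw [h1, Finset.card_sdiff_of_subset h2, Finset.card_image_of_injOn, Finset.card_erase_of_mem hx]
    · have := Finset.card_pos.2 ⟨x, hx⟩; omega
    · intro v hv u hu
      rw [Finset.mem_coe, Finset.mem_erase] at hv hu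
      exact h.inj x hx v hv.2 u hu.2 hv.1 hu.1
  have htK : ∀ s, t s ⊆ K := by
    rintro (x | i) <;> exact Finset.filter_subset _ _
  have hAcard : (D.disjSum (Finset.univ : Finset (Fin j))).card = K.card := by
    rw [Finset.card_disjSum, Finset.card_fin, hcard]
  have key : (D.disjSum (Finset.univ : Finset (Fin j))) = ∅ ∨ ∃ f : V ⊕ Fin j → C,
      (∀ s ∈ D.disjSum Finset.univ, f s ∈ t s) ∧ Set.InjOn f (D.disjSum Finset.univ : Finset (V ⊕ Fin j)) := by
    refine exists_injOn_of_hall _ t fun S hS => ?_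
    have hSD : ∀ x, .inl x ∈ S → x ∈ D := fun x hx => by simpa using hS hx
    by_cases hinr : ∃ i, .inr i ∈ S
    · obtain ⟨i, hi⟩ := hinr
      set S₁ : Finset V := {x ∈ D | .inl x ∈ S} with hS₁
      have hSsub : S ⊆ S₁.disjSum (Finset.univ : Finset (Fin j)) := by
        rintro (x | i) hx
        · simp [hS₁, hx, hSD x hx]
        · simp
      have hScard := Finset.card_le_card hSsub
      rw [Finset.card_disjSum, Finset.card_fin] at hScard
      have hNK : S.biUnion t ⊆ K := Finset.biUnion_subset.2 fun s _ => htK s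
      have hT : (K \ S.biUnion t).card * (j + 1) ≤ (D \ S₁).card * (j + 1) := by
        refine Finset.card_mul_le_card_mul (fun q x => x ∈ missingVertices D c q) ?_ ?_
        · intro q hq
          simp only [Finset.mem_sdiff, Finset.mem_biUnion, not_exists, not_and] at hq
          have hti : (missingVertices D c q).card = j + 1 := by
            have := hq.2 _ hi
            simp only [t, Sum.elim_inr, Finset.mem_filter, hq.1, true_and, not_not] at this
            exact this
          rw [← hti]
          refine Finset.card_le_card fun x hx => ?_
          have hxD := (mem_missingVertices.1 hx).1
          simp only [Finset.bipartiteAbove, Finset.mem_filter, Finset.mem_sdiff, hS₁, hxD, hx,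
            true_and, and_true]
          intro hxS
          exact hq.2 _ hxS (by simp [t, hq.1, hx])
        · intro x hx
          have hxD := (Finset.mem_sdiff.1 hx).1
          rw [← hrow x hxD]
          refine Finset.card_le_card fun q hq => ?_
          simp only [Finset.bipartiteBelow, Finset.mem_filter, Finset.mem_sdiff] at hq
          simp [t, hq.1.1, hq.2]
      have hT' := Nat.le_of_mul_le_mul_right hT (Nat.succ_pos j)
      have hSD₁ : S₁ ⊆ D := Finset.filter_subset _ _
      rw [Finset.card_sdiff_of_subset hNK, Finset.card_sdiff_of_subset hSD₁] at hT'
      have h1 := Finset.card_le_card hNK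
      have h2 := Finset.card_le_card hSD₁
      omega
    · have hinl : ∀ s ∈ S, ∃ x ∈ D, s = .inl x := by
        rintro (x | i) hs
        · exact ⟨x, hSD x hs, rfl⟩
        · exact absurd ⟨i, hs⟩ hinr
      refine card_le_card_biUnion_of_regular (d := j + 1) (by omega) (fun s hs => ?_)
        fun q hq => ?_
      · obtain ⟨x, hx, rfl⟩ := hinl s hs
        exact (hrow x hx).ge
      · have hqK : q ∈ K := by
          obtain ⟨s, hs, hqs⟩ := Finset.mem_biUnion.1 hq
          exact htK s hqs
        refine le_trans ?_ (hmiss q hqK)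
        refine (Finset.card_le_card fun s hs => ?_).trans
          (Finset.card_image_le (f := (Sum.inl : V → V ⊕ Fin j)))
        rw [Finset.mem_filter] at hs
        obtain ⟨x, hx, rfl⟩ := hinl s hs.1
        refine Finset.mem_image_of_mem _ ?_
        have := hs.2
        simp only [t, Sum.elim_inl, Finset.mem_filter] at this
        exact this.2
  obtain ⟨f, hft, hf⟩ : ∃ f : V ⊕ Fin j → C,
      (∀ s ∈ D.disjSum Finset.univ, f s ∈ t s) ∧ Set.InjOn f (D.disjSum Finset.univ : Finset (V ⊕ Fin j)) := by
    rcases key with hempty | hf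
    · have : K = ∅ := by rw [← Finset.card_eq_zero, ← hAcard, hempty, Finset.card_empty]
      rw [this] at heven
      simp at heven
    · exact hf
  have hfim : (D.disjSum Finset.univ).image f = K := by
    refine Finset.eq_of_subset_of_card_le (fun q hq => ?_) ?_
    · obtain ⟨s, hs, rfl⟩ := Finset.mem_image.1 hq
      exact htK s (hft s hs)
    · rw [Finset.card_image_of_injOn hf, hAcard]
  have hfx : ∀ x ∈ D, f (.inl x) ∈ K ∧ x ∈ missingVertices D c (f (.inl x)) := by
    intro x hx
    simpa [t] using hft (.inl x) (by simpa using hx)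
  have hfinj : ∀ x ∈ D, ∀ y ∈ D, f (.inl x) = f (.inl y) → x = y := fun x hx y hy he =>
    Sum.inl_injective (hf (by simpa using hx) (by simpa using hy) he)
  have hne : ∀ x ∈ D, x ≠ w := fun x hx he => hw (he ▸ hx)
  let c' : V → V → C := fun u v => if u = w then f (.inl v) else if v = w then f (.inl u) else c u v
  have hc1 : ∀ v, c' w v = f (.inl v) := fun v => by simp [c']
  have hc2 : ∀ u ∈ D, c' u w = f (.inl u) := fun u hu => by simp [c', hne u hu]
  have hc3 : ∀ u ∈ D, ∀ v ∈ D, c' u v = c u v := fun u hu v hv => by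
    simp [c', hne u hu, hne v hv]
  refine ⟨c', ⟨?_, ?_, ?_⟩, hc3, ?_⟩
  · intro u hu v hv
    rcases Finset.mem_insert.1 hu with rfl | hu' <;> rcases Finset.mem_insert.1 hv with rfl | hv'
    · rfl
    · rw [hc1, hc2 v hv']
    · rw [hc1, hc2 u hu']
    · rw [hc3 u hu' v hv', hc3 v hv' u hu', h.symm u hu' v hv']
  · intro u hu v hv hvu
    rcases Finset.mem_insert.1 hu with rfl | hu' <;> rcases Finset.mem_insert.1 hv with rfl | hv'
    · exact absurd rfl hvu
    · rw [hc1]; exact (hfx v hv').1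
    · rw [hc2 u hu']; exact (hfx u hu').1
    · rw [hc3 u hu' v hv']; exact h.mem u hu' v hv' hvu
  · intro u hu v hv x hx hvu hxu
    rcases Finset.mem_insert.1 hu with rfl | hu'
    · rw [hc1, hc1]
      exact hfinj v (Finset.mem_of_mem_insert_of_ne hv hvu) x
        (Finset.mem_of_mem_insert_of_ne hx hxu)
    rcases Finset.mem_insert.1 hv with rfl | hv' <;> rcases Finset.mem_insert.1 hx with rfl | hx'
    · exact fun _ => rfl
    · rw [hc2 u hu', hc3 u hu' x hx']
      exact fun he => absurd he.symm ((mem_missingVertices.1 (hfx u hu').2).2 x hx' hxu)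
    · rw [hc2 u hu', hc3 u hu' v hv']
      exact fun he => absurd he ((mem_missingVertices.1 (hfx u hu').2).2 v hv' hvu)
    · rw [hc3 u hu' v hv', hc3 u hu' x hx']
      exact h.inj u hu' v hv' x hx' hvu hxu
  · intro q hq
    have hsub : ∀ x ∈ D, x ∈ missingVertices (insert w D) c' q →
        x ∈ missingVertices D c q ∧ f (.inl x) ≠ q := by
      intro x hx hm
      rw [mem_missingVertices] at hm ⊢
      refine ⟨⟨hx, fun v hv hvx => ?_⟩, ?_⟩
      · rw [← hc3 x hx v hv]; exact hm.2 v (Finset.mem_insert_of_mem hv) hvx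
      · rw [← hc2 x hx]; exact hm.2 w (Finset.mem_insert_self _ _) (hne x hx).symm
    have hq' := hq
    rw [← hfim, Finset.mem_image] at hq'
    obtain ⟨x | i, hs, hsq⟩ := hq'
    · have hx : x ∈ D := by simpa using hs
      have hwm : w ∉ missingVertices (insert w D) c' q := by
        rw [mem_missingVertices]
        exact fun hcon => hcon.2 x (Finset.mem_insert_of_mem hx) (hne x hx) (by rw [hc1, hsq])
      have h1 : missingVertices (insert w D) c' q ⊆ (missingVertices D c q).erase x := by
        intro y hy
        have hyD : y ∈ D := by
          rcases Finset.mem_insert.1 (mem_missingVertices.1 hy).1 with rfl | h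
          exacts [absurd hy hwm, h]
        obtain ⟨h1, h2⟩ := hsub y hyD hy
        exact Finset.mem_erase.2 ⟨fun he => h2 (he ▸ hsq), h1⟩
      have h2 := Finset.card_le_card h1
      rw [Finset.card_erase_of_mem (hsq ▸ (hfx x hx).2)] at h2
      have := hmiss q hq
      omega
    · have h1 : missingVertices (insert w D) c' q ⊆ insert w (missingVertices D c q) := by
        intro y hy
        rcases Finset.mem_insert.1 (mem_missingVertices.1 hy).1 with rfl | h
        · exact Finset.mem_insert_self _ _
        · exact Finset.mem_insert_of_mem (hsub y h hy).1
      have h2 := (Finset.card_le_card h1).trans (Finset.card_insert_le _ _)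
      have h3 : q ∈ t (.inr i) := hsq ▸ hft _ hs
      simp only [t, Sum.elim_inr, Finset.mem_filter] at h3
      exact h2.trans (hpar q hq h3.2)

theorem IsCompleteColoring.exists_extend {A : Finset V} {K : Finset C}
    (hAK : A.card = K.card + 1) (heven : Even A.card) (j : ℕ) :
    ∀ {D : Finset V} {c : V → V → C}, IsCompleteColoring D K c → D ⊆ A → D.card + j = A.card →
    (∀ q ∈ K, (missingVertices D c q).card ≤ j) →
    ∃ c' : V → V → C, IsCompleteColoring A K c' ∧ ∀ u ∈ D, ∀ v ∈ D, c' u v = c u v := by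
  induction j with
  | zero =>
    intro D c h hDA hcard _
    obtain rfl := Finset.eq_of_subset_of_card_le hDA (by omega)
    exact ⟨c, h, fun _ _ _ _ => rfl⟩
  | succ j ih =>
    intro D c h hDA hcard hmiss
    obtain ⟨w, hwA, hwD⟩ := Finset.exists_mem_notMem_of_card_lt_card (s := D) (t := A) (by omega)
    obtain ⟨c', hc', hext, hm⟩ := h.exists_extend_vertex (j := j) (by omega) (hAK ▸ heven) hmiss hwD
    obtain ⟨c'', hc'', hext'⟩ := ih hc' (Finset.insert_subset hwA hDA)
      (by rw [Finset.card_insert_of_notMem hwD]; omega) hm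
    refine ⟨c'', hc'', fun u hu v hv => ?_⟩
    rw [hext' u (Finset.mem_insert_of_mem hu) v (Finset.mem_insert_of_mem hv), hext u hu v hv]

end CompleteColoring

section Base

variable {V ι C : Type*} [DecidableEq V] [DecidableEq ι] [DecidableEq C]

theorem ItemProper.exists_greedy {ends : ι → Sym2 V} {G : Finset ι} {K : Finset C}
    (hdeg : ∀ e ∈ G, ({i ∈ G | i ≠ e ∧ ∃ v ∈ (ends e).toFinset, v ∈ ends i} : Finset ι).card
      < K.card) {F : Finset ι} (hFG : F ⊆ G) {f : ι → C} (hf : ItemProper ends F f)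
    (hfK : ∀ i ∈ F, f i ∈ K) :
    ∃ f' : ι → C, ItemProper ends G f' ∧ (∀ i ∈ G, f' i ∈ K) ∧ ∀ i ∈ F, f' i = f i := by
  induction hn : (G \ F).card generalizing F f with
  | zero =>
    have hGF : G ⊆ F := Finset.sdiff_eq_empty_iff_subset.1 (Finset.card_eq_zero.1 hn)
    exact ⟨f, hf.mono hGF, fun i hi => hfK i (hGF hi), fun _ _ => rfl⟩
  | succ n ih =>
    obtain ⟨e, he⟩ := Finset.card_pos.1 (by omega : 0 < (G \ F).card)
    have he' := Finset.mem_sdiff.1 he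
    obtain ⟨q, hqK, hq⟩ : ∃ q ∈ K, q ∉
        ({i ∈ G | i ≠ e ∧ ∃ v ∈ (ends e).toFinset, v ∈ ends i} : Finset ι).image f :=
      Finset.exists_mem_notMem_of_card_lt_card (Finset.card_image_le.trans_lt (hdeg e he'.1))
    have hfree : ∀ i ∈ F, f i = q → ∀ v, v ∈ ends e → v ∉ ends i := by
      intro i hi hiq v hv hv'
      refine hq (Finset.mem_image.2 ⟨i, Finset.mem_filter.2 ⟨hFG hi, ?_, v, ?_, hv'⟩, hiq⟩)
      · rintro rfl; exact he'.2 hi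
      · rwa [Sym2.mem_toFinset]
    have hup : ∀ i ∈ F, Function.update f e q i = f i := by
      intro i hi
      rw [Function.update_of_ne]
      rintro rfl; exact he'.2 hi
    obtain ⟨f', h1, h2, h3⟩ := ih (F := insert e F) (f := Function.update f e q)
      (Finset.insert_subset he'.1 hFG) (by
        intro i hi j hj hij
        rcases Finset.mem_insert.1 hi with rfl | hi' <;> rcases Finset.mem_insert.1 hj with rfl | hj'
        · exact absurd rfl hij
        · rw [Function.update_self, hup j hj']
          exact fun h v hv => hfree j hj' h.symm v hv
        · rw [Function.update_self, hup i hi']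
          exact fun h v hv hv' => hfree i hi' h v hv' hv
        · rw [hup i hi', hup j hj']; exact hf i hi' j hj' hij)
      (by
        intro i hi
        rcases Finset.mem_insert.1 hi with rfl | hi
        · rwa [Function.update_self]
        · rw [hup i hi]; exact hfK i hi)
      (by
        rw [Finset.sdiff_insert, Finset.card_erase_of_mem he, hn]; rfl)
    exact ⟨f', h1, h2, fun i hi => (h3 i (Finset.mem_insert_of_mem hi)).trans (hup i hi)⟩

/-- The edges of the complete graph on `R`. -/
def completeEdges (R : Finset V) : Finset (Sym2 V) := R.offDiag.image Sym2.mk.uncurry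

theorem mem_completeEdges {R : Finset V} {u v : V} :
    s(u, v) ∈ completeEdges R ↔ u ∈ R ∧ v ∈ R ∧ u ≠ v := by
  simp only [completeEdges, Finset.mem_image, Finset.mem_offDiag, Prod.exists,
    Function.uncurry_apply_pair, Sym2.eq_iff]
  constructor
  · rintro ⟨x, y, ⟨hx, hy, hxy⟩, ⟨rfl, rfl⟩ | ⟨rfl, rfl⟩⟩
    exacts [⟨hx, hy, hxy⟩, ⟨hy, hx, hxy.symm⟩]
  · rintro ⟨hu, hv, huv⟩
    exact ⟨u, v, ⟨hu, hv, huv⟩, .inl ⟨rfl, rfl⟩⟩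

theorem two_mul_card_completeEdges (R : Finset V) :
    2 * (completeEdges R).card = R.card * R.card - R.card := by
  rw [completeEdges, Sym2.two_mul_card_image_offDiag, Finset.offDiag_card]

theorem card_meet_completeEdges_le (R : Finset V) {e : Sym2 V} (he : e ∈ completeEdges R) :
    ({i ∈ completeEdges R | i ≠ e ∧ ∃ v ∈ e.toFinset, v ∈ i} : Finset (Sym2 V)).card
      ≤ 2 * (R.card - 2) := by
  induction e with | _ u v
  obtain ⟨hu, hv, huv⟩ := mem_completeEdges.1 he
  have hsub : ({i ∈ completeEdges R | i ≠ s(u, v) ∧ ∃ x ∈ (s(u, v) : Sym2 V).toFinset, x ∈ i} :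
      Finset (Sym2 V)) ⊆ ((R.erase u).erase v).image (fun w => s(u, w)) ∪
        ((R.erase u).erase v).image (fun w => s(v, w)) := by
    intro i hi
    obtain ⟨hi, hne, x, hx, hxi⟩ := Finset.mem_filter.1 hi
    obtain ⟨w, rfl⟩ := Sym2.mem_iff_exists.1 hxi
    obtain ⟨h1, h2, h3⟩ := mem_completeEdges.1 hi
    rw [Sym2.mem_toFinset, Sym2.mem_iff] at hx
    simp only [Finset.mem_union, Finset.mem_image, Finset.mem_erase]
    rcases hx with rfl | rfl
    · exact .inl ⟨w, ⟨fun h => hne (h ▸ rfl), h3.symm, h2⟩, rfl⟩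
    · exact .inr ⟨w, ⟨h3.symm, fun h => hne (h ▸ Sym2.eq_swap), h2⟩, rfl⟩
  have hc : ((R.erase u).erase v).card = R.card - 2 := by
    rw [Finset.card_erase_of_mem (Finset.mem_erase.2 ⟨huv.symm, hv⟩), Finset.card_erase_of_mem hu]
    omega
  have h1 := (Finset.card_le_card hsub).trans (Finset.card_union_le _ _)
  have h2 := Finset.card_image_le (s := (R.erase u).erase v) (f := fun w => s(u, w))
  have h3 := Finset.card_image_le (s := (R.erase u).erase v) (f := fun w => s(v, w))
  omega

theorem exists_involution (n : ℕ) : ∀ {A : Finset V} {Z : Finset (Sym2 V)}, A.card = 2 * n →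
    (∀ e ∈ Z, ¬ e.IsDiag) → (∀ e ∈ Z, ∀ v ∈ e, v ∈ A) → ItemMatching id Z →
    ∃ z : V → V, (∀ u ∈ A, z u ∈ A ∧ z u ≠ u ∧ z (z u) = u) ∧ ∀ u v, s(u, v) ∈ Z → z u = v := by
  induction n with
  | zero =>
    intro A Z hA hZd hZA hZ
    obtain rfl := Finset.card_eq_zero.1 hA
    exact ⟨id, by simp, fun u v huv => absurd (hZA _ huv u (by simp)) (by simp)⟩
  | succ n ih =>
    intro A Z hA hZd hZA hZ
    obtain ⟨x, y, hx, hy, hxy, hZxy⟩ : ∃ x y, x ∈ A ∧ y ∈ A ∧ x ≠ y ∧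
        ∀ e ∈ Z, e ≠ s(x, y) → x ∉ e ∧ y ∉ e := by
      rcases Z.eq_empty_or_nonempty with rfl | ⟨e, he⟩
      · obtain ⟨x, hx, y, hy, hxy⟩ := Finset.one_lt_card.1 (by omega : 1 < A.card)
        exact ⟨x, y, hx, hy, hxy, by simp⟩
      · induction e with | _ x y
        refine ⟨x, y, hZA _ he x (by simp), hZA _ he y (by simp), ?_, fun e' he' hne => ?_⟩
        · have := hZd _ he; rwa [Sym2.mk_isDiag_iff] at this
        · exact ⟨hZ _ he _ he' hne.symm x (by simp), hZ _ he _ he' hne.symm y (by simp)⟩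
    obtain ⟨z, hz, hzZ⟩ := ih (A := (A.erase x).erase y) (Z := Z.erase s(x, y))
      (by
        rw [Finset.card_erase_of_mem (Finset.mem_erase.2 ⟨hxy.symm, hy⟩),
          Finset.card_erase_of_mem hx]; omega)
      (fun e he => hZd e (Finset.mem_of_mem_erase he))
      (fun e he v hv => by
        obtain ⟨h1, h2⟩ := Finset.mem_erase.1 he
        obtain ⟨h3, h4⟩ := hZxy e h2 h1
        rw [Finset.mem_erase, Finset.mem_erase]
        exact ⟨fun h => h4 (h ▸ hv), fun h => h3 (h ▸ hv), hZA e h2 v hv⟩)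
      (hZ.mono (Finset.erase_subset _ _))
    refine ⟨fun u => if u = x then y else if u = y then x else z u, fun u hu => ?_,
      fun u v huv => ?_⟩
    · by_cases hux : u = x
      · subst hux; simp [hy, hxy.symm]
      by_cases huy : u = y
      · subst huy; simp [hx, hxy, hux]
      obtain ⟨h1, h2, h3⟩ := hz u (by simp [hux, huy, hu])
      rw [Finset.mem_erase, Finset.mem_erase] at h1
      simp only [hux, huy, if_false, h1.1, h1.2.1]
      exact ⟨h1.2.2, h2, h3⟩
    · by_cases he : s(u, v) = s(x, y)
      · rcases Sym2.eq_iff.1 he with ⟨rfl, rfl⟩ | ⟨rfl, rfl⟩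
        · simp
        · simp [hxy.symm]
      · obtain ⟨h1, h2⟩ := hZxy _ huv he
        have hux : u ≠ x := by rintro rfl; simp at h1
        have huy : u ≠ y := by rintro rfl; simp at h2
        simp only [hux, huy, if_false]
        exact hzZ u v (Finset.mem_erase.2 ⟨he, huv⟩)

end Base

section Base

variable {V C : Type*} [DecidableEq V] [DecidableEq C]

theorem card_unused_le_card_free {R : Finset V} {K : Finset C} {E : Finset (Sym2 V)}
    {φ : Sym2 V → C} {k : ℕ} (hk : 1 ≤ k) (hR : R.card = k + 1) (hK : K.card + 1 = 2 * k)
    (hE : E ⊆ completeEdges R) (hEk : E.card ≤ k) (hφ : ItemProper id E φ)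
    (hφK : ∀ e ∈ E, φ e ∈ K) :
    (K \ E.image φ).card ≤ (completeEdges R \ E).card := by
  have hG := two_mul_card_completeEdges R
  have himK : E.image φ ⊆ K := fun c hc => by
    obtain ⟨e, he, rfl⟩ := Finset.mem_image.1 hc; exact hφK e he
  rw [Finset.card_sdiff_of_subset himK, Finset.card_sdiff_of_subset hE]
  have hEG := Finset.card_le_card hE
  have hpos : 1 ≤ E.card → 1 ≤ (E.image φ).card := fun h =>
    Finset.card_pos.2 ((Finset.card_pos.1 h).image _)
  have hone : (E.image φ).card ≤ 1 → 2 * E.card ≤ k + 1 := by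
    intro h
    rw [Finset.card_le_one] at h
    have hm : ItemMatching id E := fun i hi j hj hij => hφ i hi j hj hij
      (h _ (Finset.mem_image_of_mem _ hi) _ (Finset.mem_image_of_mem _ hj))
    rw [← hm.card_biUnion, ← hR]
    · refine Finset.card_le_card (Finset.biUnion_subset.2 fun e he v hv => ?_)
      obtain ⟨w, rfl⟩ := Sym2.mem_iff_exists.1 (Sym2.mem_toFinset.1 hv)
      exact (mem_completeEdges.1 (hE he)).1
    · intro e he
      induction e with | _ u v
      simpa using (mem_completeEdges.1 (hE he)).2.2
  generalize (E.image φ).card = u at *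
  generalize (completeEdges R).card = g at *
  rw [hR] at hG
  have hG' : 2 * g = k * (k + 1) := by
    rw [hG]
    have : (k + 1) * (k + 1) = k * (k + 1) + (k + 1) := by ring
    omega
  rcases Nat.lt_or_ge k 4 with hk4 | hk4
  · interval_cases k <;> omega
  · obtain ⟨m, rfl⟩ := Nat.exists_eq_add_of_le hk4
    have h4 : 2 * g = m * m + 9 * m + 20 := by rw [hG']; ring
    have : 0 ≤ m * m := Nat.zero_le _
    omega

theorem exists_completeColoring_seed {R : Finset V} {K : Finset C} {E : Finset (Sym2 V)}
    {φ : Sym2 V → C} {k : ℕ} (hk : 1 ≤ k) (hR : R.card = k + 1) (hK : K.card + 1 = 2 * k)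
    (hE : E ⊆ completeEdges R) (hEk : E.card ≤ k) (hφ : ItemProper id E φ)
    (hφK : ∀ e ∈ E, φ e ∈ K) :
    ∃ c : V → V → C, IsCompleteColoring R K c ∧ (∀ u v, s(u, v) ∈ E → c u v = φ s(u, v)) ∧
      ∀ q ∈ K, ∃ u ∈ R, ∃ v ∈ R, u ≠ v ∧ c u v = q := by
  obtain ⟨N, hN, hNc⟩ := Finset.exists_subset_card_eq
    (card_unused_le_card_free hk hR hK hE hEk hφ hφK)
  let g := Finset.equivOfCardEq hNc
  let f : Sym2 V → C := fun e => if h : e ∈ N then g ⟨e, h⟩ else φ e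
  have hNE : ∀ e ∈ N, e ∈ completeEdges R ∧ e ∉ E := fun e he => Finset.mem_sdiff.1 (hN he)
  have hfN : ∀ e (h : e ∈ N), f e = g ⟨e, h⟩ := fun e h => dif_pos h
  have hfNK : ∀ e ∈ N, f e ∈ K ∧ f e ∉ E.image φ := fun e h => by
    rw [hfN e h, ← Finset.mem_sdiff]; exact (g ⟨e, h⟩).2
  have hfE : ∀ e ∈ E, f e = φ e := fun e he => dif_neg fun h => (hNE e h).2 he
  have hfinj : ∀ e ∈ N, ∀ e' ∈ N, f e = f e' → e = e' := by
    intro e he e' he' h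
    rw [hfN e he, hfN e' he'] at h
    exact congrArg Subtype.val (g.injective (Subtype.ext h))
  have hfK : ∀ e ∈ E ∪ N, f e ∈ K := by
    intro e he
    rcases Finset.mem_union.1 he with he | he
    · rw [hfE e he]; exact hφK e he
    · exact (hfNK e he).1
  have hfp : ItemProper id (E ∪ N) f := by
    intro e he e' he' hne
    rcases Finset.mem_union.1 he with he | he <;> rcases Finset.mem_union.1 he' with he' | he'
    · rw [hfE e he, hfE e' he']; exact hφ e he e' he' hne
    · intro h
      exact absurd (Finset.mem_image_of_mem φ he) ((hfE e he) ▸ h ▸ (hfNK e' he').2)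
    · intro h
      exact absurd (Finset.mem_image_of_mem φ he') ((hfE e' he') ▸ h ▸ (hfNK e he).2)
    · exact fun h => absurd (hfinj e he e' he' h) hne
  obtain ⟨f', hp, hK', hext⟩ := hfp.exists_greedy (G := completeEdges R) (K := K)
    (fun e he => (card_meet_completeEdges_le R he).trans_lt (by omega))
    (Finset.union_subset hE fun e he => (hNE e he).1) hfK
  refine ⟨fun u v => f' s(u, v), ⟨?_, ?_, ?_⟩, ?_, ?_⟩
  · intro u _ v _
    rw [Sym2.eq_swap]
  · intro u hu v hv hvu
    exact hK' _ (mem_completeEdges.2 ⟨hu, hv, hvu.symm⟩)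
  · intro u hu v hv w hw hvu hwu he
    by_contra hvw
    exact hp _ (mem_completeEdges.2 ⟨hu, hv, hvu.symm⟩) _ (mem_completeEdges.2 ⟨hu, hw, hwu.symm⟩)
      (fun h => hvw (Sym2.congr_right.1 h)) he u (by simp) (by simp)
  · intro u v huv
    exact (hext _ (Finset.mem_union_left _ huv)).trans (hfE _ huv)
  · intro q hq
    obtain ⟨e, he, heq⟩ : ∃ e ∈ E ∪ N, f e = q := by
      by_cases hqE : q ∈ E.image φ
      · obtain ⟨e, he, rfl⟩ := Finset.mem_image.1 hqE
        exact ⟨e, Finset.mem_union_left _ he, hfE e he⟩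
      · have hqU : q ∈ K \ E.image φ := Finset.mem_sdiff.2 ⟨hq, hqE⟩
        refine ⟨g.symm ⟨q, hqU⟩, Finset.mem_union_right _ (g.symm ⟨q, hqU⟩).2, ?_⟩
        rw [hfN _ (g.symm ⟨q, hqU⟩).2]
        simp
    have heG : e ∈ completeEdges R := by
      rcases Finset.mem_union.1 he with h | h
      exacts [hE h, (hNE e h).1]
    have hq' := hext e he
    rw [heq] at hq'
    induction e with | _ u v
    obtain ⟨hu, hv, huv⟩ := mem_completeEdges.1 heG
    exact ⟨u, hu, v, hv, huv, hq'⟩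

theorem SymLatin.exists_of_few_vertices {A : Finset V} {K : Finset C} {d : C} {k : ℕ} (hk : 1 ≤ k)
    (hA : A.card = 2 * k) (hK : K.card = 2 * k) (hd : d ∈ K) {E Z : Finset (Sym2 V)}
    {φ : Sym2 V → C} (hEd : ∀ e ∈ E, ¬ e.IsDiag) (hEA : ∀ e ∈ E, ∀ v ∈ e, v ∈ A)
    (hEk : E.card ≤ k) (hEV : (E.biUnion Sym2.toFinset).card ≤ k + 1) (hφ : ItemProper id E φ)
    (hφK : ∀ e ∈ E, φ e ∈ K ∧ φ e ≠ d) (hZE : Z ⊆ E) (hZ : ItemMatching id Z) :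
    ∃ z L, SymLatin A K z L ∧ (∀ u v, s(u, v) ∈ E → L u v = φ s(u, v)) ∧
      (∀ u v, s(u, v) ∈ Z → z u = v) ∧ ∀ u ∈ A, L u u = d := by
  obtain ⟨R, hER, hRA, hR⟩ := Finset.exists_subsuperset_card_eq (n := k + 1)
    (Finset.biUnion_subset.2 fun e he v hv => hEA e he v (Sym2.mem_toFinset.1 hv)) hEV (by omega)
  have hKd : (K.erase d).card + 1 = 2 * k := by rw [Finset.card_erase_of_mem hd]; omega
  have hEne : ∀ u v, s(u, v) ∈ E → u ≠ v := fun u v h => by simpa using hEd _ h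
  have hEG : E ⊆ completeEdges R := by
    intro e he
    induction e with | _ u v
    refine mem_completeEdges.2 ⟨hER ?_, hER ?_, hEne u v he⟩ <;>
      exact Finset.mem_biUnion.2 ⟨_, he, by simp [Sym2.mem_toFinset]⟩
  obtain ⟨c₀, hc₀, hcE, hall⟩ := exists_completeColoring_seed hk hR hKd hEG hEk hφ
    fun e he => Finset.mem_erase.2 ⟨(hφK e he).2, (hφK e he).1⟩
  obtain ⟨c, hc, hcR⟩ := IsCompleteColoring.exists_extend (by omega) (by rw [hA]; simp) (k - 1)
    hc₀ hRA (by omega) fun q hq => by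
      obtain ⟨u, hu, v, hv, huv, hq'⟩ := hall q hq
      have hsub : missingVertices R c₀ q ⊆ (R.erase u).erase v := by
        intro x hx
        obtain ⟨hxR, hx⟩ := mem_missingVertices.1 hx
        rw [Finset.mem_erase, Finset.mem_erase]
        refine ⟨?_, ?_, hxR⟩
        · rintro rfl
          exact hx u hu huv (by rw [← hc₀.symm u hu x hv, hq'])
        · rintro rfl
          exact hx v hv huv.symm hq'
      have := Finset.card_le_card hsub
      rw [Finset.card_erase_of_mem (Finset.mem_erase.2 ⟨huv.symm, hv⟩),
        Finset.card_erase_of_mem hu] at this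
      omega
  obtain ⟨z, hz, hzZ⟩ := exists_involution k hA (fun e he => hEd e (hZE he))
    (fun e he => hEA e (hZE he)) hZ
  refine ⟨z, fun u v => if v = u then d else c u v,
    ⟨fun u hu => (hz u hu).1, fun u hu => (hz u hu).2.1, fun u hu => (hz u hu).2.2, ?_, ?_, ?_, ?_⟩,
    ?_, hzZ, ?_⟩
  · intro u hu v hv
    simp only [eq_comm (a := u) (b := v), hc.symm u hu v hv]
  · simp
  · intro u hu v hv
    split_ifs with h
    exacts [hd, Finset.mem_of_mem_erase (hc.mem u hu v hv h)]
  · intro u hu v hv w hw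
    split_ifs with h1 h2 h2
    · exact fun _ => h1.trans h2.symm
    · exact fun h => absurd h.symm (Finset.ne_of_mem_erase (hc.mem u hu w hw h2))
    · exact fun h => absurd h (Finset.ne_of_mem_erase (hc.mem u hu v hv h1))
    · exact hc.inj u hu v hv w hw h1 h2
  · intro u v huv
    obtain ⟨hu, hv, hne⟩ := mem_completeEdges.1 (hEG huv)
    simp only [hne.symm, if_false]
    rw [hcR u hu v hv, hcE u v huv]
  · simp

end Base

section Prescribable

variable {V C : Type*} [DecidableEq V] [DecidableEq C]

theorem card_biUnion_toFinset_le (E : Finset (Sym2 V)) :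
    (E.biUnion Sym2.toFinset).card ≤ 2 * E.card := by
  rw [mul_comm]
  refine Finset.card_biUnion_le_card_mul _ _ _ fun e _ => ?_
  induction e with | _ u v
  rw [Sym2.toFinset_mk_eq]
  exact Finset.card_le_two

theorem exists_separated_subset {E : Finset (Sym2 V)} (hE : E.Nonempty) :
    ∃ F ⊆ E, F.Nonempty ∧ (F.biUnion Sym2.toFinset).card ≤ F.card + 1 ∧
      Disjoint (F.biUnion Sym2.toFinset) ((E \ F).biUnion Sym2.toFinset) := by
  let S := {F ∈ E.powerset | F.Nonempty ∧ (F.biUnion Sym2.toFinset).card ≤ F.card + 1}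
  have hS : S.Nonempty := by
    obtain ⟨e, he⟩ := hE
    refine ⟨{e}, Finset.mem_filter.2 ⟨by simpa using he, by simp, ?_⟩⟩
    simpa using card_biUnion_toFinset_le {e}
  obtain ⟨F, hF, hmax⟩ := Finset.exists_max_image S Finset.card hS
  obtain ⟨hFE, hne, hFc⟩ := Finset.mem_filter.1 hF
  refine ⟨F, Finset.mem_powerset.1 hFE, hne, hFc, Finset.disjoint_left.2 fun v hv hv' => ?_⟩
  obtain ⟨e, he, hve⟩ := Finset.mem_biUnion.1 hv'
  obtain ⟨heE, heF⟩ := Finset.mem_sdiff.1 he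
  have hsub : ((insert e F).biUnion Sym2.toFinset) ⊆
      F.biUnion Sym2.toFinset ∪ e.toFinset.erase v := by
    intro x hx
    rw [Finset.biUnion_insert, Finset.mem_union] at hx
    rw [Finset.mem_union, Finset.mem_erase]
    by_cases hxv : x = v
    · exact Or.inl (hxv ▸ hv)
    · tauto
  have h2 : (e.toFinset.erase v).card ≤ 1 := by
    have := card_biUnion_toFinset_le {e}
    rw [Finset.singleton_biUnion, Finset.card_singleton] at this
    rw [Finset.card_erase_of_mem hve]
    omega
  have hi := Finset.card_insert_of_notMem heF
  have hmem : insert e F ∈ S := by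
    refine Finset.mem_filter.2 ⟨Finset.mem_powerset.2 (Finset.insert_subset heE
      (Finset.mem_powerset.1 hFE)), Finset.insert_nonempty _ _, ?_⟩
    have h1 := Finset.card_le_card hsub
    have h3 := Finset.card_union_le (F.biUnion Sym2.toFinset) (e.toFinset.erase v)
    omega
  have := hmax _ hmem
  omega

/-- There is a symmetric Latin square on `A` with colours `K` that agrees with `φ` on `E`, whose
involution contains the pairs in `Z`, and whose diagonal is constant with value in `D`. -/
def Prescribable (A : Finset V) (K : Finset C) (E Z : Finset (Sym2 V)) (φ : Sym2 V → C)
    (D : Finset C) : Prop :=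
  ∃ z L, SymLatin A K z L ∧ (∀ u v, s(u, v) ∈ E → L u v = φ s(u, v)) ∧
    (∀ u v, s(u, v) ∈ Z → z u = v) ∧ ∀ d ∈ D, ∀ u ∈ A, L u u = d

theorem Prescribable.of_few_vertices {A : Finset V} {K D : Finset C} {k : ℕ} (hk : 1 ≤ k)
    (hA : A.card = 2 * k) (hK : K.card = 2 * k) {E Z : Finset (Sym2 V)}
    {φ : Sym2 V → C} (hEd : ∀ e ∈ E, ¬ e.IsDiag) (hEA : ∀ e ∈ E, ∀ v ∈ e, v ∈ A)
    (hEk : E.card ≤ k) (hEV : (E.biUnion Sym2.toFinset).card ≤ k + 1) (hφ : ItemProper id E φ)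
    (hφK : ∀ e ∈ E, φ e ∈ K) (hZE : Z ⊆ E) (hZ : ItemMatching id Z) (hD : D.card ≤ 1)
    (hDK : D ⊆ K) (hφD : ∀ e ∈ E, φ e ∉ D) : Prescribable A K E Z φ D := by
  obtain ⟨d, hd, hdE, hdD⟩ : ∃ d ∈ K, (∀ e ∈ E, φ e ≠ d) ∧ ∀ d' ∈ D, d = d' := by
    rcases D.eq_empty_or_nonempty with rfl | ⟨d, hd⟩
    · obtain ⟨d, hd, hdE⟩ := Finset.exists_mem_notMem_of_card_lt_card
        (s := E.image φ) (t := K) (by have := Finset.card_image_le (s := E) (f := φ); omega)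
      exact ⟨d, hd, fun e he h => hdE (Finset.mem_image.2 ⟨e, he, h⟩), by simp⟩
    · exact ⟨d, hDK hd, fun e he h => hφD e he (h ▸ hd),
        fun d' hd' => Finset.card_le_one.1 hD d hd d' hd'⟩
  obtain ⟨z, L, h1, h2, h3, h4⟩ := SymLatin.exists_of_few_vertices hk hA hK hd hEd hEA hEk hEV hφ
    (fun e he => ⟨hφK e he, hdE e he⟩) hZE hZ
  exact ⟨z, L, h1, h2, h3, fun d' hd' u hu => (h4 u hu).trans (hdD d' hd')⟩

theorem Prescribable.union {A₁ A₂ : Finset V} {K D : Finset C} {E₁ E₂ Z₁ Z₂ : Finset (Sym2 V)}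
    {φ : Sym2 V → C} {a b : ℕ} (hA : Disjoint A₁ A₂) (hA₁ : A₁.card = 2 * a)
    (hA₂ : A₂.card = 2 * b) (hK : K.card = 2 * (a + b)) (hb : 1 ≤ b) (hba : b ≤ a)
    (hEd : ∀ e ∈ E₁, ¬ e.IsDiag) (hE₁ : ∀ e ∈ E₁, ∀ v ∈ e, v ∈ A₁)
    (hE₂ : ∀ e ∈ E₂, ∀ v ∈ e, v ∈ A₂) (hZ₁ : Z₁ ⊆ E₁) (hZ₂ : Z₂ ⊆ E₂)
    (he : E₁.card + E₂.card + D.card ≤ a + b) (he₂ : E₂.card ≤ b) (hD : D.card ≤ 1)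
    (hDK : D ⊆ K) (hφ₁ : ∀ e ∈ E₁, φ e ∈ K) (hφ₂ : ∀ e ∈ E₂, φ e ∈ K)
    (h₁ : ∀ K' : Finset C, K'.card = 2 * a → D ⊆ K' → (∀ e ∈ E₁, φ e ∈ K') →
      Prescribable A₁ K' E₁ Z₁ φ D)
    (h₂ : ∀ K' : Finset C, K'.card = 2 * b → D ⊆ K' → (∀ e ∈ E₂, φ e ∈ K') →
      Prescribable A₂ K' E₂ Z₂ φ D) :
    Prescribable (A₁ ∪ A₂) K (E₁ ∪ E₂) (Z₁ ∪ Z₂) φ D := by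
  obtain ⟨γ, α, hγα, hαK, hγ, hα, hDγ, hφγ, hφα, hcond⟩ :=
    exists_color_split he he₂ hD hb hba hK hφ₁ hφ₂ hDK
  obtain ⟨z₁, L₁, hL₁, hLE₁, hzZ₁, hd₁⟩ := h₁ α hα (hDγ.trans hγα) hφα
  obtain ⟨z₂, L₂, hL₂, hLE₂, hzZ₂, hd₂⟩ := h₂ γ hγ hDγ hφγ
  have hm : ∀ u v, s(u, v) ∈ E₁ → u ∈ A₁ ∧ v ∈ A₁ := fun u v h =>
    ⟨hE₁ _ h u (Sym2.mem_mk_left u v), hE₁ _ h v (Sym2.mem_mk_right u v)⟩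
  have hm₂ : ∀ u v, s(u, v) ∈ E₂ → u ∈ A₂ ∧ v ∈ A₂ := fun u v h =>
    ⟨hE₂ _ h u (Sym2.mem_mk_left u v), hE₂ _ h v (Sym2.mem_mk_right u v)⟩
  obtain ⟨z, L, hL, hz₁, hz₂, hB, hγL, hE⟩ := SymLatin.exists_join hL₁ hL₂ hA hA₁ hA₂ hα hγ hK hγα
    hαK hb hba (φ := φ) (E := {e ∈ E₁ | φ e ∉ γ}) (fun e he => hEd e (Finset.mem_filter.1 he).1)
    (fun u v h => by
      obtain ⟨h, h'⟩ := Finset.mem_filter.1 h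
      exact ⟨(hm u v h).1, (hm u v h).2, hLE₁ u v h, h'⟩) hcond
  refine ⟨z, L, hL, fun u v h => ?_, fun u v h => ?_, fun d hd u hu => ?_⟩
  · rcases Finset.mem_union.1 h with h | h
    · by_cases hc : φ s(u, v) ∈ γ
      · rw [hγL u (hm u v h).1 v (hm u v h).2 (by rwa [hLE₁ u v h]), hLE₁ u v h]
      · exact hE u v (Finset.mem_filter.2 ⟨h, hc⟩)
    · rw [hB u (hm₂ u v h).1 v (hm₂ u v h).2, hLE₂ u v h]
  · rcases Finset.mem_union.1 h with h | h
    · rw [hz₁ u (hm u v (hZ₁ h)).1, hzZ₁ u v h]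
    · rw [hz₂ u (hm₂ u v (hZ₂ h)).1, hzZ₂ u v h]
  · rcases Finset.mem_union.1 hu with hu | hu
    · rw [hγL u hu u hu (by rw [hd₁ d hd u hu]; exact hDγ hd), hd₁ d hd u hu]
    · rw [hB u hu u hu, hd₂ d hd u hu]

theorem Prescribable.of_card_add_card_le (n : ℕ) : ∀ {A : Finset V} {K D : Finset C}
    {E Z : Finset (Sym2 V)} {φ : Sym2 V → C}, A.card = 2 * n → K.card = 2 * n →
    (∀ e ∈ E, ¬ e.IsDiag) → (∀ e ∈ E, ∀ v ∈ e, v ∈ A) → ItemProper id E φ →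
    (∀ e ∈ E, φ e ∈ K) → Z ⊆ E → ItemMatching id Z → D.card ≤ 1 → D ⊆ K →
    (∀ e ∈ E, φ e ∉ D) → E.card + D.card ≤ n → Prescribable A K E Z φ D := by
  induction n using Nat.strong_induction_on with | _ n ih
  intro A K D E Z φ hA hK hEd hEA hφ hφK hZE hZ hD hDK hφD hcard
  rcases Nat.eq_zero_or_pos n with rfl | hn
  · have hA0 : A = ∅ := by simpa using hA
    have hE0 : E = ∅ := by rw [← Finset.card_eq_zero]; omega
    have hZ0 : Z = ∅ := Finset.subset_empty.1 (hE0 ▸ hZE)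
    have hD0 : D = ∅ := by rw [← Finset.card_eq_zero]; omega
    subst hA0 hE0 hZ0 hD0
    exact ⟨id, fun u v => φ s(u, v), by constructor <;> simp, by simp, by simp, by simp⟩
  obtain ⟨F, k, hk, hkn, hFE, hFk, hFV, hdisj, hrest, hV⟩ : ∃ (F : Finset (Sym2 V)) (k : ℕ), 1 ≤ k ∧
      k ≤ n ∧ F ⊆ E ∧ F.card ≤ k ∧ (F.biUnion Sym2.toFinset).card ≤ k + 1 ∧
      Disjoint (F.biUnion Sym2.toFinset) ((E \ F).biUnion Sym2.toFinset) ∧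
      (k < n → (E \ F).card + D.card ≤ n - k) ∧ (E \ F).card ≤ n - k := by
    rcases E.eq_empty_or_nonempty with rfl | hE
    · exact ⟨∅, 1, le_rfl, hn, by simp, by simp, by simp, by simp, by simp; omega, by simp⟩
    · obtain ⟨F, hFE, hF, hFV, hdisj⟩ := exists_separated_subset hE
      have h1 := Finset.card_le_card hFE
      have h2 := Finset.card_sdiff_of_subset hFE
      have h3 := Finset.card_pos.2 hF
      exact ⟨F, F.card, h3, by omega, hFE, le_rfl, hFV, hdisj, by omega, by omega⟩
  have hφF := hφ.mono hFE
  rcases hkn.eq_or_lt with rfl | hlt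
  · have hEF : E = F := by
      refine subset_antisymm (Finset.sdiff_eq_empty_iff_subset.1 (Finset.card_eq_zero.1 ?_)) hFE
      omega
    subst hEF
    exact Prescribable.of_few_vertices hk hA hK hEd hEA hFk hFV hφ hφK hZE hZ hD hDK hφD
  have hVA : ∀ G ⊆ E, G.biUnion Sym2.toFinset ⊆ A := fun G hG =>
    Finset.biUnion_subset.2 fun e he v hv => hEA e (hG he) v (Sym2.mem_toFinset.1 hv)
  have hrV := card_biUnion_toFinset_le (E \ F)
  obtain ⟨B, hFB, hBA, hB⟩ := Finset.exists_subsuperset_card_eq (n := 2 * k)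
    (Finset.subset_sdiff.2 ⟨hVA F hFE, hdisj⟩) (by omega) (by
      rw [Finset.card_sdiff_of_subset (hVA _ Finset.sdiff_subset)]; omega)
  obtain ⟨hBA, hBd⟩ := Finset.subset_sdiff.1 hBA
  have hB' : (A \ B).card = 2 * (n - k) := by rw [Finset.card_sdiff_of_subset hBA]; omega
  have hFmem : ∀ e ∈ F, ∀ v ∈ e, v ∈ B := fun e he v hv =>
    hFB (Finset.mem_biUnion.2 ⟨e, he, Sym2.mem_toFinset.2 hv⟩)
  have hRmem : ∀ e ∈ E \ F, ∀ v ∈ e, v ∈ A \ B := fun e he v hv =>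
    Finset.mem_sdiff.2 ⟨hEA e (Finset.mem_sdiff.1 he).1 v hv, fun h =>
      Finset.disjoint_left.1 hBd h (Finset.mem_biUnion.2 ⟨e, he, Sym2.mem_toFinset.2 hv⟩)⟩
  have hRE : E \ F ⊆ E := Finset.sdiff_subset
  have hZF : Z ∩ F ⊆ F := Finset.inter_subset_right
  have hZR : Z \ F ⊆ E \ F := Finset.sdiff_subset_sdiff hZE subset_rfl
  have h₁ : ∀ K' : Finset C, K'.card = 2 * k → D ⊆ K' → (∀ e ∈ F, φ e ∈ K') →
      Prescribable B K' F (Z ∩ F) φ D := fun K' hK' hDK' hφK' =>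
    Prescribable.of_few_vertices hk hB hK' (fun e he => hEd e (hFE he)) hFmem hFk hFV hφF hφK' hZF
      (hZ.mono Finset.inter_subset_left) hD hDK' fun e he => hφD e (hFE he)
  have h₂ : ∀ K' : Finset C, K'.card = 2 * (n - k) → D ⊆ K' → (∀ e ∈ E \ F, φ e ∈ K') →
      Prescribable (A \ B) K' (E \ F) (Z \ F) φ D := fun K' hK' hDK' hφK' =>
    ih (n - k) (by omega) hB' hK' (fun e he => hEd e (hRE he)) hRmem (hφ.mono hRE) hφK' hZR
      (hZ.mono Finset.sdiff_subset) hD hDK' (fun e he => hφD e (hRE he)) (hrest hlt)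
  have hc : F.card + (E \ F).card = E.card := by
    rw [Finset.card_sdiff_of_subset hFE]
    exact Nat.add_sub_cancel' (Finset.card_le_card hFE)
  rcases le_total (n - k) k with hle | hle
  · have := Prescribable.union Finset.disjoint_sdiff hB hB' (by rw [hK]; omega) (by omega) hle
      (fun e he => hEd e (hFE he)) hFmem hRmem hZF hZR (by omega) hV hD hDK
      (fun e he => hφK e (hFE he)) (fun e he => hφK e (hRE he)) h₁ h₂
    rwa [Finset.union_sdiff_of_subset hBA, Finset.union_sdiff_of_subset hFE, Finset.union_comm,
      Finset.sdiff_union_inter] at this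
  · have := Prescribable.union Finset.sdiff_disjoint hB' hB (by rw [hK]; omega) hk hle
      (fun e he => hEd e (hRE he)) hRmem hFmem hZR hZF (by omega) hFk hD hDK
      (fun e he => hφK e (hRE he)) (fun e he => hφK e (hFE he)) h₂ h₁
    rwa [Finset.sdiff_union_of_subset hBA, Finset.sdiff_union_of_subset hFE,
      Finset.sdiff_union_inter] at this

end Prescribable

section Layers

variable {V C : Type*} [DecidableEq V] [DecidableEq C]

/-- `L` is a symmetric Latin array on `A` with entries in `K`. -/
structure SymArray (A : Finset V) (K : Finset C) (L : V → V → C) : Prop where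
  symm : ∀ u ∈ A, ∀ v ∈ A, L u v = L v u
  mem : ∀ u ∈ A, ∀ v ∈ A, L u v ∈ K
  inj : ∀ u ∈ A, ∀ v ∈ A, ∀ w ∈ A, L u v = L u w → v = w

theorem SymLatin.exists_swap_diag {A : Finset V} {K : Finset C} {z : V → V} {L : V → V → C}
    (h : SymLatin A K z L) {P : Finset V} (hP : ∀ u ∈ P, z u ∈ P) :
    ∃ L' : V → V → C, SymArray A K L' ∧ (∀ u ∈ P, L' u u = L u (z u)) ∧
      (∀ u ∉ P, ∀ v, L' u v = L u v) ∧ ∀ u v, v ≠ u → v ≠ z u → L' u v = L u v := by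
  have hs : ∀ u ∈ A, ∀ v ∈ A, Equiv.swap u (z u) v ∈ A := by
    intro u hu v hv
    rw [Equiv.swap_apply_def]
    split_ifs
    exacts [h.z_mem u hu, hu, hv]
  refine ⟨fun u v => if u ∈ P then L u (Equiv.swap u (z u) v) else L u v, ⟨?_, ?_, ?_⟩, ?_, ?_, ?_⟩
  · intro u hu v hv
    by_cases huv : u = v
    · rw [huv]
    by_cases hz : v = z u
    · subst hz
      by_cases hp : u ∈ P
      · simp only [hp, hP u hp, if_true, Equiv.swap_apply_right, h.z_z u hu, h.diag u hu]
      · have : z u ∉ P := fun h' => hp (by simpa [h.z_z u hu] using hP _ h')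
        simp only [hp, this, if_false]
        exact h.symm u hu _ hv
    · have hz' : u ≠ z v := fun h' => hz (by rw [h', h.z_z v hv])
      simp only [Equiv.swap_apply_of_ne_of_ne (Ne.symm huv) hz,
        Equiv.swap_apply_of_ne_of_ne huv hz', ite_self]
      exact h.symm u hu v hv
  · intro u hu v hv
    split_ifs
    exacts [h.mem u hu _ (hs u hu v hv), h.mem u hu v hv]
  · intro u hu v hv w hw
    split_ifs
    · exact fun h' => (Equiv.swap u (z u)).injective
        (h.inj u hu _ (hs u hu v hv) _ (hs u hu w hw) h')
    · exact h.inj u hu v hv w hw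
  · intro u hu
    simp [hu]
  · intro u hu v
    simp [hu]
  · intro u v h1 h2
    simp [Equiv.swap_apply_of_ne_of_ne h1 h2]

theorem SymArray.exists_prescribed_diag {A X : Finset V} {K D : Finset C} {E : Finset (Sym2 V)}
    {ψ : Sym2 V → C} {β : V → C} {ζ : V → V} {n : ℕ} (hA : A.card = 2 * n) (hK : K.card = 2 * n)
    (hEd : ∀ e ∈ E, ¬ e.IsDiag) (hEA : ∀ e ∈ E, ∀ v ∈ e, v ∈ A) (hXA : X ⊆ A)
    (hψ : ItemProper id E ψ) (hψK : ∀ e ∈ E, ψ e ∈ K) (hβK : ∀ x ∈ X, β x ∈ K)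
    (hψβ : ∀ e ∈ E, ∀ x ∈ X, x ∈ e → ψ e ≠ β x) (hζA : ∀ x ∈ X, ζ x ∈ A)
    (hζX : ∀ x ∈ X, ζ x ∉ X) (hζE : ∀ x ∈ X, ∀ e ∈ E, ζ x ∉ e)
    (hζ : ∀ x ∈ X, ∀ y ∈ X, ζ x = ζ y → x = y) (hD : D.card ≤ 1) (hDK : D ⊆ K)
    (hψD : ∀ e ∈ E, ψ e ∉ D) (hβD : ∀ x ∈ X, β x ∉ D) (hcard : E.card + X.card + D.card ≤ n) :
    ∃ L : V → V → C, SymArray A K L ∧ (∀ u v, s(u, v) ∈ E → L u v = ψ s(u, v)) ∧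
      (∀ x ∈ X, L x x = β x ∧ L (ζ x) (ζ x) = β x) ∧
      ∀ d ∈ D, ∀ u ∈ A, u ∉ X → u ∉ X.image ζ → L u u = d := by
  classical
  let Z : Finset (Sym2 V) := X.image fun x => s(x, ζ x)
  let φ : Sym2 V → C := fun e => if h : ∃ x ∈ X, e = s(x, ζ x) then β h.choose else ψ e
  have hinj : ∀ x ∈ X, ∀ y ∈ X, ∀ v ∈ s(x, ζ x), v ∈ s(y, ζ y) → x = y := by
    intro x hx y hy v hv hv'
    rcases Sym2.mem_iff.1 hv with rfl | rfl <;> rcases Sym2.mem_iff.1 hv' with h | h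
    · exact h
    · exact absurd (h ▸ hx) (hζX y hy)
    · exact absurd (h ▸ hy) (hζX x hx)
    · exact hζ x hx y hy h
  have hφE : ∀ e ∈ E, φ e = ψ e := fun e he => dif_neg <| by
    rintro ⟨x, hx, rfl⟩
    exact hζE x hx _ he (Sym2.mem_mk_right _ _)
  have hφZ : ∀ x ∈ X, φ s(x, ζ x) = β x := fun x hx => by
    have h : ∃ y ∈ X, s(x, ζ x) = s(y, ζ y) := ⟨x, hx, rfl⟩
    have hφ : φ s(x, ζ x) = β h.choose := dif_pos h
    rw [hφ, ← hinj x hx _ h.choose_spec.1 x (Sym2.mem_mk_left _ _)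
      (h.choose_spec.2 ▸ Sym2.mem_mk_left _ _)]
  have hZ : ∀ e ∈ Z, ∃ x ∈ X, s(x, ζ x) = e := fun e he => Finset.mem_image.1 he
  have hZm : ItemMatching id Z := by
    intro e he f hf hne v hv hv'
    obtain ⟨x, hx, rfl⟩ := hZ e he
    obtain ⟨y, hy, rfl⟩ := hZ f hf
    exact hne (by rw [hinj x hx y hy v hv hv'])
  have hEZ : ∀ e ∈ E, ∀ x ∈ X, ∀ v ∈ e, v ∈ s(x, ζ x) → ψ e ≠ β x := by
    intro e he x hx v hv hv'
    rcases Sym2.mem_iff.1 hv' with rfl | rfl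
    exacts [hψβ e he _ hx hv, absurd hv (hζE x hx e he)]
  have hφp : ItemProper id (E ∪ Z) φ := by
    intro e he f hf hne hc v hv hv'
    rcases Finset.mem_union.1 he with he | he <;> rcases Finset.mem_union.1 hf with hf | hf
    · rw [hφE e he, hφE f hf] at hc
      exact hψ e he f hf hne hc v hv hv'
    · obtain ⟨x, hx, rfl⟩ := hZ f hf
      rw [hφE e he, hφZ x hx] at hc
      exact hEZ e he x hx v hv hv' hc
    · obtain ⟨x, hx, rfl⟩ := hZ e he
      rw [hφE f hf, hφZ x hx] at hc
      exact hEZ f hf x hx v hv' hv hc.symm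
    · exact hZm e he f hf hne v hv hv'
  have hall : ∀ {p : C → Prop}, (∀ e ∈ E, p (ψ e)) → (∀ x ∈ X, p (β x)) →
      ∀ e ∈ E ∪ Z, p (φ e) := by
    intro p h1 h2 e he
    rcases Finset.mem_union.1 he with he | he
    · rw [hφE e he]
      exact h1 e he
    · obtain ⟨x, hx, rfl⟩ := hZ e he
      rw [hφZ x hx]
      exact h2 x hx
  obtain ⟨z, L, hL, hLE, hz, hLD⟩ := Prescribable.of_card_add_card_le n (A := A) (K := K) (D := D)
    (E := E ∪ Z) (Z := Z) (φ := φ) hA hK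
    (fun e he => by
      rcases Finset.mem_union.1 he with he | he
      · exact hEd e he
      · obtain ⟨x, hx, rfl⟩ := hZ e he
        exact fun h => hζX x hx ((Sym2.mk_isDiag_iff.1 h) ▸ hx))
    (fun e he v hv => by
      rcases Finset.mem_union.1 he with he | he
      · exact hEA e he v hv
      · obtain ⟨x, hx, rfl⟩ := hZ e he
        rcases Sym2.mem_iff.1 hv with rfl | rfl
        exacts [hXA hx, hζA x hx])
    hφp (hall hψK hβK) Finset.subset_union_right hZm hD hDK (hall (p := (· ∉ D)) hψD hβD)
    (by
      have h1 := Finset.card_union_le E Z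
      have h2 : Z.card ≤ X.card := Finset.card_image_le
      omega)
  have hmemZ : ∀ x ∈ X, s(x, ζ x) ∈ Z := fun x hx => Finset.mem_image_of_mem _ hx
  have hzx : ∀ x ∈ X, z x = ζ x := fun x hx => hz x (ζ x) (hmemZ x hx)
  have hzζ : ∀ x ∈ X, z (ζ x) = x := fun x hx => hz (ζ x) x (Sym2.eq_swap ▸ hmemZ x hx)
  have hLx : ∀ x ∈ X, L x (ζ x) = β x := fun x hx => by
    rw [hLE x (ζ x) (Finset.mem_union_right _ (hmemZ x hx)), hφZ x hx]
  obtain ⟨L', hL', hP, hnP, hne⟩ := hL.exists_swap_diag (P := X ∪ X.image ζ) (by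
    intro u hu
    rcases Finset.mem_union.1 hu with hu | hu
    · exact Finset.mem_union_right _ (hzx u hu ▸ Finset.mem_image_of_mem _ hu)
    · obtain ⟨x, hx, rfl⟩ := Finset.mem_image.1 hu
      exact Finset.mem_union_left _ ((hzζ x hx).symm ▸ hx))
  refine ⟨L', hL', fun u v huv => ?_, fun x hx => ⟨?_, ?_⟩, fun d hd u hu h1 h2 => ?_⟩
  · rw [← hφE _ huv, ← hLE u v (Finset.mem_union_left _ huv)]
    by_cases hu : u ∈ X
    · refine hne u v (fun h => hEd _ huv (Sym2.mk_isDiag_iff.2 h.symm)) fun h => ?_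
      rw [hzx u hu] at h
      exact hζE u hu _ huv (h ▸ Sym2.mem_mk_right _ _)
    · refine hnP u (fun h => ?_) v
      rcases Finset.mem_union.1 h with h | h
      · exact hu h
      · obtain ⟨x, hx, rfl⟩ := Finset.mem_image.1 h
        exact hζE x hx _ huv (Sym2.mem_mk_left _ _)
  · rw [hP x (Finset.mem_union_left _ hx), hzx x hx, hLx x hx]
  · rw [hP _ (Finset.mem_union_right _ (Finset.mem_image_of_mem _ hx)), hzζ x hx,
      hL.symm _ (hζA x hx) _ (hXA hx), hLx x hx]
  · rw [hnP u (by simp only [Finset.mem_union, not_or]; exact ⟨h1, h2⟩), hLD d hd u hu]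

theorem exists_injOn_avoiding {A X U : Finset V} (h : U.card + X.card ≤ A.card) :
    ∃ ζ : V → V, (∀ x ∈ X, ζ x ∈ A ∧ ζ x ∉ U) ∧ ∀ x ∈ X, ∀ y ∈ X, ζ x = ζ y → x = y := by
  obtain ⟨S, hS, hSc⟩ := Finset.exists_subset_card_eq (s := A \ U) (n := X.card)
    (by have := Finset.le_card_sdiff U A; omega)
  let g := Finset.equivOfCardEq hSc.symm
  refine ⟨fun v => if h : v ∈ X then g ⟨v, h⟩ else v, fun x hx => ?_, fun x hx y hy hxy => ?_⟩
  · simp only [hx, dif_pos]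
    exact Finset.mem_sdiff.1 (hS (g ⟨x, hx⟩).2)
  · simp only [hx, hy, dif_pos] at hxy
    simpa using g.injective (Subtype.ext hxy)

theorem SymArray.exists_two_layers {A X : Finset V} {K : Finset C} {E : Fin 2 → Finset (Sym2 V)}
    {ψ : Fin 2 → Sym2 V → C} {β : V → C} {n : ℕ} (hn : 1 ≤ n) (hA : A.card = 2 * n)
    (hK : K.card = 2 * n) (hEd : ∀ i, ∀ e ∈ E i, ¬ e.IsDiag)
    (hEA : ∀ i, ∀ e ∈ E i, ∀ v ∈ e, v ∈ A) (hXA : X ⊆ A) (hψ : ∀ i, ItemProper id (E i) (ψ i))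
    (hψK : ∀ i, ∀ e ∈ E i, ψ i e ∈ K) (hβK : ∀ x ∈ X, β x ∈ K)
    (hψβ : ∀ i, ∀ e ∈ E i, ∀ x ∈ X, x ∈ e → ψ i e ≠ β x)
    (hcard : (E 0).card + (E 1).card + X.card ≤ n) :
    ∃ L : Fin 2 → V → V → C, (∀ i, SymArray A K (L i)) ∧
      (∀ i u v, s(u, v) ∈ E i → L i u v = ψ i s(u, v)) ∧ (∀ x ∈ X, L 0 x x = β x) ∧
      ∀ u ∈ A, L 0 u u = L 1 u u := by
  let T := fun i => (E i).biUnion Sym2.toFinset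
  obtain ⟨ζ, hζ, hζi⟩ := exists_injOn_avoiding (A := A) (X := X) (U := T 0 ∪ T 1 ∪ X) (by
    have h0 := card_biUnion_toFinset_le (E 0)
    have h1 := card_biUnion_toFinset_le (E 1)
    have h2 := Finset.card_union_le (T 0 ∪ T 1) X
    have h3 := Finset.card_union_le (T 0) (T 1)
    simp only [T] at *
    omega)
  have hζX : ∀ x ∈ X, ζ x ∉ X := fun x hx h => (hζ x hx).2 (Finset.mem_union_right _ h)
  have hζE : ∀ i, ∀ x ∈ X, ∀ e ∈ E i, ζ x ∉ e := by
    intro i x hx e he h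
    have hT : ζ x ∈ T i := Finset.mem_biUnion.2 ⟨e, he, Sym2.mem_toFinset.2 h⟩
    refine (hζ x hx).2 (Finset.mem_union_left _ (Finset.mem_union.2 ?_))
    fin_cases i
    exacts [Or.inl hT, Or.inr hT]
  have key : ∀ i, ∀ D : Finset C, D.card ≤ 1 → D ⊆ K → (∀ e ∈ E i, ψ i e ∉ D) →
      (∀ x ∈ X, β x ∉ D) → (E i).card + X.card + D.card ≤ n →
      ∃ L : V → V → C, SymArray A K L ∧ (∀ u v, s(u, v) ∈ E i → L u v = ψ i s(u, v)) ∧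
        (∀ x ∈ X, L x x = β x ∧ L (ζ x) (ζ x) = β x) ∧
        ∀ d ∈ D, ∀ u ∈ A, u ∉ X → u ∉ X.image ζ → L u u = d := fun i D hD hDK h1 h2 h3 =>
    SymArray.exists_prescribed_diag hA hK (hEd i) (hEA i) hXA (hψ i) (hψK i) hβK (hψβ i)
      (fun x hx => (hζ x hx).1) hζX (hζE i) hζi hD hDK h1 h2 h3
  have one : ∀ i, (∀ j, j ≠ i → E j = ∅) → ∃ L : Fin 2 → V → V → C, (∀ i, SymArray A K (L i)) ∧
      (∀ i u v, s(u, v) ∈ E i → L i u v = ψ i s(u, v)) ∧ (∀ x ∈ X, L 0 x x = β x) ∧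
      ∀ u ∈ A, L 0 u u = L 1 u u := by
    intro i hi
    obtain ⟨L, hL, hLE, hLX, -⟩ := key i ∅ (by simp) (by simp) (by simp) (by simp) (by
      fin_cases i <;> simp <;> omega)
    refine ⟨fun _ => L, fun _ => hL, fun j u v huv => ?_, fun x hx => (hLX x hx).1, fun _ _ => rfl⟩
    by_cases hji : j = i
    · subst hji
      exact hLE u v huv
    · simp [hi j hji] at huv
  by_cases h0 : E 0 = ∅
  · exact one 1 fun j hj => by rwa [show j = 0 by omega]
  by_cases h1 : E 1 = ∅
  · exact one 0 fun j hj => by rwa [show j = 1 by omega]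
  have h0 := Finset.card_pos.2 (Finset.nonempty_iff_ne_empty.2 h0)
  have h1 := Finset.card_pos.2 (Finset.nonempty_iff_ne_empty.2 h1)
  obtain ⟨d, hd, hdU⟩ := Finset.exists_mem_notMem_of_card_lt_card
    (s := (E 0).image (ψ 0) ∪ (E 1).image (ψ 1) ∪ X.image β) (t := K) (by
      have h2 := Finset.card_union_le ((E 0).image (ψ 0) ∪ (E 1).image (ψ 1)) (X.image β)
      have h3 := Finset.card_union_le ((E 0).image (ψ 0)) ((E 1).image (ψ 1))
      have h4 := Finset.card_image_le (s := E 0) (f := ψ 0)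
      have h5 := Finset.card_image_le (s := E 1) (f := ψ 1)
      have h6 := Finset.card_image_le (s := X) (f := β)
      omega)
  simp only [Finset.mem_union, not_or] at hdU
  have hdψ : ∀ i, ∀ e ∈ E i, ψ i e ∉ ({d} : Finset C) := by
    intro i e he h
    rw [Finset.mem_singleton] at h
    have hm : d ∈ (E i).image (ψ i) := h ▸ Finset.mem_image_of_mem _ he
    fin_cases i
    exacts [hdU.1.1 hm, hdU.1.2 hm]
  have hle : ∀ i, (E i).card + X.card + ({d} : Finset C).card ≤ n := by
    intro i
    rw [Finset.card_singleton]
    fin_cases i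
    · show (E 0).card + X.card + 1 ≤ n
      omega
    · show (E 1).card + X.card + 1 ≤ n
      omega
  have hdβ : ∀ x ∈ X, β x ∉ ({d} : Finset C) := fun x hx h =>
    hdU.2 (Finset.mem_singleton.1 h ▸ Finset.mem_image_of_mem _ hx)
  choose L hL hLE hLX hLd using fun i =>
    key i {d} (by simp) (Finset.singleton_subset_iff.2 hd) (hdψ i) hdβ (hle i)
  refine ⟨L, hL, hLE, fun x hx => (hLX 0 x hx).1, fun u hu => ?_⟩
  by_cases h2 : u ∈ X
  · rw [(hLX 0 u h2).1, (hLX 1 u h2).1]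
  by_cases h3 : u ∈ X.image ζ
  · obtain ⟨x, hx, rfl⟩ := Finset.mem_image.1 h3
    rw [(hLX 0 x hx).2, (hLX 1 x hx).2]
  · rw [hLd 0 d (Finset.mem_singleton_self d) u hu h2 h3,
      hLd 1 d (Finset.mem_singleton_self d) u hu h2 h3]

end Layers

section Prism

variable {V : Type*}

theorem mem_map_layer {i : Fin 2} {e : Sym2 V} {p : V × Fin 2} (h : p ∈ e.map (·, i)) :
    p.2 = i := by
  obtain ⟨x, -, rfl⟩ := Sym2.mem_map.1 h
  rfl

theorem map_layer_mem_edgeSet {i : Fin 2} {e : Sym2 V} :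
    e.map (·, i) ∈ ((⊤ : SimpleGraph V).boxProd (⊤ : SimpleGraph (Fin 2))).edgeSet ↔
      ¬ e.IsDiag := by
  induction e with | _ u v
  simp [boxProd_adj]

theorem map_layer_ne_rung {i : Fin 2} {e : Sym2 V} {x : V} :
    e.map (·, i) ≠ s((x, 0), (x, 1)) := by
  intro h
  have h0 : (0 : Fin 2) = i := mem_map_layer (h ▸ Sym2.mem_mk_left (x, (0 : Fin 2)) (x, 1))
  have h1 : (1 : Fin 2) = i := mem_map_layer (h ▸ Sym2.mem_mk_right (x, (0 : Fin 2)) (x, 1))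
  exact absurd (h0.trans h1.symm) (by decide)

theorem rung_injective : Function.Injective fun x : V => s((x, (0 : Fin 2)), (x, (1 : Fin 2))) := by
  intro x y h
  simpa using h

theorem map_layer_injective (i : Fin 2) :
    Function.Injective fun e : Sym2 V => e.map (·, i) :=
  Sym2.map.injective fun _ _ h => congrArg Prod.fst h

theorem card_layers_le_ncard [Fintype V] [DecidableEq V] {S : Set (Sym2 (V × Fin 2))}
    {E : Fin 2 → Finset (Sym2 V)} {X : Finset V} (hE : ∀ i, ∀ e ∈ E i, e.map (·, i) ∈ S)
    (hX : ∀ x ∈ X, s((x, 0), (x, 1)) ∈ S) :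
    (E 0).card + (E 1).card + X.card ≤ S.ncard := by
  rw [← Finset.card_image_of_injective (E 0) (map_layer_injective 0),
    ← Finset.card_image_of_injective (E 1) (map_layer_injective 1),
    ← Finset.card_image_of_injective X rung_injective, ← Finset.card_union_of_disjoint,
    ← Finset.card_union_of_disjoint, ← Set.ncard_coe_finset]
  · refine Set.ncard_le_ncard (fun e he => ?_) (Set.toFinite S)
    simp only [Finset.coe_union, Finset.coe_image, Set.mem_union, Set.mem_image,
      Finset.mem_coe] at he
    rcases he with (⟨e, he, rfl⟩ | ⟨e, he, rfl⟩) | ⟨x, hx, rfl⟩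
    exacts [hE 0 e he, hE 1 e he, hX x hx]
  · refine Finset.disjoint_left.2 fun e he he' => ?_
    obtain ⟨x, -, rfl⟩ := Finset.mem_image.1 he'
    rcases Finset.mem_union.1 he with he | he <;> obtain ⟨e, -, h⟩ := Finset.mem_image.1 he
    exacts [map_layer_ne_rung h, map_layer_ne_rung h]
  · refine Finset.disjoint_left.2 fun e he he' => ?_
    obtain ⟨f, -, rfl⟩ := Finset.mem_image.1 he
    obtain ⟨g, -, h⟩ := Finset.mem_image.1 he'
    induction f with | _ u v
    have hu : (u, (0 : Fin 2)) ∈ g.map (·, (1 : Fin 2)) := by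
      rw [h]
      exact Sym2.mem_mk_left _ _
    exact absurd (show (0 : Fin 2) = 1 from mem_map_layer hu) (by decide)

theorem exists_prism_coloring [Fintype V] [DecidableEq V] {K : Finset ℕ}
    {L : Fin 2 → V → V → ℕ} (hL : ∀ i, SymArray Finset.univ K (L i))
    (hd : ∀ u, L 0 u u = L 1 u u) :
    ∃ C : Sym2 (V × Fin 2) → ℕ,
      IsProperEdgeColoring ((⊤ : SimpleGraph V).boxProd (⊤ : SimpleGraph (Fin 2))) C ∧
      ∀ p q, ((⊤ : SimpleGraph V).boxProd (⊤ : SimpleGraph (Fin 2))).Adj p q →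
        C s(p, q) = L p.2 p.1 q.1 := by
  have hd' : ∀ i j u, L i u u = L j u u := by
    intro i j u
    fin_cases i <;> fin_cases j
    exacts [rfl, hd u, (hd u).symm, rfl]
  let c : V × Fin 2 → V × Fin 2 → ℕ := fun p q =>
    if p.2 = q.2 then L p.2 p.1 q.1 else if p.1 = q.1 then L p.2 p.1 p.1 else 0
  have hc : ∀ p q, c p q = c q p := by
    rintro ⟨u, i⟩ ⟨v, j⟩
    by_cases hij : i = j
    · subst hij
      simpa [c] using (hL i).symm u (Finset.mem_univ u) v (Finset.mem_univ v)
    · by_cases huv : u = v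
      · subst huv
        simpa [c, hij, Ne.symm hij] using hd' i j u
      · simp [c, hij, Ne.symm hij, huv, Ne.symm huv]
  have hadj : ∀ p q, ((⊤ : SimpleGraph V).boxProd (⊤ : SimpleGraph (Fin 2))).Adj p q →
      c p q = L p.2 p.1 q.1 := by
    rintro ⟨u, i⟩ ⟨v, j⟩ h
    rcases (boxProd_adj).1 h with ⟨-, h⟩ | ⟨h, h'⟩
    · exact if_pos h
    · obtain rfl : u = v := h'
      exact (if_neg h.ne).trans (if_pos rfl)
  refine ⟨Sym2.lift ⟨c, hc⟩, ?_, hadj⟩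
  rintro e f ⟨he, hf, hne, p, hpe, hpf⟩
  obtain ⟨q, rfl⟩ := hpe
  obtain ⟨r, rfl⟩ := hpf
  rw [mem_edgeSet] at he hf
  intro h
  simp only [Sym2.lift_mk] at h
  rw [hadj p q he, hadj p r hf] at h
  have hqr := (hL p.2).inj p.1 (Finset.mem_univ _) q.1 (Finset.mem_univ _) r.1
    (Finset.mem_univ _) h
  refine hne (congrArg (fun t => s(p, t)) (Prod.ext hqr ?_))
  rcases boxProd_adj.1 he with ⟨h1, h2⟩ | ⟨h1, h2⟩ <;>
    rcases boxProd_adj.1 hf with ⟨h3, h4⟩ | ⟨h3, h4⟩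
  · exact h2.symm.trans h4
  · exact absurd (h4.trans hqr.symm) h1.ne
  · exact absurd (h2.trans hqr) h3.ne
  · have := h1.ne
    have := h3.ne
    omega

end Prism

theorem stmt12 (n : ℕ) (hn : 2 ≤ n) (φ : Sym2 (Fin (2*n) × Fin 2) → Option ℕ)
    (hφ : IsPartialProperEdgeColoring
      ((⊤ : SimpleGraph (Fin (2*n))).boxProd (⊤ : SimpleGraph (Fin 2))) φ)
    (hc : UsesColors φ (2*n)) (hcard : (Precolored φ).ncard ≤ n) :
    Extendable ((⊤ : SimpleGraph (Fin (2*n))).boxProd (⊤ : SimpleGraph (Fin 2)))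
      φ (2*n) := by
  have hval : ∀ e, φ e ≠ none → φ e = some ((φ e).getD 0) := fun e he => by
    obtain ⟨a, ha⟩ := Option.ne_none_iff_exists'.1 he
    simp [ha]
  have hlt : ∀ e, φ e ≠ none → (φ e).getD 0 ∈ Finset.range (2 * n) := fun e he =>
    Finset.mem_range.2 (hc e _ (hval e he))
  have hne : ∀ e f v, φ e ≠ none → φ f ≠ none → e ≠ f → v ∈ e → v ∈ f →
      (φ e).getD 0 ≠ (φ f).getD 0 := by
    intro e f v he hf hef hve hvf h
    refine hφ.2 ⟨hφ.1 e he, hφ.1 f hf, hef, v, hve, hvf⟩ he ?_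
    rw [hval e he, hval f hf, h]
  let E : Fin 2 → Finset (Sym2 (Fin (2 * n))) := fun i => {e | φ (e.map (·, i)) ≠ none}
  let X : Finset (Fin (2 * n)) := {x | φ s((x, 0), (x, 1)) ≠ none}
  have hE : ∀ i e, e ∈ E i ↔ φ (e.map (·, i)) ≠ none := by simp [E]
  have hX : ∀ x, x ∈ X ↔ φ s((x, 0), (x, 1)) ≠ none := by simp [X]
  have hEd : ∀ i, ∀ e ∈ E i, ¬ e.IsDiag := fun i e he =>
    map_layer_mem_edgeSet.1 (hφ.1 _ ((hE i e).1 he))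
  have hmap : ∀ (i : Fin 2) (v : Fin (2 * n)) (e : Sym2 (Fin (2 * n))), v ∈ e → (v, i) ∈ e.map (·, i) := fun i v e hv =>
    Sym2.mem_map.2 ⟨v, hv, rfl⟩
  obtain ⟨L, hL, hLE, hLX, hLd⟩ := SymArray.exists_two_layers (A := Finset.univ) (X := X)
    (K := Finset.range (2 * n)) (E := E) (ψ := fun i e => (φ (e.map (·, i))).getD 0)
    (β := fun x => (φ s((x, 0), (x, 1))).getD 0) (n := n) (by omega) (by simp) (by simp) hEd
    (by simp) (by simp)
    (fun i e he f hf hef h v hve hvf => hne _ _ (v, i) ((hE i e).1 he) ((hE i f).1 hf)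
      (fun h' => hef (map_layer_injective i h')) (hmap i v e hve) (hmap i v f hvf) h)
    (fun i e he => hlt _ ((hE i e).1 he)) (fun x hx => hlt _ ((hX x).1 hx))
    (fun i e he x hx hxe => hne _ _ (x, i) ((hE i e).1 he) ((hX x).1 hx) map_layer_ne_rung
      (hmap i x e hxe) (by fin_cases i <;> simp))
    ((card_layers_le_ncard (fun i e he => (hE i e).1 he) (fun x hx => (hX x).1 hx)).trans hcard)
  obtain ⟨C, hC, hCL⟩ := exists_prism_coloring hL fun u => hLd u (Finset.mem_univ u)
  refine ⟨C, hC, fun e he => ?_, fun e a hea => ?_⟩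
  · induction e with | _ p q
    rw [hCL p q he]
    exact Finset.mem_range.1 ((hL p.2).mem _ (Finset.mem_univ _) _ (Finset.mem_univ _))
  · have hen : φ e ≠ none := by simp [hea]
    have he := hφ.1 e hen
    induction e with | _ p q
    obtain ⟨u, i⟩ := p
    obtain ⟨v, j⟩ := q
    rw [hCL _ _ he]
    rcases boxProd_adj.1 he with ⟨-, h⟩ | ⟨h, h'⟩
    · obtain rfl : i = j := h
      refine (hLE i u v ((hE i _).2 hen)).trans ?_
      simp [hea]
    · obtain rfl : u = v := h'
      have hs : s((u, i), (u, j)) = s((u, (0 : Fin 2)), (u, 1)) := by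
        have hij : i ≠ j := h.ne
        obtain ⟨rfl, rfl⟩ | ⟨rfl, rfl⟩ : i = 0 ∧ j = 1 ∨ i = 1 ∧ j = 0 := by omega
        exacts [rfl, Sym2.eq_swap]
      have hLi : L i u u = L 0 u u := by
        fin_cases i
        exacts [rfl, (hLd u (Finset.mem_univ u)).symm]
      rw [hs] at hea hen
      refine hLi.trans ((hLX u ((hX u).2 hen)).trans ?_)
      simp [hea]
end

section
/- If G is a regular graph in which every partial proper edge coloring of at most k < Δ(G)/2 independent edges extends to a proper χ'(G)-edge coloring of G, then every partial proper edge coloring of at most k+1 independent edges of G □ K_2 extends to a proper (χ'(G)+1)-edge coloring of G □ K_2. -/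
open SimpleGraph

variable {V : Type*}

/-- The copy of an edge of `G` in the `i`-th layer of `G □ K₂`. -/
def layerEdge (i : Fin 2) (e : Sym2 V) : Sym2 (V × Fin 2) := e.map fun v => (v, i)

/-- The edge of `G □ K₂` joining the two copies of `u`. -/
def rung (u : V) : Sym2 (V × Fin 2) := s((u, 0), (u, 1))

lemma mem_layerEdge {i : Fin 2} {e : Sym2 V} {p : V × Fin 2} :
    p ∈ layerEdge i e ↔ p.1 ∈ e ∧ p.2 = i := by
  obtain ⟨v, j⟩ := p
  simp only [layerEdge, Sym2.mem_map, Prod.mk.injEq]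
  constructor
  · rintro ⟨a, ha, rfl, rfl⟩
    exact ⟨ha, rfl⟩
  · rintro ⟨h, rfl⟩
    exact ⟨v, h, rfl, rfl⟩

lemma mem_rung {u : V} {p : V × Fin 2} : p ∈ rung u ↔ p.1 = u := by
  obtain ⟨v, j⟩ := p
  fin_cases j <;> simp [rung]

lemma rung_injective_s15 : Function.Injective (rung : V → Sym2 (V × Fin 2)) := by
  intro u w h
  have : ((u, 0) : V × Fin 2) ∈ rung w := h ▸ mem_rung.2 rfl
  exact mem_rung.1 this

lemma map_fst_layerEdge (i : Fin 2) (e : Sym2 V) : (layerEdge i e).map Prod.fst = e := by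
  induction e with
  | h x y => rfl

lemma rung_ne_layerEdge (u : V) (i : Fin 2) (e : Sym2 V) : rung u ≠ layerEdge i e := by
  intro h
  have h0 : ((u, 0) : V × Fin 2) ∈ layerEdge i e := h ▸ mem_rung.2 rfl
  have h1 : ((u, 1) : V × Fin 2) ∈ layerEdge i e := h ▸ mem_rung.2 rfl
  have e0 := (mem_layerEdge.1 h0).2
  have e1 := (mem_layerEdge.1 h1).2
  simp only at e0 e1
  omega

lemma layerEdge_inj {i j : Fin 2} {e f : Sym2 V} (h : layerEdge i e = layerEdge j f) :
    i = j ∧ e = f := by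
  have hef : e = f := by rw [← map_fst_layerEdge i e, h, map_fst_layerEdge]
  refine ⟨?_, hef⟩
  induction e with
  | h x y =>
    have : (x, i) ∈ layerEdge j f := h ▸ mem_layerEdge.2 ⟨Sym2.mem_mk_left x y, rfl⟩
    exact (mem_layerEdge.1 this).2

lemma mem_edgeSet_boxProd_top {G : SimpleGraph V} {x : Sym2 (V × Fin 2)} :
    x ∈ (G.boxProd (⊤ : SimpleGraph (Fin 2))).edgeSet ↔
      (∃ u, x = rung u) ∨ ∃ i, ∃ e ∈ G.edgeSet, x = layerEdge i e := by
  constructor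
  · induction x with
    | h p q =>
      obtain ⟨u, i⟩ := p
      obtain ⟨v, j⟩ := q
      simp only [SimpleGraph.mem_edgeSet, SimpleGraph.boxProd_adj, SimpleGraph.top_adj]
      rintro (⟨h, rfl⟩ | ⟨h, rfl⟩)
      · exact Or.inr ⟨i, s(u, v), h, rfl⟩
      · left
        refine ⟨u, ?_⟩
        fin_cases i <;> fin_cases j <;> simp_all [rung]
  · rintro (⟨u, rfl⟩ | ⟨i, e, he, rfl⟩)
    · simp [rung]
    · induction e with
      | h a b => simpa [layerEdge] using he

/-- Prescribing distinct, pairwise disjoint edges `g x`, `x ∈ K`, with the colors `col x`, none of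
which is `c`: the extension property with `t` colors gives a coloring from `{0, …, t} \ {c}`. -/
lemma exists_coloring_avoiding {W : Type*} {G : SimpleGraph V} {k t : ℕ}
    (hext : ∀ φ : Sym2 V → Option ℕ, IsPartialProperEdgeColoring G φ →
      UsesColors φ t → IndependentEdges (Precolored φ) →
      (Precolored φ).ncard ≤ k → Extendable G φ t)
    (K : Set W) (hK : K.Finite) (hKk : K.ncard ≤ k) (g : W → Sym2 V) (col : W → ℕ) (c : ℕ)
    (hc : c < t + 1) (hg : ∀ x ∈ K, g x ∈ G.edgeSet)
    (hdisj : ∀ x ∈ K, ∀ y ∈ K, x ≠ y → ∀ v, v ∈ g x → v ∉ g y)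
    (hcol : ∀ x ∈ K, col x < t + 1 ∧ col x ≠ c) :
    ∃ C, IsProperEdgeColoring G C ∧ (∀ e ∈ G.edgeSet, C e < t + 1 ∧ C e ≠ c) ∧
      ∀ x ∈ K, C (g x) = col x := by
  classical
  let φ : Sym2 V → Option ℕ := fun e =>
    if h : ∃ x ∈ K, g x = e then some (Equiv.swap c t (col h.choose)) else none
  have hpre : ∀ e, φ e ≠ none → ∃ x ∈ K, g x = e := by
    intro e he
    by_contra h
    exact he (dif_neg h)
  have hφ : ∀ x ∈ K, φ (g x) = some (Equiv.swap c t (col x)) := by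
    intro x hx
    have h : ∃ y ∈ K, g y = g x := ⟨x, hx, rfl⟩
    have hch : h.choose = x := by
      by_contra hne
      have h1 := h.choose_spec
      have hv := (g x).out_fst_mem
      exact hdisj _ h1.1 x hx hne _ (by rwa [h1.2]) hv
    simp only [φ, dif_pos h, hch]
  have hind : IndependentEdges (Precolored φ) := by
    intro e he f hf hef v
    obtain ⟨x, hx, rfl⟩ := hpre e he
    obtain ⟨y, hy, rfl⟩ := hpre f hf
    exact hdisj x hx y hy (fun h => hef (h ▸ rfl)) v
  obtain ⟨C, hC, hCt, hCφ⟩ := hext φ ⟨fun e he => by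
      obtain ⟨x, hx, rfl⟩ := hpre e he
      exact hg x hx, fun e f hef he h => by
        obtain ⟨-, -, hne, v, hve, hvf⟩ := hef
        exact hind e he f (show φ f ≠ none from h ▸ he) hne v hve hvf⟩
    (fun e a hea => by
      obtain ⟨x, hx, rfl⟩ := hpre e (by simp [hea])
      obtain ⟨h1, h2⟩ := hcol x hx
      rw [hφ x hx, Option.some_inj] at hea
      subst hea
      rw [Equiv.swap_apply_def]
      split_ifs <;> omega)
    hind
    ((Set.ncard_le_ncard (fun e he => hpre e he) (hK.image g)).trans
      ((Set.ncard_image_le hK).trans hKk))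
  refine ⟨fun e => Equiv.swap c t (C e), fun e f hef h => hC hef ((Equiv.swap c t).injective h),
    fun e he => ?_, fun x hx => ?_⟩
  · have := hCt e he
    simp only [Equiv.swap_apply_def]
    split_ifs <;> omega
  · simp [hCφ _ _ (hφ x hx)]

/-- Two colorings of the layers avoiding `c`, with color `c` on all rungs, can be modified by
swapping colors on the 4-cycles over a matching `S` on which the two colorings agree. -/
lemma exists_swapped_coloring {G : SimpleGraph V} {t c : ℕ} (hc : c < t)
    (C : Fin 2 → Sym2 V → ℕ) (hC : ∀ i, IsProperEdgeColoring G (C i))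
    (hCt : ∀ i, ∀ e ∈ G.edgeSet, C i e < t ∧ C i e ≠ c) (S : Set (Sym2 V))
    (hSG : S ⊆ G.edgeSet) (hS : IndependentEdges S) (hCS : ∀ i, ∀ e ∈ S, C i e = C 0 e) :
    ∃ D, IsProperEdgeColoring (G.boxProd (⊤ : SimpleGraph (Fin 2))) D ∧
      ColorsBelow (G.boxProd (⊤ : SimpleGraph (Fin 2))) D t ∧
      (∀ i, ∀ e ∈ S, D (layerEdge i e) = c) ∧
      (∀ i, ∀ e ∉ S, D (layerEdge i e) = C i e) ∧
      (∀ e ∈ S, ∀ u ∈ e, D (rung u) = C 0 e) ∧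
      (∀ u, (∀ e ∈ S, u ∉ e) → D (rung u) = c) := by
  classical
  let D : Sym2 (V × Fin 2) → ℕ := fun x =>
    if h : ∃ u, x = rung u then
      if h' : ∃ e ∈ S, h.choose ∈ e then C 0 h'.choose else c
    else if h : ∃ p : Fin 2 × Sym2 V, x = layerEdge p.1 p.2 then
      if h.choose.2 ∈ S then c else C h.choose.1 h.choose.2
    else 0
  have hlayer : ∀ i e, D (layerEdge i e) = if e ∈ S then c else C i e := by
    intro i e
    have h1 : ¬ ∃ u, layerEdge i e = rung u := fun ⟨u, h⟩ => rung_ne_layerEdge u i e h.symm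
    have h2 : ∃ p : Fin 2 × Sym2 V, layerEdge i e = layerEdge p.1 p.2 := ⟨(i, e), rfl⟩
    obtain ⟨e1, e2⟩ := layerEdge_inj h2.choose_spec
    simp only [D, dif_neg h1, dif_pos h2, ← e1, ← e2]
  have hrung : ∀ u, D (rung u) = if h' : ∃ e ∈ S, u ∈ e then C 0 h'.choose else c := by
    intro u
    have h1 : ∃ w, rung u = rung w := ⟨u, rfl⟩
    have h2 : h1.choose = u := (rung_injective_s15 h1.choose_spec).symm
    simp only [D, dif_pos h1]
    rw [h2]
  have hin : ∀ i, ∀ e ∈ S, D (layerEdge i e) = c := fun i e he => by rw [hlayer, if_pos he]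
  have hout : ∀ i, ∀ e ∉ S, D (layerEdge i e) = C i e := fun i e he => by rw [hlayer, if_neg he]
  have hrin : ∀ e ∈ S, ∀ u ∈ e, D (rung u) = C 0 e := by
    intro e he u hu
    have h : ∃ e ∈ S, u ∈ e := ⟨e, he, hu⟩
    have hch : h.choose = e := by
      by_contra hne
      exact hS _ h.choose_spec.1 e he hne u h.choose_spec.2 hu
    rw [hrung, dif_pos h, hch]
  have hrout : ∀ u, (∀ e ∈ S, u ∉ e) → D (rung u) = c := by
    intro u hu
    rw [hrung, dif_neg]
    rintro ⟨e, he, h⟩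
    exact hu e he h
  have hmix : ∀ i, ∀ e ∈ G.edgeSet, ∀ u ∈ e, D (layerEdge i e) ≠ D (rung u) := by
    intro i e he u hu
    by_cases hes : e ∈ S
    · rw [hin i e hes, hrin e hes u hu]
      exact (hCt 0 e he).2.symm
    · rw [hout i e hes]
      by_cases h : ∃ e' ∈ S, u ∈ e'
      · obtain ⟨e', he', hu'⟩ := h
        rw [hrin e' he' u hu', ← hCS i e' he']
        exact hC i ⟨he, hSG he', fun h => hes (h ▸ he'), u, hu, hu'⟩
      · push Not at h
        rw [hrout u h]
        exact (hCt i e he).2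
  refine ⟨D, ?_, ?_, hin, hout, hrin, hrout⟩
  · rintro x y ⟨hx, hy, hne, ⟨v, j⟩, hvx, hvy⟩
    rcases mem_edgeSet_boxProd_top.1 hx with ⟨u, rfl⟩ | ⟨i, e, he, rfl⟩ <;>
      rcases mem_edgeSet_boxProd_top.1 hy with ⟨u', rfl⟩ | ⟨i', e', he', rfl⟩
    · exact absurd (congrArg rung ((mem_rung.1 hvx).symm.trans (mem_rung.1 hvy))) hne
    · obtain rfl : v = u := mem_rung.1 hvx
      exact (hmix i' e' he' v (mem_layerEdge.1 hvy).1).symm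
    · obtain rfl : v = u' := mem_rung.1 hvy
      exact hmix i e he v (mem_layerEdge.1 hvx).1
    · obtain ⟨hve, rfl⟩ : v ∈ e ∧ j = i := mem_layerEdge.1 hvx
      obtain ⟨hve', rfl⟩ : v ∈ e' ∧ j = i' := mem_layerEdge.1 hvy
      have hee : e ≠ e' := fun h => hne (h ▸ rfl)
      by_cases h1 : e ∈ S <;> by_cases h2 : e' ∈ S
      · exact absurd hve' (hS e h1 e' h2 hee v hve)
      · rw [hin _ _ h1, hout _ _ h2]
        exact (hCt _ _ he').2.symm
      · rw [hout _ _ h1, hin _ _ h2]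
        exact (hCt _ _ he).2
      · rw [hout _ _ h1, hout _ _ h2]
        exact hC j ⟨he, he', hee, v, hve, hve'⟩
  · intro x hx
    rcases mem_edgeSet_boxProd_top.1 hx with ⟨u, rfl⟩ | ⟨i, e, he, rfl⟩
    · by_cases h : ∃ e' ∈ S, u ∈ e'
      · obtain ⟨e', he', hu'⟩ := h
        rw [hrin e' he' u hu']
        exact (hCt 0 e' (hSG he')).1
      · push Not at h
        rwa [hrout u h]
    · by_cases h : e ∈ S
      · rwa [hin i e h]
      · rw [hout i e h]
        exact (hCt i e he).1

lemma exists_injOn_choice {α β : Type*} [Inhabited β] [DecidableEq β] (s : Finset α)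
    (N : α → Finset β) (hN : ∀ a ∈ s, s.card ≤ (N a).card) :
    ∃ f : α → β, (∀ a ∈ s, f a ∈ N a) ∧ Set.InjOn f s := by
  classical
  induction s using Finset.induction_on with
  | empty => exact ⟨fun _ => default, by simp, by simp⟩
  | insert a s ha ih =>
    rw [Finset.card_insert_of_notMem ha] at hN
    obtain ⟨f, hf, hinj⟩ := ih fun b hb =>
      (Nat.le_succ _).trans (hN b (Finset.mem_insert_of_mem hb))
    obtain ⟨y, hy, hys⟩ : ∃ y ∈ N a, y ∉ s.image f := by
      apply Finset.exists_mem_notMem_of_card_lt_card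
      have h1 := hN a (Finset.mem_insert_self a s)
      have h2 := Finset.card_image_le (s := s) (f := f)
      omega
    have hfs : ∀ b ∈ s, Function.update f a y b = f b := fun b hb =>
      Function.update_of_ne (ne_of_mem_of_not_mem hb ha) _ _
    refine ⟨Function.update f a y, ?_, ?_⟩
    · intro b hb
      rcases Finset.mem_insert.1 hb with rfl | hb
      · simpa using hy
      · rw [hfs b hb]
        exact hf b hb
    · rw [Finset.coe_insert, Set.injOn_insert (by simpa using ha)]
      refine ⟨hinj.congr fun b hb => (hfs b hb).symm, ?_⟩
      rintro ⟨b, hb, h⟩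
      rw [hfs b hb, Function.update_self] at h
      exact hys (Finset.mem_image.2 ⟨b, hb, h⟩)

/-- Every precolored rung at `u` can be assigned a neighbour of `u`, so that the neighbours are
distinct and lie below no precolored edge. -/
lemma exists_fresh_neighbors [Fintype V] {G : SimpleGraph V} [DecidableRel G.Adj] {d k : ℕ}
    (hreg : G.IsRegularOfDegree d) (hk : 2 * k < d) (P : Set (Sym2 (V × Fin 2)))
    (hP : P.ncard ≤ k + 1) :
    ∃ f : V → V, (∀ u, rung u ∈ P → G.Adj u (f u)) ∧
      (∀ u, rung u ∈ P → ∀ x ∈ P, ∀ i, (f u, i) ∉ x) ∧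
      ∀ u w, rung u ∈ P → rung w ∈ P → f u = f w → u = w := by
  classical
  cases isEmpty_or_nonempty V
  · exact ⟨id, fun u => isEmptyElim u, fun u => isEmptyElim u, fun u => isEmptyElim u⟩
  inhabit V
  let F : Finset (Sym2 (V × Fin 2)) := P.toFinset
  have hF : F.card ≤ k + 1 := by rwa [← Set.ncard_eq_toFinset_card']
  let E : Fin 2 → Finset V := fun i => {v | ∃ x ∈ P, (v, i) ∈ x}
  let U : Finset V := {u | rung u ∈ P}
  have hUE : U ⊆ E 0 ∩ E 1 := by
    intro u hu
    have hu' : rung u ∈ P := by simpa [U] using hu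
    simp only [E, Finset.mem_inter, Finset.mem_filter, Finset.mem_univ, true_and]
    exact ⟨⟨_, hu', mem_rung.2 rfl⟩, ⟨_, hu', mem_rung.2 rfl⟩⟩
  have hE : (E 0).card + (E 1).card ≤ 2 * F.card := by
    have h1 : (E 0).disjSum (E 1) ⊆
        (F.biUnion Sym2.toFinset).image fun p => if p.2 = 0 then Sum.inl p.1 else Sum.inr p.1 := by
      intro z hz
      simp only [Finset.mem_image, Finset.mem_biUnion, Sym2.mem_toFinset]
      rcases Finset.mem_disjSum.1 hz with ⟨v, hv, rfl⟩ | ⟨v, hv, rfl⟩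
      · obtain ⟨x, hx, hvx⟩ : ∃ x ∈ P, (v, 0) ∈ x := by simpa [E] using hv
        exact ⟨(v, 0), ⟨x, by simpa [F] using hx, hvx⟩, by simp⟩
      · obtain ⟨x, hx, hvx⟩ : ∃ x ∈ P, (v, 1) ∈ x := by simpa [E] using hv
        exact ⟨(v, 1), ⟨x, by simpa [F] using hx, hvx⟩, by simp⟩
    have h2 := (Finset.card_le_card h1).trans Finset.card_image_le
    rw [Finset.card_disjSum] at h2
    refine h2.trans ?_
    rw [mul_comm]
    refine Finset.card_biUnion_le_card_mul _ _ _ fun x _ => ?_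
    rw [Sym2.card_toFinset]
    split_ifs <;> omega
  have hT := Finset.card_union_add_card_inter (E 0) (E 1)
  have hU := Finset.card_le_card hUE
  obtain ⟨f, hf, hinj⟩ := exists_injOn_choice U (fun u => G.neighborFinset u \ (E 0 ∪ E 1)) (by
    intro u hu
    have huT : u ∈ E 0 ∪ E 1 := Finset.mem_union_left _ (Finset.mem_inter.1 (hUE hu)).1
    have h1 : G.neighborFinset u \ ((E 0 ∪ E 1).erase u) ⊆
        G.neighborFinset u \ (E 0 ∪ E 1) := by
      intro v hv
      rw [Finset.mem_sdiff] at hv ⊢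
      refine ⟨hv.1, fun h => hv.2 (Finset.mem_erase.2 ⟨?_, h⟩)⟩
      rintro rfl
      simp at hv
    have h2 := Finset.card_le_card h1
    have h3 := Finset.le_card_sdiff ((E 0 ∪ E 1).erase u) (G.neighborFinset u)
    have h4 : (G.neighborFinset u).card = d := hreg u
    have h5 := Finset.card_erase_add_one huT
    omega)
  have hmem : ∀ u, rung u ∈ P → u ∈ U := fun u hu => by simpa [U] using hu
  refine ⟨f, fun u hu => ?_, fun u hu x hx i hi => ?_, fun u w hu hw h =>
    hinj (hmem u hu) (hmem w hw) h⟩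
  · have := hf u (hmem u hu)
    simp only [Finset.mem_sdiff, SimpleGraph.mem_neighborFinset] at this
    exact this.1
  · have := (Finset.mem_sdiff.1 (hf u (hmem u hu))).2
    have hE' : f u ∈ E i := by
      simp only [E, Finset.mem_filter, Finset.mem_univ, true_and]
      exact ⟨x, hx, hi⟩
    apply this
    rw [Finset.mem_union]
    fin_cases i
    · exact Or.inl hE'
    · exact Or.inr hE'

/-- Replace each precolored rung by a fresh edge of `G` at its foot and each precolored layer edge
by the edge of `G` below it. -/
lemma exists_disjoint_projection [Fintype V] {G : SimpleGraph V} [DecidableRel G.Adj] {d k : ℕ}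
    (hreg : G.IsRegularOfDegree d) (hk : 2 * k < d) (P : Set (Sym2 (V × Fin 2)))
    (hPG : P ⊆ (G.boxProd (⊤ : SimpleGraph (Fin 2))).edgeSet) (hI : IndependentEdges P)
    (hP : P.ncard ≤ k + 1) :
    ∃ g : Sym2 (V × Fin 2) → Sym2 V, (∀ x ∈ P, g x ∈ G.edgeSet) ∧
      (∀ i e, g (layerEdge i e) = e) ∧ (∀ u, u ∈ g (rung u)) ∧
      ∀ j, ∀ x ∈ P, ∀ y ∈ P, (∀ i e, x = layerEdge i e → i = j) →
        (∀ i e, y = layerEdge i e → i = j) → x ≠ y → ∀ v, v ∈ g x → v ∉ g y := by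
  classical
  obtain ⟨f, hadj, hfresh, hinj⟩ := exists_fresh_neighbors hreg hk P hP
  let g : Sym2 (V × Fin 2) → Sym2 V := fun x =>
    if h : ∃ u, x = rung u then s(h.choose, f h.choose) else x.map Prod.fst
  have hl : ∀ i e, g (layerEdge i e) = e := by
    intro i e
    have h1 : ¬ ∃ u, layerEdge i e = rung u := fun ⟨u, h⟩ => rung_ne_layerEdge u i e h.symm
    simp only [g, dif_neg h1, map_fst_layerEdge]
  have hr : ∀ u, g (rung u) = s(u, f u) := by
    intro u
    have h1 : ∃ w, rung u = rung w := ⟨u, rfl⟩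
    have h2 : h1.choose = u := (rung_injective_s15 h1.choose_spec).symm
    simp only [g, dif_pos h1, h2]
  have hmix : ∀ u i e, rung u ∈ P → layerEdge i e ∈ P → ∀ v, v ∈ s(u, f u) → v ∉ e := by
    intro u i e hu he v hv hve
    have hmem : (v, i) ∈ layerEdge i e := mem_layerEdge.2 ⟨hve, rfl⟩
    rcases Sym2.mem_iff.1 hv with rfl | rfl
    · exact hI _ hu _ he (rung_ne_layerEdge v i e) (v, i) (mem_rung.2 rfl) hmem
    · exact hfresh u hu _ he i hmem
  refine ⟨g, ?_, hl, fun u => hr u ▸ Sym2.mem_mk_left _ _, ?_⟩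
  · intro x hx
    rcases mem_edgeSet_boxProd_top.1 (hPG hx) with ⟨u, rfl⟩ | ⟨i, e, he, rfl⟩
    · rw [hr]
      exact hadj u hx
    · rwa [hl]
  · intro j x hx y hy hxj hyj hne v hvx hvy
    rcases mem_edgeSet_boxProd_top.1 (hPG hx) with ⟨u, rfl⟩ | ⟨i, e, he, rfl⟩ <;>
      rcases mem_edgeSet_boxProd_top.1 (hPG hy) with ⟨w, rfl⟩ | ⟨i', e', he', rfl⟩
    · have huw : u ≠ w := fun h => hne (h ▸ rfl)
      rw [hr] at hvx hvy
      rcases Sym2.mem_iff.1 hvx with rfl | rfl <;> rcases Sym2.mem_iff.1 hvy with h | h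
      · exact huw h
      · exact hfresh w hy _ hx 0 (mem_rung.2 h.symm)
      · exact hfresh u hx _ hy 0 (mem_rung.2 h)
      · exact huw (hinj u w hx hy h)
    · rw [hr] at hvx
      rw [hl] at hvy
      exact hmix u i' e' hx hy v hvx hvy
    · rw [hr] at hvy
      rw [hl] at hvx
      exact hmix w i e hy hx v hvy hvx
    · obtain rfl := hxj i e rfl
      obtain rfl := hyj i' e' rfl
      rw [hl] at hvx hvy
      exact hI _ hx _ hy hne (v, i') (mem_layerEdge.2 ⟨hvx, rfl⟩) (mem_layerEdge.2 ⟨hvy, rfl⟩)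

/-- The main construction, for a suitable color `c` of the rungs. The coloring of layer `i` is an
extension of what is precolored on layer `j i` and on the rungs. -/
lemma extendable_boxProd_of_color [Fintype V] {G : SimpleGraph V} [DecidableRel G.Adj] {d k t : ℕ}
    (hreg : G.IsRegularOfDegree d) (hk : 2 * k < d)
    (hext : ∀ φ : Sym2 V → Option ℕ, IsPartialProperEdgeColoring G φ →
      UsesColors φ t → IndependentEdges (Precolored φ) →
      (Precolored φ).ncard ≤ k → Extendable G φ t)
    (φ : Sym2 (V × Fin 2) → Option ℕ)
    (hφG : Precolored φ ⊆ (G.boxProd (⊤ : SimpleGraph (Fin 2))).edgeSet)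
    (hφt : UsesColors φ (t + 1)) (hI : IndependentEdges (Precolored φ))
    (hφk : (Precolored φ).ncard ≤ k + 1) (c : ℕ) (hc : c < t + 1) (j : Fin 2 → Fin 2)
    (hj : ∀ i e, φ (layerEdge i e) ≠ none → j i = i)
    (hjc : ∀ i e, φ (layerEdge i e) = some c → ∀ i', j i' = i)
    (hK : ∀ i, {x | φ x ≠ none ∧ φ x ≠ some c ∧
      ∀ i' e, x = layerEdge i' e → i' = j i}.ncard ≤ k) :
    Extendable (G.boxProd (⊤ : SimpleGraph (Fin 2))) φ (t + 1) := by
  obtain ⟨g, hgG, hgl, hgr, hg⟩ := exists_disjoint_projection hreg hk _ hφG hI hφk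
  have hcoe : ∀ x a, φ x = some a → x ∈ Precolored φ := fun x a h => by simp [Precolored, h]
  have hex : ∀ m : Fin 2, ∃ C, m ∈ Set.range j → IsProperEdgeColoring G C ∧
      (∀ e ∈ G.edgeSet, C e < t + 1 ∧ C e ≠ c) ∧
      ∀ x a, φ x = some a → a ≠ c → (∀ i' e, x = layerEdge i' e → i' = m) → C (g x) = a := by
    intro m
    by_cases hm : m ∈ Set.range j
    · obtain ⟨i, rfl⟩ := hm
      obtain ⟨C, h1, h2, h3⟩ := exists_coloring_avoiding hext _ (Set.toFinite _) (hK i) g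
        (fun x => (φ x).getD 0) c hc (fun x hx => hgG x hx.1)
        (fun x hx y hy => hg (j i) x hx.1 y hy.1 hx.2.2 hy.2.2) (by
          rintro x ⟨hx, hxc, -⟩
          obtain ⟨a, ha⟩ := Option.ne_none_iff_exists'.1 hx
          simp only [ha, Option.getD_some]
          exact ⟨hφt x a ha, fun h => hxc (h ▸ ha)⟩)
      refine ⟨C, fun _ => ⟨h1, h2, fun x a hxa hac hx => ?_⟩⟩
      have := h3 x ⟨by simp [hxa], by simpa [hxa] using hac, hx⟩
      simpa [hxa] using this
    · exact ⟨0, fun h => absurd h hm⟩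
  choose C hC using hex
  have hCj := fun i => hC (j i) ⟨i, rfl⟩
  have hrl : ∀ (u : V) (m i : Fin 2) (e : Sym2 V), rung u = layerEdge i e → i = m :=
    fun u m i e h => absurd h (rung_ne_layerEdge u i e)
  have hll : ∀ (m : Fin 2) (e : Sym2 V) (i : Fin 2) (e' : Sym2 V),
      layerEdge m e = layerEdge i e' → i = m := fun m e i e' h => (layerEdge_inj h).1.symm
  let S : Set (Sym2 V) := {e | (∃ u a, φ (rung u) = some a ∧ a ≠ c ∧ g (rung u) = e) ∨
    ∃ i, φ (layerEdge i e) = some c}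
  have hSmem : ∀ e ∈ S, ∃ x ∈ Precolored φ, g x = e ∧
      ((∃ u a, x = rung u ∧ φ x = some a ∧ a ≠ c) ∨
        ∃ i, x = layerEdge i e ∧ φ x = some c ∧ ∀ i', j i' = i) := by
    rintro e (⟨u, a, h, hac, rfl⟩ | ⟨i, h⟩)
    · exact ⟨rung u, hcoe _ _ h, rfl, Or.inl ⟨u, a, rfl, h, hac⟩⟩
    · exact ⟨layerEdge i e, hcoe _ _ h, hgl i e, Or.inr ⟨i, rfl, h, hjc i e h⟩⟩
  obtain ⟨D, hD, hDt, hin, hout, hrin, hrout⟩ := exists_swapped_coloring hc (fun i => C (j i))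
    (fun i => (hCj i).1) (fun i => (hCj i).2.1) S
    (by
      intro e he
      obtain ⟨x, hx, rfl, -⟩ := hSmem e he
      exact hgG x hx)
    (by
      intro e he f hf hef v
      obtain ⟨x, hx, hxe, hx'⟩ := hSmem e he
      obtain ⟨y, hy, hyf, hy'⟩ := hSmem f hf
      subst hxe hyf
      have hne : x ≠ y := fun h => hef (h ▸ rfl)
      refine hg (j 0) x hx y hy ?_ ?_ hne v
      · rcases hx' with ⟨u, -, rfl, -⟩ | ⟨i, hxi, -, hi⟩
        · exact hrl u _
        · rw [hxi, hi]
          exact hll i _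
      · rcases hy' with ⟨u, -, rfl, -⟩ | ⟨i, hyi, -, hi⟩
        · exact hrl u _
        · rw [hyi, hi]
          exact hll i _)
    (by
      intro i e he
      obtain ⟨x, hx, rfl, ⟨u, a, rfl, ha, hac⟩ | ⟨i', -, -, hi'⟩⟩ := hSmem e he
      · exact ((hCj i).2.2 _ a ha hac (hrl u _)).trans ((hCj 0).2.2 _ a ha hac (hrl u _)).symm
      · simp only [hi'])
  refine ⟨D, hD, hDt, fun x a hxa => ?_⟩
  rcases mem_edgeSet_boxProd_top.1 (hφG (hcoe x a hxa)) with ⟨u, rfl⟩ | ⟨i, e, he, rfl⟩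
  · by_cases hac : a = c
    · subst hac
      refine hrout u fun e he hu => ?_
      obtain ⟨y, hy, rfl, hy'⟩ := hSmem e he
      have hne : rung u ≠ y := by
        rintro rfl
        rcases hy' with ⟨-, b, -, hb, hba⟩ | ⟨i, h, -⟩
        · exact hba (Option.some_inj.1 (hb.symm.trans hxa))
        · exact rung_ne_layerEdge _ _ _ h
      refine hg (j 0) _ (hcoe _ _ hxa) y hy (hrl u _) ?_ hne u (hgr u) hu
      rcases hy' with ⟨w, -, rfl, -⟩ | ⟨i, hyi, -, hi⟩
      · exact hrl w _
      · rw [hyi, hi]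
        exact hll i _
    · rw [hrin (g (rung u)) (Or.inl ⟨u, a, hxa, hac, rfl⟩) u (hgr u)]
      exact (hCj 0).2.2 _ a hxa hac (hrl u _)
  · have hji : j i = i := hj i e (by simp [hxa])
    by_cases hac : a = c
    · subst hac
      exact hin i e (Or.inr ⟨i, hxa⟩)
    · rw [hout i e]
      · have := (hCj i).2.2 _ a hxa hac (by rw [hji]; exact hll i e)
        rwa [hgl] at this
      · intro heS
        obtain ⟨y, hy, hye, hy'⟩ := hSmem e heS
        have hne : layerEdge i e ≠ y := by
          rintro rfl
          rcases hy' with ⟨u, -, h, -⟩ | ⟨-, -, h, -⟩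
          · exact rung_ne_layerEdge _ _ _ h.symm
          · exact hac (Option.some_inj.1 (hxa.symm.trans h))
        have hv := e.out_fst_mem
        refine hg i _ (hcoe _ _ hxa) y hy (hll i e) ?_ hne _ (by rwa [hgl]) (by rwa [hye])
        rcases hy' with ⟨w, -, rfl, -⟩ | ⟨i', hyi, -, hi⟩
        · exact hrl w _
        · rw [hyi, ← hji, hi]
          exact hll i' _

lemma degree_le_of_coloring [Fintype V] {G : SimpleGraph V} [DecidableRel G.Adj] {t : ℕ}
    {C : Sym2 V → ℕ} (hC : IsProperEdgeColoring G C) (hCt : ColorsBelow G C t) (v : V) :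
    G.degree v ≤ t := by
  rw [← Finset.card_range t]
  refine Finset.card_le_card_of_injOn (fun w => C s(v, w)) (fun w hw => ?_) fun w hw w' hw' h => ?_
  · have : G.Adj v w := by simpa using hw
    simpa using hCt s(v, w) this
  · have h1 : G.Adj v w := by simpa using hw
    have h2 : G.Adj v w' := by simpa using hw'
    by_contra hne
    exact hC (e := s(v, w)) (f := s(v, w')) ⟨h1, h2, fun h => hne (Sym2.congr_right.1 h), v,
      Sym2.mem_mk_left _ _, Sym2.mem_mk_left _ _⟩ h

lemma exists_unused_color {W : Type*} [Finite W] (φ : W → Option ℕ) {t : ℕ}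
    (h : {x | φ x ≠ none}.ncard < t) : ∃ c < t, ∀ x, φ x ≠ some c := by
  classical
  by_contra! hcon
  have hsub : (Finset.range t : Set ℕ) ⊆ (fun x => (φ x).getD 0) '' {x | φ x ≠ none} := by
    intro c hc
    obtain ⟨x, hx⟩ := hcon c (by simpa using hc)
    exact ⟨x, by simp [hx], by simp [hx]⟩
  have h1 := Set.ncard_le_ncard hsub (Set.toFinite _)
  rw [Set.ncard_coe_finset, Finset.card_range] at h1
  have h2 := Set.ncard_image_le (f := fun x => (φ x).getD 0) (Set.toFinite {x | φ x ≠ none})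
  omega

theorem stmt15 [Fintype V] (G : SimpleGraph V) [DecidableRel G.Adj]
    (hreg : G.IsRegularOfDegree G.maxDegree)
    (k : ℕ) (hk : 2*k < G.maxDegree)
    (hext : ∀ φ : Sym2 V → Option ℕ, IsPartialProperEdgeColoring G φ →
      UsesColors φ (chromaticIndex G) → IndependentEdges (Precolored φ) →
      (Precolored φ).ncard ≤ k → Extendable G φ (chromaticIndex G)) :
    ∀ φ : Sym2 (V × Fin 2) → Option ℕ,
      IsPartialProperEdgeColoring (G.boxProd (⊤ : SimpleGraph (Fin 2))) φ →
      UsesColors φ (chromaticIndex G + 1) → IndependentEdges (Precolored φ) →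
      (Precolored φ).ncard ≤ k + 1 →
      Extendable (G.boxProd (⊤ : SimpleGraph (Fin 2))) φ (chromaticIndex G + 1) := by
  classical
  intro φ hφ hφt hI hφk
  have hlt : k < chromaticIndex G := by
    obtain ⟨C, hC, hCt, -⟩ := hext (fun _ => none) ⟨by simp, by simp⟩ (by simp [UsesColors])
      (by simp [IndependentEdges, Precolored]) (by simp [Precolored])
    have : Nonempty V := by
      by_contra h
      rw [not_nonempty_iff] at h
      simp at hk
    obtain ⟨v⟩ := this
    have h1 := degree_le_of_coloring hC hCt v
    have h2 := hreg v
    omega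
  have hstrict : ∀ K ⊆ Precolored φ, ∀ x ∈ Precolored φ, x ∉ K → K.ncard ≤ k := by
    intro K hKs x hx hxK
    have := Set.ncard_lt_ncard ⟨hKs, fun h => hxK (h hx)⟩ (Set.toFinite (Precolored φ))
    omega
  by_cases hboth : ∀ i, ∃ e, φ (layerEdge i e) ≠ none
  · obtain ⟨c, hc, hcφ⟩ := exists_unused_color φ (t := chromaticIndex G + 1)
      (show (Precolored φ).ncard < _ by omega)
    refine extendable_boxProd_of_color hreg hk hext φ hφ.1 hφt hI hφk c hc id (fun _ _ _ => rfl)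
      (fun i e h => absurd h (hcφ _)) fun i => ?_
    obtain ⟨e, he⟩ := hboth (i + 1)
    refine hstrict _ (fun x hx => hx.1) _ he fun h => ?_
    have := h.2.2 _ e rfl
    fin_cases i <;> simp at this
  · push Not at hboth
    obtain ⟨i₁, hi₁⟩ := hboth
    have hlayer : ∀ i e, φ (layerEdge i e) ≠ none → i₁ + 1 = i := by
      intro i e h
      have : i ≠ i₁ := fun hi => h (hi ▸ hi₁ e)
      omega
    by_cases hne : ∃ x a, φ x = some a
    · obtain ⟨x, c, hx⟩ := hne
      exact extendable_boxProd_of_color hreg hk hext φ hφ.1 hφt hI hφk c (hφt x c hx)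
        (fun _ => i₁ + 1) hlayer (fun i e h _ => hlayer i e (by simp [h])) fun i =>
        hstrict _ (fun y hy => hy.1) x (by simp [Precolored, hx]) fun h => h.2.1 hx
    · push Not at hne
      have hnone : ∀ x, φ x = none := fun x => Option.eq_none_iff_forall_ne_some.2 (hne x)
      exact extendable_boxProd_of_color hreg hk hext φ hφ.1 hφt hI hφk 0 (Nat.succ_pos _)
        (fun _ => i₁ + 1) hlayer (fun i e h => absurd h (hne _ _)) fun i => by simp [hnone]
end
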